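/- For any quasi-compact quasi-separated scheme X, there is an integer s > 0 such that for every integer a, every a-locally projective O_X-complex E, and every G ∈ D_qc(X) with H^j(G) = 0 for all j > a − s, one has Hom_{D(X)}(E, G) = 0. -/

import Mathlib

/-!
Setup for statements about a (quasi-compact, quasi-separated) scheme `X`:

* `X.Modules` is the abelian category of sheaves of `O_X`-modules;
* for `U : X.Opens`, `ModOver X U` is the category of `O_U`-modules (sheaves of modules
  over the restriction of the structure sheaf to the localized site at `U`), and
  `restrictComplex X U` restricts complexes of `O_X`-modules to `U`;
* `D(X)` is `DerivedCategory X.Modules`, and `D_qc(X)` consists of the objects all of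
  whose homology sheaves are quasi-coherent;
* `StrictlyPerfect` means a bounded complex of finite-rank free modules;
* `IsNIsoD n ξ` says that `ξ` is an `n`-isomorphism: `H^j(ξ)` is invertible for `j > n`
  and surjective (epi) for `j = n`;
* `IsPseudoCoherent X n E` says that, locally on some open cover, `E` admits an
  `n`-isomorphism from a strictly perfect complex, and `IsPerfect X E` says that `E` is
  locally `D`-isomorphic to a strictly perfect complex.
-/

open CategoryTheory CategoryTheory.Limits AlgebraicGeometry TopologicalSpace

universe u

noncomputable section

namespace LN

variable (X : Scheme.{u})

/-- The category of `O_U`-modules, for an open `U` of the scheme `X`. -/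
abbrev ModOver (U : X.Opens) : Type (u + 1) :=
  SheafOfModules.{u} (X.ringCatSheaf.over U)

/-- Restriction of sheaves of `O_X`-modules to an open `U`. -/
abbrev restrictionFunctor (U : X.Opens) : X.Modules ⥤ ModOver X U :=
  SheafOfModules.pushforward (𝟙 _)

instance (U : X.Opens) : (restrictionFunctor X U).Additive := by
  constructor; intro A B f g; ext1; ext1; rfl

/-- Restriction of complexes of `O_X`-modules to an open `U`. -/
abbrev restrictComplex (U : X.Opens) :
    CochainComplex X.Modules ℤ ⥤ CochainComplex (ModOver X U) ℤ :=
  (restrictionFunctor X U).mapHomologicalComplex _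

/-- A strictly perfect complex on `U`: a bounded complex of finite-rank free modules. -/
def StrictlyPerfect (U : X.Opens) (P : CochainComplex (ModOver X U) ℤ) : Prop :=
  (∃ a b : ℤ, ∀ i : ℤ, (i < a ∨ b < i) → IsZero (P.X i)) ∧
    ∀ i : ℤ, ∃ k : ℕ, Nonempty (P.X i ≅ SheafOfModules.free (ULift.{u} (Fin k)))

/-- `ξ` is an `n`-isomorphism: `H^j(ξ)` is bijective for `j > n` and surjective
for `j = n`. -/
def IsNIsoD {C : Type u₁} [Category.{v₁} C] [Abelian C] [HasDerivedCategory.{w₁} C]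
    (n : ℤ) {P E : DerivedCategory C} (ξ : P ⟶ E) : Prop :=
  (∀ j : ℤ, n < j → IsIso ((DerivedCategory.homologyFunctor C j).map ξ)) ∧
    Epi ((DerivedCategory.homologyFunctor C n).map ξ)

/-- `E` is an `n`-pseudo-coherent complex of `O_X`-modules: on each member `U α` of some
open cover of `X` there is an `n`-isomorphism `P ⟶ E|_{U α}` in `D(U α)` with `P`
strictly perfect. -/
def IsPseudoCoherent [∀ U : X.Opens, HasDerivedCategory.{u + 1} (ModOver X U)]
    (n : ℤ) (E : CochainComplex X.Modules ℤ) : Prop :=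
  ∃ (ι : Type u) (U : ι → X.Opens),
    iSup U = ⊤ ∧
    ∀ α : ι, ∃ P : CochainComplex (ModOver X (U α)) ℤ,
      StrictlyPerfect X (U α) P ∧
      ∃ ξ : DerivedCategory.Q.obj P ⟶ DerivedCategory.Q.obj ((restrictComplex X (U α)).obj E),
        IsNIsoD n ξ

/-- `E` is a perfect complex of `O_X`-modules: locally on some open cover of `X`, it is
`D`-isomorphic to a strictly perfect complex. -/
def IsPerfect [∀ U : X.Opens, HasDerivedCategory.{u + 1} (ModOver X U)]
    (E : CochainComplex X.Modules ℤ) : Prop :=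
  ∃ (ι : Type u) (U : ι → X.Opens),
    iSup U = ⊤ ∧
    ∀ α : ι, ∃ P : CochainComplex (ModOver X (U α)) ℤ,
      StrictlyPerfect X (U α) P ∧
      Nonempty
        (DerivedCategory.Q.obj ((restrictComplex X (U α)).obj E) ≅ DerivedCategory.Q.obj P)

/-- The complex `E` lies in `D_qc(X)`: all its homology sheaves are quasi-coherent. -/
def MemDqc (E : CochainComplex X.Modules ℤ) : Prop :=
  ∀ n : ℤ, (E.homology n).IsQuasicoherent

end LN

namespace LN

variable (X : Scheme.{u})

/-- An `O_X`-complex `E` is *`a`-locally projective* if there are an integer `b ≥ a` and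
a finite affine open cover `(U α)` of `X` such that each restriction `E|_{U α}` is
`D(U α)`-isomorphic to a quasi-coherent direct summand of a complex `F` of free
`O_{U α}`-modules with `F` vanishing in all degrees outside `[a, b]`. -/
def IsALocallyProjective [∀ U : X.Opens, HasDerivedCategory.{u + 1} (ModOver X U)]
    (a : ℤ) (E : CochainComplex X.Modules ℤ) : Prop :=
  ∃ b : ℤ, a ≤ b ∧
    ∃ (ι : Type u) (_ : Finite ι) (U : ι → X.Opens),
      (∀ α : ι, IsAffineOpen (U α)) ∧ iSup U = ⊤ ∧
      ∀ α : ι, ∃ F G : CochainComplex (ModOver X (U α)) ℤ,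
        (∀ i : ℤ, ∃ κ : Type u, Nonempty (F.X i ≅ SheafOfModules.free κ)) ∧
        (∀ i : ℤ, (i < a ∨ b < i) → IsZero (F.X i)) ∧
        (∀ i : ℤ, (G.X i).IsQuasicoherent) ∧
        (∃ (s : G ⟶ F) (ρ : F ⟶ G), s ≫ ρ = 𝟙 G) ∧
        Nonempty (DerivedCategory.Q.obj ((restrictComplex X (U α)).obj E) ≅
          DerivedCategory.Q.obj G)

end LN

namespace LN

variable {X : Scheme.{u}}

/-- Restriction of sections of an `O_X`-module. -/
def res (M : X.Modules) {V W : X.Opens} (h : V ≤ W) : Γ(M, W) →+ Γ(M, V) :=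
  (M.presheaf.map (homOfLE h).op).hom

lemma res_self (M : X.Modules) {V : X.Opens} (h : V ≤ V) (s : Γ(M, V)) : res M h s = s := by
  have : (homOfLE h).op = 𝟙 (Opposite.op V) := rfl
  unfold res
  rw [this, M.presheaf.map_id]
  rfl

lemma res_res (M : X.Modules) {V W Z : X.Opens} (h : V ≤ W) (h' : W ≤ Z) (s : Γ(M, Z)) :
    res M h (res M h' s) = res M (h.trans h') s := by
  unfold res
  have : (homOfLE (h.trans h')).op = (homOfLE h').op ≫ (homOfLE h).op := rfl
  rw [this, M.presheaf.map_comp]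
  rfl

lemma res_smul (M : X.Modules) {V W : X.Opens} (h : V ≤ W) (a : Γ(X, W)) (s : Γ(M, W)) :
    res M h (a • s) = X.presheaf.map (homOfLE h).op a • res M h s :=
  M.map_smul (homOfLE h) a s

lemma app_res {M N : X.Modules} (f : M ⟶ N) {V W : X.Opens} (h : V ≤ W) (s : Γ(M, W)) :
    f.app V (res M h s) = res N h (f.app W s) :=
  ConcreteCategory.congr_hom (f.mapPresheaf.naturality (homOfLE h).op) s

lemma comp_app_apply {M N K : X.Modules} (f : M ⟶ N) (g : N ⟶ K) (V : X.Opens) (s : Γ(M, V)) :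
    (f ≫ g).app V s = g.app V (f.app V s) := rfl

lemma hom_ext_apply {M N : X.Modules} {f g : M ⟶ N}
    (h : ∀ V (s : Γ(M, V)), f.app V s = g.app V s) : f = g := by
  apply Scheme.Modules.hom_ext
  intro U
  ext s
  exact h U s

lemma eq_of_locally (M : X.Modules) {V : X.Opens} (s t : Γ(M, V))
    (h : ∀ x ∈ V, ∃ (W : X.Opens) (hW : W ≤ V), x ∈ W ∧ res M hW s = res M hW t) : s = t := by
  choose W hW hx e using h
  refine TopCat.Sheaf.eq_of_locally_eq' (⟨M.presheaf, M.isSheaf⟩ : TopCat.Sheaf Ab X)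
    (fun x : V ↦ W x x.2) V (fun x ↦ homOfLE (hW x x.2)) ?_ s t fun i ↦ e i i.2
  intro x hxV
  exact Opens.mem_iSup.2 ⟨⟨x, hxV⟩, hx x hxV⟩

lemma eq_zero_of_locally (M : X.Modules) {V : X.Opens} (s : Γ(M, V))
    (h : ∀ x ∈ V, ∃ (W : X.Opens) (hW : W ≤ V), x ∈ W ∧ res M hW s = 0) : s = 0 :=
  eq_of_locally M s 0 fun x hx ↦ by
    obtain ⟨W, hW, hxW, e⟩ := h x hx
    exact ⟨W, hW, hxW, by rw [e, map_zero]⟩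

lemma app_injective_of_mono {M N : X.Modules} (f : M ⟶ N) [Mono f] (V : X.Opens) :
    Function.Injective (f.app V) := by
  have : Mono ((Scheme.Modules.toPresheaf X).map f) := inferInstance
  have : Mono (((Scheme.Modules.toPresheaf X).map f).app (.op V)) := inferInstance
  exact (AddCommGrpCat.mono_iff_injective _).1 this

/-- `s` is locally in the family of subsets `P`. -/
def LocallyIn (M : X.Modules) (P : ∀ V : X.Opens, Set Γ(M, V)) {V : X.Opens} (s : Γ(M, V)) : Prop :=
  ∀ x ∈ V, ∃ (W : X.Opens) (hW : W ≤ V), x ∈ W ∧ res M hW s ∈ P W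

/-- Sections locally belonging to a stable family of submodules are detected by a morphism. -/
lemma exists_hom_detecting (M : X.Modules) (P : ∀ V : X.Opens, Submodule Γ(X, V) Γ(M, V))
    (hP : ∀ {V W : X.Opens} (h : V ≤ W) (s : Γ(M, W)), s ∈ P W → res M h s ∈ P V) :
    ∃ (C : X.Modules) (c : M ⟶ C), ∀ (V : X.Opens) (s : Γ(M, V)),
      c.app V s = 0 ↔ LocallyIn M (fun W ↦ P W) s := by
  let N : PresheafOfModules.Submodule M.val :=
    { obj := fun V ↦ P V.unop
      map := fun {V W} f s hs ↦ hP f.unop.le s hs }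
  let Q := cokernel N.ι
  let q : M.val ⟶ Q := cokernel.π N.ι
  let C : X.Modules := (PresheafOfModules.sheafification (𝟙 X.ringCatSheaf.obj)).obj Q
  let t : Q ⟶ C.val := (PresheafOfModules.sheafificationAdjunction (𝟙 X.ringCatSheaf.obj)).unit.app Q
  have hq : ∀ V (s : M.val.obj (.op V)), (q.app (.op V)).hom s = 0 ↔ s ∈ P V := by
    intro V s
    have ex : (ShortComplex.mk N.ι q (cokernel.condition _)).Exact :=
      ShortComplex.exact_of_g_is_cokernel _ (cokernelIsCokernel N.ι)
    have ex' := ex.map (PresheafOfModules.evaluation X.ringCatSheaf.obj (.op V))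
    rw [ShortComplex.moduleCat_exact_iff] at ex'
    constructor
    · intro h
      obtain ⟨y, hy⟩ := ex' s h
      rw [← hy]
      exact Subtype.property (p := fun z ↦ z ∈ N.obj (.op V)) y
    · intro h
      have := congr((PresheafOfModules.Hom.app $(cokernel.condition N.ι) (.op V)).hom
        (⟨s, h⟩ : N.obj (.op V)))
      exact this
  let c : M ⟶ C := (⟨q ≫ t⟩ : SheafOfModules.Hom M C)
  have hres : ∀ {V W : X.Opens} (h : W ≤ V) (s : Γ(M, V)), 
    (Q.map (homOfLE h).op) ((q.app (.op V)) s) = (q.app (.op W)) (res M h s) := fun h s ↦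
    (PresheafOfModules.naturality_apply q (homOfLE h).op s).symm
  refine ⟨C, c, fun V s ↦ ⟨fun h x hx ↦ ?_, fun h ↦ ?_⟩⟩
  · have hinj : Presheaf.IsLocallyInjective (Opens.grothendieckTopology X)
        (CategoryTheory.toSheafify (Opens.grothendieckTopology X) Q.presheaf) := inferInstance
    have hs := Presheaf.equalizerSieve_mem (Opens.grothendieckTopology X)
      (CategoryTheory.toSheafify (Opens.grothendieckTopology X) Q.presheaf)
      (X := .op V) (q.app (.op V) s) 0 (by rw [map_zero]; exact h)
    obtain ⟨W, i, hi, hxW⟩ := hs x hx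
    refine ⟨W, i.le, hxW, (hq W _).1 ?_⟩
    have e : Q.presheaf.map i.op (q.app (.op V) s) = Q.presheaf.map i.op 0 := hi
    rw [map_zero] at e
    rw [← hres]
    exact e
  · refine eq_zero_of_locally _ _ fun x hx ↦ ?_
    obtain ⟨W, hW, hxW, e⟩ := h x hx
    refine ⟨W, hW, hxW, ?_⟩
    rw [← app_res]
    have : q.app (.op W) (res M hW s) = 0 := (hq W _).2 e
    show (t.app (.op W)) (q.app (.op W) (res M hW s)) = 0
    rw [this, map_zero]

end LN

namespace LN

variable {X : Scheme.{u}}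

/-- An epimorphism is locally surjective on sections. -/
lemma exists_local_lift {M N : X.Modules} (f : M ⟶ N) [Epi f] {V : X.Opens} (s : Γ(N, V))
    {x : X} (hx : x ∈ V) : ∃ (W : X.Opens) (hW : W ≤ V), x ∈ W ∧
      ∃ t : Γ(M, W), f.app W t = res N hW s := by
  obtain ⟨C, c, hc⟩ := exists_hom_detecting N
    (fun V ↦ { carrier := Set.range (f.app V)
               add_mem' := by
                rintro _ _ ⟨a, rfl⟩ ⟨b, rfl⟩
                exact ⟨a + b, map_add _ _ _⟩
               zero_mem' := ⟨0, map_zero _⟩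
               smul_mem' := by
                rintro r _ ⟨a, rfl⟩
                exact ⟨r • a, f.app_smul r a⟩ })
    (by
      rintro V W h _ ⟨a, rfl⟩
      exact ⟨res M h a, app_res f h a⟩)
  have hfc : f ≫ c = 0 := hom_ext_apply fun V s ↦
    (hc V _).2 fun x hx ↦ ⟨V, le_rfl, hx, res M le_rfl s, app_res f _ s⟩
  have hc0 : c = 0 := by rw [← cancel_epi f, hfc, comp_zero]
  obtain ⟨W, hW, hxW, h⟩ := (hc V s).1 (by rw [hc0]; rfl) x hx
  exact ⟨W, hW, hxW, h⟩

section
variable (X) (U : X.Opens)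

/-- The category of modules over an open, as a type of its own. -/
def OpenMod : Type (u + 1) := ModOver X U

instance : Category.{u} (OpenMod X U) := inferInstanceAs (Category.{u} (ModOver X U))
instance : Abelian (OpenMod X U) := inferInstanceAs (Abelian (ModOver X U))

/-- Restriction to an open. -/
def rest : X.Modules ⥤ OpenMod X U := restrictionFunctor X U

/-- The right adjoint of the restriction to an open. -/
def restRightAdjoint : OpenMod X U ⥤ X.Modules :=
  (Scheme.Modules.overEquiv U).functor ⋙ Scheme.Modules.pushforward U.ι

/-- The adjunction between restriction and direct image. -/
def restAdj : rest X U ⊣ restRightAdjoint X U :=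
  (((Scheme.Modules.restrictAdjunction U.ι).comp
    (Scheme.Modules.overEquiv U).symm.toAdjunction)).ofNatIsoLeft
    ((Functor.isoWhiskerRight (Scheme.Modules.overFunctorEquiv U).symm _ ) ≪≫
      Functor.associator _ _ _ ≪≫
      Functor.isoWhiskerLeft _ (Scheme.Modules.overEquiv U).unitIso.symm ≪≫
      Functor.rightUnitor _)

instance : (restRightAdjoint X U).Full := by
  have : (Scheme.Modules.pushforward U.ι).Full := 
    (Scheme.Modules.restrictAdjunction U.ι).fullyFaithfulROfIsIsoCounit.full
  exact Functor.Full.comp (Scheme.Modules.overEquiv U).functor (Scheme.Modules.pushforward U.ι)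

instance : (restRightAdjoint X U).Faithful := by
  have : (Scheme.Modules.pushforward U.ι).Faithful := 
    (Scheme.Modules.restrictAdjunction U.ι).fullyFaithfulROfIsIsoCounit.faithful
  exact Functor.Faithful.comp (Scheme.Modules.overEquiv U).functor (Scheme.Modules.pushforward U.ι)

instance : (rest X U).IsRightAdjoint := by
  have h1 : (PresheafOfModules.pushforward.{u} (F := Over.forget U) (R := X.ringCatSheaf.obj)
      (S := (X.ringCatSheaf.over U).obj)
      (𝟙 (X.ringCatSheaf.over U) : X.ringCatSheaf.over U ⟶ X.ringCatSheaf.over U).hom).IsRightAdjoint :=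
    @PresheafOfModules.instIsRightAdjointPushforward (Over U) X.Opens inferInstance inferInstance
      (Over.forget U) X.ringCatSheaf.obj _ _
  exact @SheafOfModules.instIsRightAdjointPushforward _ _ _ _ _ _ (Over.forget U) _ _ inferInstance
    (𝟙 (X.ringCatSheaf.over U)) h1 inferInstance inferInstance

/-- Extension by zero from an open. -/
def extZero : OpenMod X U ⥤ X.Modules := (rest X U).leftAdjoint

/-- Extension by zero is left adjoint to restriction. -/
def extAdj : extZero X U ⊣ rest X U := Adjunction.ofIsRightAdjoint _

instance : (rest X U).Additive := inferInstanceAs (restrictionFunctor X U).Additive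
instance : (extZero X U).IsLeftAdjoint := (extAdj X U).isLeftAdjoint
instance : (rest X U).IsLeftAdjoint := (restAdj X U).isLeftAdjoint

/-- Extension by zero is fully faithful. -/
def extZeroFF : (extZero X U).FullyFaithful :=
  (Adjunction.Triple.mk (extAdj X U) (restAdj X U)).fullyFaithfulEquiv.symm
    (Functor.FullyFaithful.ofFullyFaithful _)

instance : (extZero X U).Full := (extZeroFF X U).full
instance : (extZero X U).Faithful := (extZeroFF X U).faithful
instance : IsIso (extAdj X U).unit := inferInstance
instance : (extZero X U).Additive := (extAdj X U).left_adjoint_additive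

/-- The functor sending a module to the extension by zero of its restriction to an open. -/
def cut : X.Modules ⥤ X.Modules := rest X U ⋙ extZero X U

instance : (cut X U).Additive := by unfold cut; infer_instance

/-- The counit map. -/
def cutε : cut X U ⟶ 𝟭 _ := (extAdj X U).counit
end

lemma rest_map_eq_zero_iff {A B : X.Modules} (f : A ⟶ B) (U : X.Opens) :
    (rest X U).map f = 0 ↔ ∀ V ≤ U, ∀ s : Γ(A, V), f.app V s = 0 := by
  constructor
  · intro h V hV s
    exact congr(($(h).val.app (.op (Over.mk (homOfLE hV)))).hom s)
  · intro h
    apply SheafOfModules.hom_ext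
    ext V s
    exact h V.unop.left V.unop.hom.le s

/-- The sections of `B` are locally zero outside `U`. -/
def IsSupp (U : X.Opens) (B : X.Modules) : Prop :=
  ∀ V (s : Γ(B, V)), LocallyIn B (fun W ↦ {t | W ≤ U ∨ t = 0}) s

lemma isSupp_extZero (U : X.Opens) (A : OpenMod X U) : IsSupp U ((extZero X U).obj A) := by
  intro V s
  classical
  obtain ⟨C, c, hc⟩ := exists_hom_detecting ((extZero X U).obj A)
    (fun V ↦ if V ≤ U then ⊤ else ⊥) (by
      intro V W h s hs
      split_ifs at hs with h1
      · rw [if_pos (h.trans h1)]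
        trivial
      · rw [(Submodule.mem_bot _).1 hs, map_zero]
        exact zero_mem _)
  have h0 : (rest X U).map c = 0 := by
    rw [rest_map_eq_zero_iff]
    intro V hV s
    rw [hc]
    refine fun x hx ↦ ⟨V, le_rfl, hx, ?_⟩
    beta_reduce
    rw [if_pos hV]
    trivial
  have hc0 : c = 0 := by
    apply ((extAdj X U).homEquiv _ _).injective
    rw [Adjunction.homEquiv_unit, Adjunction.homEquiv_unit, h0, Functor.map_zero]
  intro x hx
  obtain ⟨W, hW, hxW, h⟩ := (hc V s).1 (by rw [hc0]; rfl) x hx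
  refine ⟨W, hW, hxW, ?_⟩
  beta_reduce at h
  split_ifs at h with h1
  · exact Or.inl h1
  · exact Or.inr ((Submodule.mem_bot _).1 h)

namespace IsSupp

variable {U : X.Opens} {A B : X.Modules}

lemma le {U' : X.Opens} (h : IsSupp U B) (hU : U ≤ U') : IsSupp U' B := fun V s x hx ↦ by
  obtain ⟨W, hW, hxW, h⟩ := h V s x hx
  exact ⟨W, hW, hxW, h.imp (fun h ↦ h.trans hU) id⟩

lemma of_mono (h : IsSupp U B) (f : A ⟶ B) [Mono f] : IsSupp U A := fun V s x hx ↦ by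
  obtain ⟨W, hW, hxW, h⟩ := h V (f.app V s) x hx
  refine ⟨W, hW, hxW, h.imp id fun h ↦ app_injective_of_mono f W ?_⟩
  rw [app_res, map_zero]
  exact h

lemma of_epi (h : IsSupp U A) (f : A ⟶ B) [Epi f] : IsSupp U B := fun V s x hx ↦ by
  obtain ⟨V', hV', hxV', t, ht⟩ := exists_local_lift f s hx
  obtain ⟨W, hW, hxW, h⟩ := h V' t x hxV'
  refine ⟨W, hW.trans hV', hxW, h.imp id fun h ↦ ?_⟩
  rw [← res_res B hW hV', ← ht, ← app_res, show res A hW t = 0 from h, map_zero]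

lemma hom_eq_zero (h : IsSupp U A) (f : A ⟶ B) (hf : ∀ V ≤ U, ∀ s : Γ(A, V), f.app V s = 0) :
    f = 0 := by
  refine hom_ext_apply fun V s ↦ eq_zero_of_locally B _ fun x hx ↦ ?_
  obtain ⟨W, hW, hxW, h⟩ := h V s x hx
  refine ⟨W, hW, hxW, ?_⟩
  rw [← app_res]
  obtain h | h := h
  · exact hf W h _
  · rw [show res A hW s = 0 from h, map_zero]

lemma hom_eq_zero' (h : IsSupp U A) (f : A ⟶ B) (hf : (rest X U).map f = 0) :
    f = 0 :=
  h.hom_eq_zero f ((rest_map_eq_zero_iff f U).1 hf)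

lemma isZero (h : IsSupp U A) (hA : IsZero ((rest X U).obj A)) : IsZero A := by
  rw [IsZero.iff_id_eq_zero] at hA ⊢
  apply h.hom_eq_zero'
  rw [CategoryTheory.Functor.map_id, hA]

lemma mono (h : IsSupp U A) (f : A ⟶ B) [Mono ((rest X U).map f)] : Mono f := by
  apply Preadditive.mono_of_kernel_zero
  apply (h.of_mono (kernel.ι f)).hom_eq_zero'
  rw [← cancel_mono ((rest X U).map f), ← Functor.map_comp, kernel.condition,
    Functor.map_zero, zero_comp]

lemma epi (h : IsSupp U B) (f : A ⟶ B) [Epi ((rest X U).map f)] : Epi f := by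
  apply Preadditive.epi_of_cokernel_zero
  apply h.hom_eq_zero'
  rw [← cancel_epi ((rest X U).map f), ← Functor.map_comp, cokernel.condition,
    Functor.map_zero, comp_zero]

lemma isIso (hA : IsSupp U A) (hB : IsSupp U B) (f : A ⟶ B)
    [IsIso ((rest X U).map f)] : IsIso f := by
  have := hA.mono f
  have := hB.epi f
  exact isIso_of_mono_of_epi f

end IsSupp

lemma isSupp_cut (U : X.Opens) (A : X.Modules) : IsSupp U ((cut X U).obj A) := isSupp_extZero _ _

instance (U : X.Opens) (A : OpenMod X U) : IsIso ((extAdj X U).unit.app A) :=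
  inferInstance

instance (U : X.Opens) (A : X.Modules) :
    IsIso ((rest X U).map ((cutε X U).app A)) := by
  have h := (extAdj X U).right_triangle_components A
  have : IsIso ((extAdj X U).unit.app ((rest X U).obj A)) := inferInstance
  exact @isIso_of_hom_comp_eq_id _ _ _ _ ((extAdj X U).unit.app ((rest X U).obj A)) this _ h

instance (U : X.Opens) (A : X.Modules) : Mono ((cutε X U).app A) := (isSupp_cut U A).mono _

lemma IsSupp.isIso_cutε {U : X.Opens} {A : X.Modules} (h : IsSupp U A) :
    IsIso ((cutε X U).app A) := (isSupp_cut U A).isIso h _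

instance (U : X.Opens) : (extZero X U).PreservesMonomorphisms where
  preserves f _ := by
    have : Mono ((rest X U).map ((extZero X U).map f)) := by
      have h := (extAdj X U).unit.naturality f
      have h2 : (rest X U).map ((extZero X U).map f) =
        inv ((extAdj X U).unit.app _) ≫ f ≫ (extAdj X U).unit.app _ := by
        rw [IsIso.eq_inv_comp]; exact h.symm
      rw [h2]
      infer_instance
    exact (isSupp_extZero U _).mono _

instance (U : X.Opens) : (extZero X U).PreservesHomology :=
  Functor.preservesHomology_of_preservesMonos_and_cokernels _

instance (U : X.Opens) : PreservesFiniteLimits (extZero X U) :=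
  (extZero X U).preservesFiniteLimits_of_preservesHomology

instance (U : X.Opens) : PreservesFiniteColimits (extZero X U) :=
  (extZero X U).preservesFiniteColimits_of_preservesHomology

instance (U : X.Opens) : PreservesFiniteLimits (rest X U) := inferInstance
instance (U : X.Opens) : PreservesFiniteColimits (rest X U) := inferInstance

instance (U : X.Opens) : PreservesFiniteLimits (cut X U) := by unfold cut; infer_instance
instance (U : X.Opens) : PreservesFiniteColimits (cut X U) := by unfold cut; infer_instance

end LN

namespace LN

variable {X : Scheme.{u}}

section
variable (X)

/-- The structure sheaf as a module over itself. -/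
def unitMod : X.Modules := SheafOfModules.unit X.ringCatSheaf

/-- The structure sheaf of an open, extended by zero. -/
def OO (U : X.Opens) : X.Modules := (cut X U).obj (unitMod X)
end

/-- The inclusion of the extension by zero of the structure sheaf of an open. -/
def OOε (U : X.Opens) : OO X U ⟶ unitMod X := (cutε X U).app (unitMod X)

instance (U : X.Opens) : Mono (OOε U) := inferInstanceAs (Mono ((cutε X U).app (unitMod X)))

lemma isSupp_OO (U : X.Opens) : IsSupp U (OO X U) := isSupp_cut _ _

/-- The section `1` of the structure sheaf. -/
def unitOne (V : X.Opens) : Γ(unitMod X, V) := (1 : Γ(X, V))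

lemma res_unitOne {V W : X.Opens} (h : V ≤ W) : res (unitMod X) h (unitOne W) = unitOne V :=
  map_one (X.presheaf.map (homOfLE h).op).hom

lemma eq_smul_unitOne {V : X.Opens} (s : Γ(unitMod X, V)) : ∃ a : Γ(X, V), s = a • unitOne V :=
  ⟨s, (mul_one (show Γ(X, V) from s)).symm⟩

lemma exists_rest_unit_hom {U : X.Opens} {F : X.Modules} (s : Γ(F, U)) :
    ∃ g : (rest X U).obj (unitMod X) ⟶ (rest X U).obj F,
      (SheafOfModules.Hom.val g).app (.op (Over.mk (𝟙 U))) (unitOne U) = s := by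
  let σ : SheafOfModules.sections ((restrictionFunctor X U).obj F) :=
    PresheafOfModules.sectionsMk (M := ((restrictionFunctor X U).obj F).val)
      (fun V ↦ res F V.unop.hom.le s) (fun V W f ↦ res_res F f.unop.left.le V.unop.hom.le s)
  refine ⟨((restrictionFunctor X U).obj F).unitHomEquiv.symm σ, ?_⟩
  have h1 := SheafOfModules.unitHomEquiv_apply_coe ((restrictionFunctor X U).obj F)
    (((restrictionFunctor X U).obj F).unitHomEquiv.symm σ) (.op (Over.mk (𝟙 U)))
  rw [Equiv.apply_symm_apply] at h1
  exact h1.symm.trans (res_self F le_rfl s)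

lemma bijective_of_isIso_rest {A B : X.Modules} (f : A ⟶ B) (U : X.Opens) [IsIso ((rest X U).map f)]
    {V : X.Opens} (hV : V ≤ U) : Function.Bijective (f.app V) := by
  let g := inv ((rest X U).map f)
  let k := (SheafOfModules.Hom.val g).app (.op (Over.mk (homOfLE hV)))
  refine Function.bijective_iff_has_inverse.2 ⟨k, fun s ↦ ?_, fun s ↦ ?_⟩
  · exact congr((SheafOfModules.Hom.val $(IsIso.hom_inv_id ((rest X U).map f))).app
      (.op (Over.mk (homOfLE hV))) s)
  · exact congr((SheafOfModules.Hom.val $(IsIso.inv_hom_id ((rest X U).map f))).app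
      (.op (Over.mk (homOfLE hV))) s)

lemma cutε_bijective {U : X.Opens} (A : X.Modules) {V : X.Opens} (hV : V ≤ U) :
    Function.Bijective (((cutε X U).app A).app V) :=
  bijective_of_isIso_rest _ U hV

lemma exists_OOε_eq {U V : X.Opens} (hV : V ≤ U) : ∃ t : Γ(OO X U, V), (OOε U).app V t = unitOne V :=
  (cutε_bijective (unitMod X) hV).2 _

/-- The canonical section of `OO U` over `U`. -/
def one (U : X.Opens) : Γ(OO X U, U) := (exists_OOε_eq le_rfl).choose

lemma OOε_one (U : X.Opens) : (OOε U).app U (one U) = unitOne U :=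
  (exists_OOε_eq (le_refl U)).choose_spec

lemma eq_smul_one {U V : X.Opens} (hV : V ≤ U) (s : Γ(OO X U, V)) :
    ∃ a : Γ(X, V), s = a • res _ hV (one U) := by
  obtain ⟨a, ha⟩ := eq_smul_unitOne ((OOε U).app V s)
  refine ⟨a, app_injective_of_mono (OOε U) V ?_⟩
  rw [ha, Scheme.Modules.Hom.app_smul, app_res, OOε_one, res_unitOne]

lemma OO_hom_ext {U : X.Opens} {F : X.Modules} {f g : OO X U ⟶ F}
    (h : f.app U (one U) = g.app U (one U)) : f = g := by
  rw [← sub_eq_zero]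
  apply (isSupp_OO U).hom_eq_zero
  intro V hV s
  obtain ⟨a, rfl⟩ := eq_smul_one hV s
  rw [Scheme.Modules.Hom.app_smul, app_res]
  have : (f - g).app U (one U) = 0 := sub_eq_zero.2 h
  rw [this, map_zero, smul_zero]

lemma exists_OO_hom {U : X.Opens} {F : X.Modules} (s : Γ(F, U)) :
    ∃ f : OO X U ⟶ F, f.app U (one U) = s := by
  obtain ⟨g, hg⟩ := exists_rest_unit_hom s
  refine ⟨((extAdj X U).homEquiv _ _).symm g, ?_⟩
  have h1 : (extAdj X U).unit.app ((rest X U).obj (unitMod X)) ≫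
    (rest X U).map (((extAdj X U).homEquiv _ _).symm g) = g :=
    ((extAdj X U).homEquiv_unit _ _ _).symm.trans (Equiv.apply_symm_apply _ _)
  have h2 : (extAdj X U).unit.app ((rest X U).obj (unitMod X)) ≫ (rest X U).map (OOε U) = 𝟙 _ :=
    (extAdj X U).right_triangle_components (unitMod X)
  let o : Γ(OO X U, U) :=
    (SheafOfModules.Hom.val ((extAdj X U).unit.app ((rest X U).obj (unitMod X)))).app
      (.op (Over.mk (𝟙 U))) (unitOne U)
  have h3 : (OOε U).app U o = unitOne U :=
    congr((SheafOfModules.Hom.val $h2).app (.op (Over.mk (𝟙 U))) (unitOne U))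
  have h4 : one U = o := app_injective_of_mono (OOε U) U ((OOε_one U).trans h3.symm)
  rw [h4, ← hg]
  exact congr((SheafOfModules.Hom.val $h1).app (.op (Over.mk (𝟙 U))) (unitOne U))

/-- The morphism from `OO U` attached to a section. -/
def ofSec {U : X.Opens} {F : X.Modules} (s : Γ(F, U)) : OO X U ⟶ F := (exists_OO_hom s).choose

lemma ofSec_one {U : X.Opens} {F : X.Modules} (s : Γ(F, U)) : (ofSec s).app U (one U) = s :=
  (exists_OO_hom s).choose_spec

lemma ofSec_comp {U : X.Opens} {F G : X.Modules} (s : Γ(F, U)) (f : F ⟶ G) :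
    ofSec s ≫ f = ofSec (f.app U s) :=
  OO_hom_ext (by rw [comp_app_apply, ofSec_one, ofSec_one])

section
variable (X)

lemma exists_cutLE {U U' : X.Opens} (h : U ≤ U') :
    ∃ τ : cut X U ⟶ cut X U', τ ≫ cutε X U' = cutε X U := by
  have e (A : X.Modules) : IsIso ((cutε X U').app ((cut X U).obj A)) :=
    IsSupp.isIso_cutε ((isSupp_cut U A).le h)
  have e2 (A : X.Modules) : (inv ((cutε X U').app ((cut X U).obj A)) ≫
      (cut X U').map ((cutε X U).app A)) ≫ (cutε X U').app A = (cutε X U).app A := by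
    rw [Category.assoc, IsIso.inv_comp_eq]
    exact (cutε X U').naturality ((cutε X U).app A)
  refine ⟨{ app := fun A ↦ inv ((cutε X U').app ((cut X U).obj A)) ≫
    (cut X U').map ((cutε X U).app A), naturality := ?_ }, ?_⟩
  · intro A B f
    rw [← cancel_mono ((cutε X U').app B), Category.assoc, e2, Category.assoc,
      (cutε X U').naturality f, ← Category.assoc, e2]
    exact (cutε X U).naturality f
  · ext1
    ext1 A
    exact e2 A

/-- The canonical map between extensions by zero from two opens. -/
def cutLE {U U' : X.Opens} (h : U ≤ U') : cut X U ⟶ cut X U' := (exists_cutLE X h).choose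

lemma cutLE_ε {U U' : X.Opens} (h : U ≤ U') : cutLE X h ≫ cutε X U' = cutε X U :=
  (exists_cutLE X h).choose_spec
end

lemma cutLE_ε_app {U U' : X.Opens} (h : U ≤ U') (A : X.Modules) :
    (cutLE X h).app A ≫ (cutε X U').app A = (cutε X U).app A := congr_app (cutLE_ε X h) A

lemma mono_cutLE {U U' : X.Opens} (h : U ≤ U') (A : X.Modules) : Mono ((cutLE X h).app A) := by
  have : Mono ((cutLE X h).app A ≫ (cutε X U').app A) := by rw [cutLE_ε_app]; infer_instance
  exact mono_of_mono _ ((cutε X U').app A)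

/-- The canonical map between extensions by zero of the structure sheaf. -/
def OOLE {U U' : X.Opens} (h : U ≤ U') : OO X U ⟶ OO X U' := (cutLE X h).app _

lemma OOLE_one {U U' : X.Opens} (h : U ≤ U') : (OOLE h).app U (one U) = res _ h (one U') := by
  apply app_injective_of_mono (OOε U')
  rw [app_res, OOε_one, res_unitOne, ← OOε_one, ← comp_app_apply]
  congr 3
  exact cutLE_ε_app h _

lemma OOLE_comp_app {U U' : X.Opens} (h : U ≤ U') {F : X.Modules} (f : OO X U' ⟶ F) :
    (OOLE h ≫ f).app U (one U) = res F h (f.app U' (one U')) := by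
  rw [comp_app_apply, OOLE_one, app_res]

end LN

namespace LN


section
universe v w
variable {C : Type w} [Category.{v} C] [Abelian C]

/-- The situation of four subobjects `T₀₁ = T₀ ∩ T₁`, `T₀`, `T₁`, `T = T₀ + T₁`. -/
structure MVSquare (T₀₁ T₀ T₁ T : C) where
  i₀ : T₀₁ ⟶ T₀
  i₁ : T₀₁ ⟶ T₁
  j₀ : T₀ ⟶ T
  j₁ : T₁ ⟶ T
  comm : i₀ ≫ j₀ = i₁ ≫ j₁
  mono : Mono i₀
  lift : ∀ {Z : C} (k₀ : Z ⟶ T₀) (k₁ : Z ⟶ T₁), k₀ ≫ j₀ = k₁ ≫ j₁ →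
    ∃ l : Z ⟶ T₀₁, l ≫ i₀ = k₀ ∧ l ≫ i₁ = k₁
  epi : ∀ {Z : C} (c : T ⟶ Z), j₀ ≫ c = 0 → j₁ ≫ c = 0 → c = 0

lemma exists_lift_of_degreewise {K L Z : CochainComplex C ℤ} (i : K ⟶ L)
    (hi : ∀ n, Mono (i.f n)) (k : Z ⟶ L) (l : ∀ n, Z.X n ⟶ K.X n)
    (hl : ∀ n, l n ≫ i.f n = k.f n) : ∃ l' : Z ⟶ K, ∀ n, l'.f n = l n := by
  refine ⟨{ f := l, comm' := fun p q _ ↦ ?_ }, fun _ ↦ rfl⟩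
  rw [← cancel_mono (i.f q), Category.assoc, Category.assoc, hl, ← i.comm, ← k.comm, ← hl,
    Category.assoc]

namespace MVSquare
variable {T₀₁ T₀ T₁ T : C} (S : MVSquare T₀₁ T₀ T₁ T)

lemma zero : biprod.lift S.i₀ (-S.i₁) ≫ biprod.desc S.j₀ S.j₁ = 0 := by simp [S.comm]

lemma shortExact : (ShortComplex.mk _ _ S.zero).ShortExact where
  mono_f := by
    have := S.mono
    have : Mono (biprod.lift S.i₀ (-S.i₁) ≫ biprod.fst) := by simpa
    exact mono_of_mono _ biprod.fst
  epi_g := by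
    refine Preadditive.epi_of_cancel_zero (biprod.desc S.j₀ S.j₁) fun c hc ↦ S.epi c ?_ ?_
    · simpa using congr(biprod.inl ≫ $hc)
    · simpa using congr(biprod.inr ≫ $hc)
  exact := by
    rw [ShortComplex.exact_iff_exact_up_to_refinements]
    intro A x hx
    change A ⟶ T₀ ⊞ T₁ at x
    have h : (x ≫ biprod.fst) ≫ S.j₀ = (-x ≫ biprod.snd) ≫ S.j₁ := by
      have : x ≫ biprod.desc S.j₀ S.j₁ = 0 := hx
      rw [biprod.desc_eq, Preadditive.comp_add] at this
      rw [Category.assoc, Preadditive.neg_comp, Category.assoc]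
      exact eq_neg_of_add_eq_zero_left this
    obtain ⟨l, h0, h1⟩ := S.lift _ _ h
    refine ⟨A, 𝟙 A, inferInstance, l, ?_⟩
    rw [Category.id_comp]
    change x = l ≫ biprod.lift S.i₀ (-S.i₁)
    apply biprod.hom_ext
    · simp [h0]
    · simp [h1]

end MVSquare
end

section
universe w v w'
variable {A : Type v} [Category.{w'} A] [Abelian A] [HasDerivedCategory.{w} A]
open Pretriangulated DerivedCategory

lemma exists_triangle {K L M : CochainComplex A ℤ} {f : K ⟶ L} {g : L ⟶ M} {w : f ≫ g = 0}
    (h : (ShortComplex.mk f g w).ShortExact) : ∃ δ : Q.obj M ⟶ (Q.obj K)⟦(1 : ℤ)⟧,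
      Triangle.mk (Q.map f) (Q.map g) δ ∈ distTriang (DerivedCategory A) :=
  ⟨_, triangleOfSES_distinguished h⟩

lemma MVSquare.eq_zero {T₀₁ T₀ T₁ T : CochainComplex A ℤ} (S : MVSquare T₀₁ T₀ T₁ T)
    {Z : DerivedCategory A} (φ : Q.obj T ⟶ Z) (h₀ : Q.map S.j₀ ≫ φ = 0) (h₁ : Q.map S.j₁ ≫ φ = 0)
    (h : ∀ ψ : (Q.obj T₀₁)⟦(1 : ℤ)⟧ ⟶ Z, ∃ (ψ₀ : (Q.obj T₀)⟦(1 : ℤ)⟧ ⟶ Z)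
      (ψ₁ : (Q.obj T₁)⟦(1 : ℤ)⟧ ⟶ Z),
      ψ = (Q.map S.i₀)⟦(1 : ℤ)⟧' ≫ ψ₀ + (Q.map S.i₁)⟦(1 : ℤ)⟧' ≫ ψ₁) : φ = 0 := by
  obtain ⟨δ, hT⟩ := exists_triangle S.shortExact
  have hz : Q.map (biprod.desc S.j₀ S.j₁) ≫ φ = 0 := by
    rw [biprod.desc_eq, Functor.map_add, Preadditive.add_comp, Functor.map_comp, Functor.map_comp,
      Category.assoc, Category.assoc, h₀, h₁, comp_zero, comp_zero, add_zero]
  obtain ⟨ψ, hψ⟩ := Triangle.yoneda_exact₃ _ hT φ hz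
  change (Q.obj T₀₁)⟦(1 : ℤ)⟧ ⟶ Z at ψ
  change φ = δ ≫ ψ at hψ
  obtain ⟨ψ₀, ψ₁, e⟩ := h ψ
  have hc : δ ≫ (Q.map (biprod.lift S.i₀ (-S.i₁)))⟦(1 : ℤ)⟧' = 0 :=
    comp_distTriang_mor_zero₃₁ _ hT
  have e' : ψ = (Q.map (biprod.lift S.i₀ (-S.i₁)))⟦(1 : ℤ)⟧' ≫
      ((Q.map biprod.fst)⟦(1 : ℤ)⟧' ≫ ψ₀ - (Q.map biprod.snd)⟦(1 : ℤ)⟧' ≫ ψ₁) := by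
    rw [Preadditive.comp_sub, ← Category.assoc, ← Category.assoc, ← Functor.map_comp,
      ← Functor.map_comp, ← Functor.map_comp, ← Functor.map_comp, biprod.lift_fst,
      biprod.lift_snd, Functor.map_neg, Functor.map_neg, e]
    simp
  rw [hψ, e', ← Category.assoc, hc, zero_comp]
end
end LN

namespace LN

variable {X : Scheme.{u}}

lemma cut_hom_ext {U : X.Opens} {A Z : X.Modules} {f g : Z ⟶ (cut X U).obj A}
    (h : f ≫ (cutε X U).app A = g ≫ (cutε X U).app A) : f = g := (cancel_mono _).1 h

lemma IsSupp.inf {U V : X.Opens} {A : X.Modules} (hU : IsSupp U A) (hV : IsSupp V A) :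
    IsSupp (U ⊓ V) A := fun W s x hx ↦ by
  obtain ⟨W1, hW1, hx1, h1⟩ := hU W s x hx
  obtain ⟨W2, hW2, hx2, h2⟩ := hV W1 (res A hW1 s) x hx1
  refine ⟨W2, hW2.trans hW1, hx2, ?_⟩
  rw [← res_res A hW2 hW1]
  obtain h2 | h2 := h2
  · obtain h1 | h1 := h1
    · exact Or.inl (le_inf (hW2.trans h1) h2)
    · exact Or.inr (by rw [show res A hW1 s = 0 from h1, map_zero])
  · exact Or.inr h2

lemma cutLE_surjective {U U' : X.Opens} (h : U ≤ U') (A : X.Modules) {V : X.Opens} (hV : V ≤ U)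
    (s : Γ((cut X U').obj A, V)) : ∃ t, ((cutLE X h).app A).app V t = s := by
  obtain ⟨t, ht⟩ := (cutε_bijective A hV).2 (((cutε X U').app A).app V s)
  refine ⟨t, app_injective_of_mono ((cutε X U').app A) V ?_⟩
  rw [← ht, ← comp_app_apply, cutLE_ε_app]

lemma IsSupp.exists_lift {U : X.Opens} {Z A : X.Modules} (h : IsSupp U Z) (f : Z ⟶ A) :
    ∃ l : Z ⟶ (cut X U).obj A, l ≫ (cutε X U).app A = f := by
  have := h.isIso_cutε
  refine ⟨inv ((cutε X U).app Z) ≫ (cut X U).map f, ?_⟩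
  rw [Category.assoc, IsIso.inv_comp_eq]
  exact (cutε X U).naturality f

/-- The Mayer-Vietoris square of two opens. -/
def mvSquare (U V : X.Opens) (A : X.Modules) : MVSquare ((cut X (U ⊓ V)).obj A)
    ((cut X U).obj A) ((cut X V).obj A) ((cut X (U ⊔ V)).obj A) where
  i₀ := (cutLE X inf_le_left).app A
  i₁ := (cutLE X inf_le_right).app A
  j₀ := (cutLE X le_sup_left).app A
  j₁ := (cutLE X le_sup_right).app A
  comm := by
    apply cut_hom_ext
    rw [Category.assoc, cutLE_ε_app, cutLE_ε_app, Category.assoc, cutLE_ε_app, cutLE_ε_app]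
  mono := mono_cutLE _ A
  lift {Z} k₀ k₁ h := by
    have h' : k₀ ≫ (cutε X U).app A = k₁ ≫ (cutε X V).app A := by
      have := congr($h ≫ (cutε X (U ⊔ V)).app A)
      rwa [Category.assoc, Category.assoc, cutLE_ε_app, cutLE_ε_app] at this
    let p₀ := pullback.fst ((cutε X U).app A) ((cutε X V).app A)
    let p₁ := pullback.snd ((cutε X U).app A) ((cutε X V).app A)
    have hs : IsSupp (U ⊓ V) (pullback ((cutε X U).app A) ((cutε X V).app A)) :=
      ((isSupp_cut U A).of_mono p₀).inf ((isSupp_cut V A).of_mono p₁)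
    obtain ⟨l, hl⟩ := hs.exists_lift (A := A) (p₀ ≫ (cutε X U).app A)
    refine ⟨pullback.lift k₀ k₁ h' ≫ l, cut_hom_ext ?_, cut_hom_ext ?_⟩
    · rw [Category.assoc, cutLE_ε_app, Category.assoc, hl, pullback.lift_fst_assoc]
    · rw [Category.assoc, cutLE_ε_app, Category.assoc, hl, pullback.lift_fst_assoc, h']
  epi {Z} c h1 h2 := by
    apply (isSupp_cut _ _).hom_eq_zero
    intro W hW s
    refine eq_zero_of_locally _ _ fun x hx ↦ ?_
    obtain hxU | hxV := hW hx
    · refine ⟨W ⊓ U, inf_le_left, ⟨hx, hxU⟩, ?_⟩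
      obtain ⟨t, ht⟩ := cutLE_surjective (le_sup_left : U ≤ U ⊔ V) A (inf_le_right : W ⊓ U ≤ U)
        (res _ inf_le_left s)
      rw [← app_res, ← ht, ← comp_app_apply, h1]; rfl
    · refine ⟨W ⊓ V, inf_le_left, ⟨hx, hxV⟩, ?_⟩
      obtain ⟨t, ht⟩ := cutLE_surjective (le_sup_right : V ≤ U ⊔ V) A (inf_le_right : W ⊓ V ≤ V)
        (res _ inf_le_left s)
      rw [← app_res, ← ht, ← comp_app_apply, h2]; rfl

variable (X) in
/-- `cut` on complexes. -/
def cutC (U : X.Opens) : CochainComplex X.Modules ℤ ⥤ CochainComplex X.Modules ℤ :=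
  (cut X U).mapHomologicalComplex _

variable (X) in
/-- The inclusion of `cutC`. -/
def cutCε (U : X.Opens) : cutC X U ⟶ 𝟭 _ where
  app K := { f := fun n ↦ (cutε X U).app (K.X n)
             comm' := fun i j _ ↦ ((cutε X U).naturality (K.d i j)).symm }
  naturality K L f := by
    apply HomologicalComplex.hom_ext
    intro n
    exact (cutε X U).naturality (f.f n)

variable (X) in
/-- The transition maps of `cutC`. -/
def cutCLE {U V : X.Opens} (h : U ≤ V) : cutC X U ⟶ cutC X V where
  app K := { f := fun n ↦ (cutLE X h).app (K.X n)
             comm' := fun i j _ ↦ ((cutLE X h).naturality (K.d i j)).symm }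
  naturality K L f := by
    apply HomologicalComplex.hom_ext
    intro n
    exact (cutLE X h).naturality (f.f n)

lemma mono_of_f {K L : CochainComplex X.Modules ℤ} (f : K ⟶ L) (h : ∀ n, Mono (f.f n)) : Mono f :=
  HomologicalComplex.mono_of_mono_f f h

instance (U : X.Opens) (K : CochainComplex X.Modules ℤ) : Mono ((cutCε X U).app K) :=
  mono_of_f _ fun n ↦ inferInstanceAs (Mono ((cutε X U).app (K.X n)))

/-- The Mayer-Vietoris square of two opens, for complexes. -/
def mvSquareC (U V : X.Opens) (K : CochainComplex X.Modules ℤ) : MVSquare ((cutC X (U ⊓ V)).obj K)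
    ((cutC X U).obj K) ((cutC X V).obj K) ((cutC X (U ⊔ V)).obj K) where
  i₀ := (cutCLE X inf_le_left).app K
  i₁ := (cutCLE X inf_le_right).app K
  j₀ := (cutCLE X le_sup_left).app K
  j₁ := (cutCLE X le_sup_right).app K
  comm := HomologicalComplex.hom_ext _ _ fun n ↦ (mvSquare U V (K.X n)).comm
  mono := mono_of_f _ fun n ↦ (mvSquare U V (K.X n)).mono
  lift {Z} k₀ k₁ h := by
    choose l hl0 hl1 using fun n ↦ (mvSquare U V (K.X n)).lift (k₀.f n) (k₁.f n) congr(($h).f n)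
    obtain ⟨l', hl'⟩ := exists_lift_of_degreewise ((cutCLE X (inf_le_left : U ⊓ V ≤ U)).app K)
      (fun n ↦ (mvSquare U V (K.X n)).mono) k₀ l hl0
    refine ⟨l', HomologicalComplex.hom_ext _ _ fun n ↦ ?_,
      HomologicalComplex.hom_ext _ _ fun n ↦ ?_⟩
    · exact congr($(hl' n) ≫ _).trans (hl0 n)
    · exact congr($(hl' n) ≫ _).trans (hl1 n)
  epi {Z} c h1 h2 := HomologicalComplex.hom_ext _ _ fun n ↦
    (mvSquare U V (K.X n)).epi (c.f n) congr(($h1).f n) congr(($h2).f n)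

end LN

namespace LN


section
universe w v w'
open Pretriangulated

/-- All morphisms between two objects vanish. -/
def HZ {D : Type v} [Category.{w} D] [HasZeroMorphisms D] (C Z : D) : Prop := ∀ φ : C ⟶ Z, φ = 0

namespace HZ

section
variable {D : Type v} [Category.{w} D] [HasZeroMorphisms D]

lemma of_retract_left {C C' Z : D} (h : HZ C Z) (i : C' ⟶ C) (p : C ⟶ C') (e : i ≫ p = 𝟙 _) :
    HZ C' Z := fun φ ↦ by
  rw [← Category.id_comp φ, ← e, Category.assoc, h (p ≫ φ), comp_zero]

lemma of_retract_right {C Z Z' : D} (h : HZ C Z) (i : Z' ⟶ Z) (p : Z ⟶ Z') (e : i ≫ p = 𝟙 _) :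
    HZ C Z' := fun φ ↦ by
  rw [← Category.comp_id φ, ← e, ← Category.assoc, h (φ ≫ i), zero_comp]

lemma of_iso_left {C C' Z : D} (h : HZ C Z) (e : C ≅ C') : HZ C' Z :=
  h.of_retract_left e.inv e.hom e.inv_hom_id

lemma of_iso_right {C Z Z' : D} (h : HZ C Z) (e : Z ≅ Z') : HZ C Z' :=
  h.of_retract_right e.inv e.hom e.inv_hom_id

lemma of_isZero_left {C Z : D} (h : IsZero C) : HZ C Z := fun φ ↦ h.eq_of_src φ 0

lemma of_isZero_right {C Z : D} (h : IsZero Z) : HZ C Z := fun φ ↦ h.eq_of_tgt φ 0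
end

section
variable {D : Type v} [Category.{w} D] [HasZeroObject D] [HasShift D ℤ] [Preadditive D]
  [∀ n : ℤ, (shiftFunctor D n).Additive] [Pretriangulated D]

lemma shift {C Z : D} (h : HZ C Z) (n : ℤ) : HZ (C⟦n⟧) (Z⟦n⟧) := fun φ ↦ by
  obtain ⟨ψ, rfl⟩ := (shiftFunctor D n).map_surjective φ
  rw [h ψ, Functor.map_zero]

lemma of_shift {C Z : D} (n : ℤ) (h : HZ (C⟦n⟧) (Z⟦n⟧)) : HZ C Z := fun φ ↦ by
  apply (shiftFunctor D n).map_injective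
  rw [h ((shiftFunctor D n).map φ), Functor.map_zero]

lemma shift_left {C Z : D} (n : ℤ) (h : HZ C (Z⟦-n⟧)) : HZ (C⟦n⟧) Z :=
  (h.shift n).of_iso_right ((shiftEquiv D n).counitIso.app Z)

variable (T : Triangle D) (hT : T ∈ distTriang D) {C Z : D}
include hT

lemma left₂ (h₁ : HZ T.obj₁ Z) (h₃ : HZ T.obj₃ Z) : HZ T.obj₂ Z := fun φ ↦ by
  obtain ⟨ψ, rfl⟩ := Triangle.yoneda_exact₂ T hT φ (h₁ _)
  rw [h₃ ψ, comp_zero]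

lemma right₂ (h₁ : HZ C T.obj₁) (h₃ : HZ C T.obj₃) : HZ C T.obj₂ := fun φ ↦ by
  obtain ⟨ψ, rfl⟩ := Triangle.coyoneda_exact₂ T hT φ (h₃ _)
  rw [h₁ ψ, zero_comp]

lemma left₃ (h₂ : HZ T.obj₂ Z) (h₁ : HZ (T.obj₁⟦(1 : ℤ)⟧) Z) : HZ T.obj₃ Z :=
  left₂ _ (rot_of_distTriang _ hT) h₂ h₁

lemma right₃ (h₂ : HZ C T.obj₂) (h₁ : HZ C (T.obj₁⟦(1 : ℤ)⟧)) : HZ C T.obj₃ :=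
  right₂ _ (rot_of_distTriang _ hT) h₂ h₁

lemma left₁ (h₂ : HZ T.obj₂ Z) (h₃ : HZ (T.obj₃⟦(-1 : ℤ)⟧) Z) : HZ T.obj₁ Z :=
  left₂ _ (inv_rot_of_distTriang _ hT) h₃ h₂

lemma right₁ (h₂ : HZ C T.obj₂) (h₃ : HZ C (T.obj₃⟦(-1 : ℤ)⟧)) : HZ C T.obj₁ :=
  right₂ _ (inv_rot_of_distTriang _ hT) h₃ h₂
end
end HZ

variable {A : Type v} [Category.{w'} A] [Abelian A] [HasDerivedCategory.{w} A]
open DerivedCategory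

/-- An object placed in degree `n`. -/
abbrev SF (n : ℤ) (M : A) : DerivedCategory A := (singleFunctor A n).obj M

/-- Homology of an object of the derived category. -/
abbrev HH (n : ℤ) (K : DerivedCategory A) : A := (homologyFunctor A n).obj K

/-- Shifting single objects. -/
def SFshift (a n n' : ℤ) (h : a + n' = n) (M : A) : (SF n M)⟦a⟧ ≅ SF n' M :=
  ((singleFunctors A).shiftIso a n' n h).app M

/-- Homology of single objects. -/
def HHSF (n : ℤ) (M : A) : HH n (SF n M) ≅ M := (singleFunctorCompHomologyFunctorIso A n).app M

lemma isZero_HHSF (n i : ℤ) (h : i ≠ n) (M : A) : IsZero (HH i (SF n M)) := by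
  obtain h | h := h.lt_or_gt
  · exact isZero_of_isGE _ n i h
  · exact isZero_of_isLE _ n i h

/-- Homology of shifts. -/
def HHshift (a n n' : ℤ) (h : a + n = n') (K : DerivedCategory A) : HH n (K⟦a⟧) ≅ HH n' K :=
  ((homologyFunctor A 0).shiftIso a n n' h).app K

section
variable (T : Triangle (DerivedCategory A)) (hT : T ∈ distTriang _)
include hT

lemma isIso_HH_mor₁ (n m : ℤ) (h : m + 1 = n) (h₁ : IsZero (HH m T.obj₃))
    (h₂ : IsZero (HH n T.obj₃)) : IsIso ((homologyFunctor A n).map T.mor₁) := by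
  have : Mono ((homologyFunctor A n).map T.mor₁) :=
    (HomologySequence.mono_homologyMap_mor₁_iff T hT m n h).2 (h₁.eq_of_src _ _)
  have : Epi ((homologyFunctor A n).map T.mor₁) :=
    (HomologySequence.epi_homologyMap_mor₁_iff T hT n).2 (h₂.eq_of_tgt _ _)
  exact isIso_of_mono_of_epi _

lemma isIso_HH_mor₂ (n m : ℤ) (h : n + 1 = m) (h₁ : IsZero (HH n T.obj₁))
    (h₂ : IsZero (HH m T.obj₁)) : IsIso ((homologyFunctor A n).map T.mor₂) := by
  have : Mono ((homologyFunctor A n).map T.mor₂) :=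
    (HomologySequence.mono_homologyMap_mor₂_iff T hT n).2 (h₁.eq_of_src _ _)
  have : Epi ((homologyFunctor A n).map T.mor₂) :=
    (HomologySequence.epi_homologyMap_mor₂_iff T hT n m h).2 (h₂.eq_of_tgt _ _)
  exact isIso_of_mono_of_epi _

lemma isZero_HH₁ (n m : ℤ) (h : m + 1 = n) (h₁ : IsZero (HH m T.obj₃))
    (h₂ : IsZero (HH n T.obj₂)) : IsZero (HH n T.obj₁) :=
  (HomologySequence.exact₁ T hT m n h).isZero_X₂ (h₁.eq_of_src _ _) (h₂.eq_of_tgt _ _)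

lemma isZero_HH₃ (n m : ℤ) (h : n + 1 = m) (h₁ : IsZero (HH n T.obj₂))
    (h₂ : IsZero (HH m T.obj₁)) : IsZero (HH n T.obj₃) :=
  (HomologySequence.exact₃ T hT n m h).isZero_X₂ (h₁.eq_of_src _ _) (h₂.eq_of_tgt _ _)
end

open ZeroObject in
/-- The truncation triangle. -/
lemma exists_trunc (K : DerivedCategory A) (n m : ℤ) (h : n + 1 = m) :
    ∃ T : Triangle (DerivedCategory A), T ∈ distTriang _ ∧ T.obj₂ = K ∧ T.obj₁.IsLE n ∧
      T.obj₃.IsGE m := by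
  obtain ⟨X, Y, hX, hY, f, g, h, mem⟩ := TStructure.t.exists_triangle K n m h
  exact ⟨_, mem, rfl, ⟨hX⟩, ⟨hY⟩⟩

lemma exists_iso_SF (K : DerivedCategory A) (n : ℤ) [K.IsGE n] [K.IsLE n] :
    Nonempty (K ≅ SF n (HH n K)) := by
  obtain ⟨Y, ⟨e⟩⟩ := exists_iso_singleFunctor_obj_of_isGE_of_isLE K n
  exact ⟨e ≪≫ (singleFunctor A n).mapIso ((HHSF n Y).symm ≪≫ (homologyFunctor A n).mapIso e.symm)⟩

lemma HZ.of_bounded_right {C : DerivedCategory A} (k : ℕ) : ∀ (n m : ℤ) (_ : n + k = m)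
    (K : DerivedCategory A) (_ : K.IsGE n) (_ : K.IsLE m) (_ : ∀ i, HZ C (SF i (HH i K))), HZ C K := by
  induction k with
  | zero =>
    intro n m hnm K h1 h2 h
    obtain rfl : n = m := by simpa using hnm
    obtain ⟨e⟩ := exists_iso_SF K n
    exact (h n).of_iso_right e.symm
  | succ k ih =>
    intro n m hnm K h1 h2 h
    obtain ⟨T, hT, rfl, hL, hG⟩ := exists_trunc K n (n + 1) rfl
    have hz1 (i : ℤ) (hi : n < i) : IsZero (HH i T.obj₁) := isZero_of_isLE _ n i hi
    have hz3 (i : ℤ) (hi : i < n + 1) : IsZero (HH i T.obj₃) := isZero_of_isGE _ (n + 1) i hi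
    have : T.obj₁.IsGE n := by
      rw [isGE_iff]
      intro i hi
      exact isZero_HH₁ T hT i (i - 1) (by lia) (hz3 _ (by lia)) (isZero_of_isGE _ n i hi)
    have : T.obj₃.IsLE m := by
      rw [isLE_iff]
      intro i hi
      exact isZero_HH₃ T hT i (i + 1) rfl (isZero_of_isLE _ m i hi) (hz1 _ (by lia))
    refine HZ.right₂ T hT ?_ ?_
    · obtain ⟨e⟩ := exists_iso_SF T.obj₁ n
      have := isIso_HH_mor₁ T hT n (n - 1) (by lia) (hz3 _ (by lia)) (hz3 _ (by lia))
      exact ((h n).of_iso_right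
        ((singleFunctor A n).mapIso (asIso ((homologyFunctor A n).map T.mor₁)).symm)).of_iso_right e.symm
    · refine ih (n + 1) m (by lia) _ hG inferInstance fun i ↦ ?_
      by_cases hi : n < i
      · have := isIso_HH_mor₂ T hT i (i + 1) rfl (hz1 _ (by lia)) (hz1 _ (by lia))
        exact (h i).of_iso_right
          ((singleFunctor A i).mapIso (asIso ((homologyFunctor A i).map T.mor₂)))
      · exact .of_isZero_right (Functor.map_isZero _ (hz3 _ (by lia)))

/-- A bounded complex of objects with no maps to `Z`. -/
lemma HZ.of_terms {Z : DerivedCategory A} (k : ℕ) : ∀ (n m : ℤ) (_ : n + k = m)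
    (K : CochainComplex A ℤ) (_ : ∀ i, (i < n ∨ m ≤ i) → IsZero (K.X i))
    (_ : ∀ i (M : A), Nonempty (M ≅ K.X i) → HZ (SF i M) Z), HZ (Q.obj K) Z := by
  induction k with
  | zero =>
    intro n m hnm K h0 h
    have : IsZero K := by
      rw [IsZero.iff_id_eq_zero]
      ext i
      exact (h0 i (by lia)).eq_of_src _ _
    exact .of_isZero_left (Functor.map_isZero _ this)
  | succ k ih =>
    intro n m hnm K h0 h
    let f : (HomologicalComplex.single A (.up ℤ) (m - 1)).obj (K.X (m - 1)) ⟶ K :=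
      HomologicalComplex.mkHomFromSingle (𝟙 _) fun j hj ↦
        (h0 j (by have : m - 1 + 1 = j := hj; lia)).eq_of_tgt _ _
    have hs (i : ℤ) (hi : i ≠ m - 1) : IsZero
        (((HomologicalComplex.single A (.up ℤ) (m - 1)).obj (K.X (m - 1))).X i) :=
      HomologicalComplex.isZero_single_obj_X _ _ _ _ hi
    have hf : IsIso (f.f (m - 1)) := by
      dsimp only [f]
      rw [HomologicalComplex.mkHomFromSingle_f]
      infer_instance
    have : Mono f := by
      refine HomologicalComplex.mono_of_mono_f f fun i ↦ ?_
      by_cases hi : i = m - 1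
      · subst hi; infer_instance
      · exact ⟨fun _ _ _ ↦ (hs i hi).eq_of_tgt _ _⟩
    have hS : (ShortComplex.mk f (cokernel.π f) (cokernel.condition f)).ShortExact :=
      { exact := ShortComplex.exact_cokernel f }
    obtain ⟨δ, hT⟩ := exists_triangle hS
    have hSi (i : ℤ) := hS.map_of_exact (HomologicalComplex.eval A (.up ℤ) i)
    refine HZ.left₂ _ hT (h (m - 1) _ ⟨Iso.refl _⟩) (ih n (m - 1) (by lia) _ ?_ ?_)
    · intro i hi
      have hep : Epi ((cokernel.π f).f i) := (hSi i).epi_g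
      by_cases hi' : i = m - 1
      · subst hi'
        have h0 : (cokernel.π f).f (m - 1) = 0 := by
          rw [← cancel_epi (f.f (m - 1)), comp_zero]
          exact congr(($(cokernel.condition f)).f (m - 1))
        rw [IsZero.iff_id_eq_zero, ← cancel_epi ((cokernel.π f).f (m - 1)), h0, zero_comp, zero_comp]
      · exact IsZero.of_epi ((cokernel.π f).f i) (h0 i (by lia))
    · rintro i M ⟨e⟩
      have hep : Epi ((cokernel.π f).f i) := (hSi i).epi_g
      by_cases hi' : i = m - 1
      · subst hi'
        have h0 : (cokernel.π f).f (m - 1) = 0 := by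
          rw [← cancel_epi (f.f (m - 1)), comp_zero]
          exact congr(($(cokernel.condition f)).f (m - 1))
        have : IsZero ((cokernel f).X (m - 1)) := by
          rw [IsZero.iff_id_eq_zero, ← cancel_epi ((cokernel.π f).f (m - 1)), h0, zero_comp,
            zero_comp]
        exact .of_isZero_left (Functor.map_isZero _ (this.of_iso e))
      · have : Mono ((cokernel.π f).f i) := (hSi i).exact.mono_g ((hs i hi').eq_of_src _ _)
        have := isIso_of_mono_of_epi ((cokernel.π f).f i)
        exact h i M ⟨e ≪≫ (asIso ((cokernel.π f).f i)).symm⟩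
end
end LN

namespace LN

universe w v w'
variable {A : Type v} [Category.{w'} A] [Abelian A] [HasDerivedCategory.{w} A]
open DerivedCategory

lemma exists_tower (G : DerivedCategory A) :
    ∃ (τ : ℕ → DerivedCategory A) (π : ∀ m, G ⟶ τ m) (t : ∀ m, τ (m + 1) ⟶ τ m),
      (∀ m, π (m + 1) ≫ t m = π m) ∧ (∀ m : ℕ, (τ m).IsGE (-m)) ∧
      ∀ (m : ℕ) (i : ℤ), -m ≤ i → IsIso ((homologyFunctor A i).map (π m)) := by
  refine ⟨fun m ↦ (TStructure.t.truncGE (-m : ℤ)).obj G, fun m ↦ (TStructure.t.truncGEπ (-m : ℤ)).app G,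
    fun m ↦ (TStructure.t.natTransTruncGEOfLE (-((m + 1 : ℕ) : ℤ)) (-m : ℤ) (by lia)).app G,
    fun m ↦ ?_, fun m ↦ ?_, fun m i hi ↦ ?_⟩
  · exact TStructure.t.π_natTransTruncGEOfLE_app _ _ _ _
  · exact inferInstanceAs (TStructure.t.IsGE _ _)
  · have hT := TStructure.t.triangleLTGE_distinguished (-m : ℤ) G
    have : TStructure.t.IsLE ((TStructure.t.triangleLTGE (-m : ℤ)).obj G).obj₁ (-m - 1 : ℤ) :=
      inferInstanceAs (TStructure.t.IsLE ((TStructure.t.truncLT (-m : ℤ)).obj G) (-m - 1 : ℤ))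
    exact isIso_HH_mor₂ _ hT i (i + 1) rfl (isZero_of_isLE _ (-m - 1) _ (by lia))
      (isZero_of_isLE _ (-m - 1) _ (by lia))

lemma exists_isKInjective [EnoughInjectives A] (K : DerivedCategory A) (n : ℤ) [K.IsGE n] :
    ∃ I : CochainComplex A ℤ, I.IsKInjective ∧ Nonempty (Q.obj I ≅ K) := by
  obtain ⟨L, _, ⟨e⟩⟩ := exists_iso_Q_obj_of_isGE K n
  obtain ⟨I, i, _, _, _⟩ := CochainComplex.Plus.modelCategoryQuillen.exists_quasiIso_injective L n
  have : QuasiIso i := by assumption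
  refine ⟨I, CochainComplex.isKInjective_of_injective I n, ⟨(asIso (Q.map i)).symm ≪≫ e.symm⟩⟩

section
variable [HasProductsOfShape ℕ A] (I : ℕ → CochainComplex A ℤ)

lemma exists_lift_pi {T : A} (j : ℤ) (h : ∀ m, T ⟶ (I m).X j) :
    ∃ g : T ⟶ (∏ᶜ I).X j, ∀ m, g ≫ (Pi.π I m).f j = h m :=
  ⟨Fan.IsLimit.lift (isLimitOfHasProductOfPreservesLimit (HomologicalComplex.eval A (.up ℤ) j) I) h,
    fun m ↦ Fan.IsLimit.fac (isLimitOfHasProductOfPreservesLimit (HomologicalComplex.eval A (.up ℤ) j) I) h m⟩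

lemma pi_hom_ext {T : A} {j : ℤ} {g g' : T ⟶ (∏ᶜ I).X j}
    (h : ∀ m, g ≫ (Pi.π I m).f j = g' ≫ (Pi.π I m).f j) : g = g' :=
  Fan.IsLimit.hom_ext
    (isLimitOfHasProductOfPreservesLimit (HomologicalComplex.eval A (.up ℤ) j) I) _ _ h

lemma nonempty_homotopy_pi {K : CochainComplex A ℤ} (f g : K ⟶ ∏ᶜ I)
    (h : ∀ m, Nonempty (Homotopy (f ≫ Pi.π I m) (g ≫ Pi.π I m))) : Nonempty (Homotopy f g) := by
  choose k hk using fun i j ↦ exists_lift_pi I j (fun m ↦ (h m).some.hom i j)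
  refine ⟨⟨k, fun i j hij ↦ pi_hom_ext I fun m ↦ ?_, fun i ↦ pi_hom_ext I fun m ↦ ?_⟩⟩
  · rw [hk, zero_comp, (h m).some.zero i j hij]
  · have := (h m).some.comm i
    rw [HomologicalComplex.comp_f, HomologicalComplex.comp_f] at this
    rw [this, Preadditive.add_comp, Preadditive.add_comp, ← dNext_comp_right, ← prevD_comp_right]
    simp only [hk]

lemma isKInjective_pi (hI : ∀ m, (I m).IsKInjective) : (∏ᶜ I).IsKInjective where
  nonempty_homotopy_zero f hK := nonempty_homotopy_pi I _ _ fun m ↦ by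
    rw [zero_comp]
    exact CochainComplex.IsKInjective.nonempty_homotopy_zero _ hK

omit [HasProductsOfShape ℕ A] in
lemma exists_Q_map_eq {K L : CochainComplex A ℤ} [L.IsKInjective] (f : Q.obj K ⟶ Q.obj L) :
    ∃ g : K ⟶ L, Q.map g = f := by
  obtain ⟨g, hg⟩ := (CochainComplex.IsKInjective.Qh_map_bijective
    ((HomotopyCategory.quotient _ _).obj K) L).surjective f
  obtain ⟨g, rfl⟩ := (HomotopyCategory.quotient _ _).map_surjective g
  exact ⟨g, hg⟩

omit [HasProductsOfShape ℕ A] in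
lemma nonempty_homotopy_of_Q_map_eq {K L : CochainComplex A ℤ} [L.IsKInjective] {f g : K ⟶ L}
    (h : Q.map f = Q.map g) : Nonempty (Homotopy f g) :=
  ⟨HomotopyCategory.homotopyOfEq _ _ ((CochainComplex.IsKInjective.Qh_map_bijective
    ((HomotopyCategory.quotient _ _).obj K) L).injective h)⟩

/-- The product of K-injective complexes is a product in the derived category. -/
lemma exists_product (hI : ∀ m, (I m).IsKInjective) :
    ∃ (P : DerivedCategory A) (p : ∀ m, P ⟶ Q.obj (I m)), ∀ (C : DerivedCategory A),
      (∀ f : ∀ m, C ⟶ Q.obj (I m), ∃ g : C ⟶ P, ∀ m, g ≫ p m = f m) ∧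
      ∀ g g' : C ⟶ P, (∀ m, g ≫ p m = g' ≫ p m) → g = g' := by
  have := isKInjective_pi I hI
  refine ⟨Q.obj (∏ᶜ I), fun m ↦ Q.map (Pi.π I m), fun C ↦ ?_⟩
  obtain ⟨C, ⟨e⟩⟩ : ∃ K, Nonempty (Q.obj K ≅ C) := ⟨_, ⟨Q.objObjPreimageIso C⟩⟩
  constructor
  · intro f
    choose g hg using fun m ↦ exists_Q_map_eq (e.hom ≫ f m)
    refine ⟨e.inv ≫ Q.map (Pi.lift g), fun m ↦ ?_⟩
    rw [Category.assoc, ← Q.map_comp, Pi.lift_π, hg, e.inv_hom_id_assoc]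
  · intro g g' h
    rw [← cancel_epi e.hom]
    obtain ⟨a, ha⟩ := exists_Q_map_eq (e.hom ≫ g)
    obtain ⟨b, hb⟩ := exists_Q_map_eq (e.hom ≫ g')
    rw [← ha, ← hb]
    obtain ⟨H⟩ := nonempty_homotopy_pi I a b fun m ↦ nonempty_homotopy_of_Q_map_eq (by
      rw [Q.map_comp, Q.map_comp, ha, hb, Category.assoc, Category.assoc, h])
    exact Q_map_eq_of_homotopy A H
end

section
universe z

lemma telescope_surjective (m₀ : ℕ) : ∀ (B : ℕ → Type z) [∀ m, AddCommGroup (B m)]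
    (t : ∀ m, B (m + 1) →+ B m) (_ : ∀ m, m₀ ≤ m → Function.Surjective (t m)) (y : ∀ m, B m),
    ∃ x : ∀ m, B m, ∀ m, x m - t m (x (m + 1)) = y m := by
  induction m₀ with
  | zero =>
    intro B _ t h y
    choose l hl using fun m ↦ h m (Nat.zero_le _)
    let x : ∀ m, B m := fun m ↦ Nat.rec 0 (fun m a ↦ l m (a - y m)) m
    refine ⟨x, fun m ↦ ?_⟩
    change x m - t m (l m (x m - y m)) = _
    rw [hl, sub_sub_cancel]
  | succ m₀ ih =>
    intro B _ t h y
    obtain ⟨x, hx⟩ := ih (fun m ↦ B (m + 1)) (fun m ↦ t (m + 1)) (fun m hm ↦ h _ (by lia))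
      (fun m ↦ y (m + 1))
    refine ⟨fun m ↦ Nat.casesOn m (y 0 + t 0 (x 0)) x, fun m ↦ ?_⟩
    cases m with
    | zero => simp
    | succ m => exact hx m

lemma exists_compatible (m₀ : ℕ) : ∀ (B : ℕ → Type z) [∀ m, AddCommGroup (B m)]
    (t : ∀ m, B (m + 1) →+ B m) (_ : ∀ m, m₀ ≤ m → Function.Surjective (t m)) (y : B m₀),
    ∃ x : ∀ m, B m, (∀ m, t m (x (m + 1)) = x m) ∧ x m₀ = y := by
  induction m₀ with
  | zero =>
    intro B _ t h y
    choose l hl using fun m ↦ h m (Nat.zero_le _)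
    exact ⟨fun m ↦ Nat.rec y (fun m a ↦ l m a) m, fun m ↦ hl m _, rfl⟩
  | succ m₀ ih =>
    intro B _ t h y
    obtain ⟨x, hx, hy⟩ := ih (fun m ↦ B (m + 1)) (fun m ↦ t (m + 1)) (fun m hm ↦ h _ (by lia)) y
    refine ⟨fun m ↦ Nat.casesOn m (t 0 (x 0)) x, fun m ↦ ?_, hy⟩
    cases m with
    | zero => rfl
    | succ m => exact hx m

lemma compatible_eq_zero (B : ℕ → Type z) [∀ m, AddCommGroup (B m)]
    (t : ∀ m, B (m + 1) →+ B m) (m₀ : ℕ) (h : ∀ m, m₀ ≤ m → Function.Injective (t m))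
    (x : ∀ m, B m) (hx : ∀ m, t m (x (m + 1)) = x m) (h0 : x m₀ = 0) (m : ℕ) : x m = 0 := by
  obtain hm | hm := le_total m₀ m
  · induction m, hm using Nat.le_induction with
    | base => exact h0
    | succ m hm ih => exact h m hm (by rw [hx, ih, map_zero])
  · induction hm using Nat.decreasingInduction with
    | self => exact h0
    | of_succ m hm ih => rw [← hx, ih, map_zero]
end

end LN

namespace LN

universe w v w'
variable {A : Type v} [Category.{w'} A] [Abelian A] [HasDerivedCategory.{w} A]
open DerivedCategory

open Pretriangulated

/-- Homotopy limits of towers with bounded below terms. -/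
lemma exists_holim [EnoughInjectives A] [HasProductsOfShape ℕ A] (τ : ℕ → DerivedCategory A)
    (n : ℕ → ℤ) (hτ : ∀ m, (τ m).IsGE (n m)) (t : ∀ m, τ (m + 1) ⟶ τ m) :
    ∃ (H : DerivedCategory A) (v : ∀ m, H ⟶ τ m), (∀ m, v (m + 1) ≫ t m = v m) ∧
      ∀ C : DerivedCategory A,
        (∀ f : ∀ m, C ⟶ τ m, (∀ m, f (m + 1) ≫ t m = f m) → ∃ g : C ⟶ H, ∀ m, g ≫ v m = f m) ∧
        ((∀ y : ∀ m, C⟦(1 : ℤ)⟧ ⟶ τ m, ∃ x : ∀ m, C⟦(1 : ℤ)⟧ ⟶ τ m,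
          ∀ m, x m - x (m + 1) ≫ t m = y m) → ∀ g : C ⟶ H, (∀ m, g ≫ v m = 0) → g = 0) := by
  choose I hI e using fun m ↦ exists_isKInjective (τ m) (n m)
  obtain ⟨P, q, hq⟩ := exists_product I hI
  let p (m) : P ⟶ τ m := q m ≫ (e m).some.hom
  have hp₁ {C} (f : ∀ m, C ⟶ τ m) : ∃ g : C ⟶ P, ∀ m, g ≫ p m = f m := by
    obtain ⟨g, hg⟩ := (hq C).1 (fun m ↦ f m ≫ (e m).some.inv)
    exact ⟨g, fun m ↦ by rw [reassoc_of% hg m, Iso.inv_hom_id, Category.comp_id]⟩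
  have hp₂ {C} (g g' : C ⟶ P) (h : ∀ m, g ≫ p m = g' ≫ p m) : g = g' := by
    refine (hq C).2 g g' fun m ↦ ?_
    rw [← cancel_mono (e m).some.hom, Category.assoc, Category.assoc]
    exact h m
  obtain ⟨φ, hφ⟩ := hp₁ (fun m ↦ p m - p (m + 1) ≫ t m)
  obtain ⟨H, ι, δ, hT⟩ := distinguished_cocone_triangle₁ φ
  have hιφ : ι ≫ φ = 0 := comp_distTriang_mor_zero₁₂ _ hT
  have hφδ : φ ≫ δ = 0 := comp_distTriang_mor_zero₂₃ _ hT
  have ex₂ {C} (g : C ⟶ P) (h : g ≫ φ = 0) : ∃ g' : C ⟶ H, g = g' ≫ ι :=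
    Triangle.coyoneda_exact₂ _ hT g h
  have ex₁ {C} (g : C ⟶ H⟦(1 : ℤ)⟧) (h : g ≫ ι⟦(1 : ℤ)⟧' = 0) : ∃ h : C ⟶ P, g = h ≫ δ :=
    Triangle.coyoneda_exact₁ _ hT g h
  refine ⟨H, fun m ↦ ι ≫ p m, fun m ↦ ?_, fun C ↦ ⟨fun f hf ↦ ?_, fun hC g hg ↦ ?_⟩⟩
  · have := hφ m
    have := congr(ι ≫ $this)
    rw [reassoc_of% hιφ, zero_comp, Preadditive.comp_sub] at this
    change (ι ≫ p (m + 1)) ≫ t m = ι ≫ p m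
    rw [Category.assoc, sub_eq_zero.1 this.symm]
  · obtain ⟨g, hg⟩ := hp₁ f
    obtain ⟨g', hg'⟩ := ex₂ g (hp₂ _ _ fun m ↦ by
      rw [Category.assoc, hφ, Preadditive.comp_sub, reassoc_of% hg (m + 1), hg, hf, sub_self,
        zero_comp])
    refine ⟨g', fun m ↦ ?_⟩
    change g' ≫ ι ≫ p m = f m
    rw [← hg m, hg', Category.assoc]
  · have h1 : g ≫ ι = 0 := hp₂ _ _ fun m ↦ by rw [Category.assoc, hg, zero_comp]
    obtain ⟨h, hh⟩ := ex₁ (g⟦(1 : ℤ)⟧') (by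
      rw [← Functor.map_comp, h1, Functor.map_zero])
    obtain ⟨x, hx⟩ := hC (fun m ↦ h ≫ p m)
    obtain ⟨h', hh'⟩ := hp₁ x
    have : h = h' ≫ φ := hp₂ _ _ fun m ↦ by
      rw [Category.assoc, hφ, Preadditive.comp_sub, reassoc_of% hh' (m + 1), hh', hx]
    apply (shiftFunctor _ (1 : ℤ)).map_injective
    rw [Functor.map_zero, hh, this]
    rw [Category.assoc, hφδ, comp_zero]

end LN

namespace LN

universe w v w'
variable {A : Type v} [Category.{w'} A] [Abelian A] [HasDerivedCategory.{w} A]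
open DerivedCategory

open Pretriangulated

lemma HZ.of_iso {C C' Z Z' : DerivedCategory A} (h : HZ C Z) (e : C ≅ C') (e' : Z ≅ Z') :
    HZ C' Z' := (h.of_iso_left e).of_iso_right e'

lemma exists_fiber_SF {K L : DerivedCategory A} (f : K ⟶ L) (n : ℤ) (hK : K.IsGE n)
    (hL : L.IsGE (n + 1)) (hf : ∀ i, n + 1 ≤ i → IsIso ((homologyFunctor A i).map f)) :
    ∃ (F : DerivedCategory A) (_ : Nonempty (F ≅ SF n (HH n K))) (k : F ⟶ K) (δ : L ⟶ F⟦(1 : ℤ)⟧),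
      Triangle.mk k f δ ∈ distTriang _ := by
  obtain ⟨F, k, δ, hT⟩ := distinguished_cocone_triangle₁ f
  have hL0 (i : ℤ) (hi : i < n + 1) : IsZero (HH i L) := isZero_of_isGE L (n + 1) i hi
  have hK0 (i : ℤ) (hi : i < n) : IsZero (HH i K) := isZero_of_isGE K n i hi
  have hF (i : ℤ) (hi : i ≠ n) : IsZero (HH i F) := by
    obtain hi | hi := hi.lt_or_gt
    · exact isZero_HH₁ _ hT i (i - 1) (by lia) (hL0 _ (by lia)) (hK0 i hi)
    · have h1 : (homologyFunctor A i).map k = 0 := by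
        have := hf i (by lia)
        rw [← cancel_mono ((homologyFunctor A i).map f), ← Functor.map_comp]
        have : k ≫ f = 0 := comp_distTriang_mor_zero₁₂ _ hT
        rw [this, Functor.map_zero, zero_comp]
      have hep : Epi ((homologyFunctor A (i - 1)).map f) := by
        by_cases h : n + 1 ≤ i - 1
        · have := hf _ h; infer_instance
        · exact ⟨fun _ _ _ ↦ (hL0 _ (by lia)).eq_of_src _ _⟩
      have := (HomologySequence.mono_homologyMap_mor₁_iff _ hT (i - 1) i (by lia)).2
        ((HomologySequence.epi_homologyMap_mor₂_iff _ hT (i - 1) i (by lia)).1 hep)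
      have h2 : Mono ((homologyFunctor A i).map k) := this
      exact IsZero.of_mono_eq_zero _ h1
  have : F.IsGE n := by
    rw [isGE_iff]
    exact fun i hi ↦ hF i hi.ne
  have : F.IsLE n := by
    rw [isLE_iff]
    exact fun i hi ↦ hF i hi.ne'
  obtain ⟨e⟩ := exists_iso_SF F n
  have := isIso_HH_mor₁ _ hT n (n - 1) (by lia) (hL0 _ (by lia)) (hL0 _ (by lia))
  have h2 : IsIso ((homologyFunctor A n).map k) := this
  exact ⟨F, ⟨e ≪≫ (singleFunctor A n).mapIso (asIso ((homologyFunctor A n).map k))⟩, k, δ, hT⟩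

section
variable {D : Type v} [Category.{w} D] [HasZeroObject D] [HasShift D ℤ] [Preadditive D]
  [∀ n : ℤ, (shiftFunctor D n).Additive] [Pretriangulated D]

lemma exists_lift_of_HZ {F K L : D} {k : F ⟶ K} {f : K ⟶ L} {δ : L ⟶ F⟦(1 : ℤ)⟧}
    (hT : Triangle.mk k f δ ∈ distTriang _) {C : D} (h : HZ C (F⟦(1 : ℤ)⟧)) (φ : C ⟶ L) :
    ∃ ψ : C ⟶ K, ψ ≫ f = φ := by
  obtain ⟨ψ, hψ⟩ := Triangle.coyoneda_exact₃ _ hT φ (h _)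
  exact ⟨ψ, hψ.symm⟩

lemma eq_zero_of_HZ {F K L : D} {k : F ⟶ K} {f : K ⟶ L} {δ : L ⟶ F⟦(1 : ℤ)⟧}
    (hT : Triangle.mk k f δ ∈ distTriang _) {C : D} (h : HZ C F) (φ : C ⟶ K) (hφ : φ ≫ f = 0) :
    φ = 0 := by
  obtain ⟨ψ, hψ⟩ : ∃ ψ : C ⟶ F, φ = ψ ≫ k := Triangle.coyoneda_exact₂ _ hT φ hφ
  rw [hψ, h ψ, zero_comp]
end

/-- Vanishing of morphisms to an object with infinitely many homology objects, tested on each of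
them, when homology is detected by objects of finite dimension with respect to them. -/
theorem HZ.of_homology [EnoughInjectives A] [HasProductsOfShape ℕ A] (G : DerivedCategory A)
    (N : ℤ) [G.IsLE N] (P : A → Prop)
    (hP : ∀ O, P O → ∀ i j k, i < j → HZ (SF j O) (SF i (HH k G)))
    (hdet : ∀ (L : DerivedCategory A) (n : ℤ), (∀ O, P O → HZ (SF n O) L) → IsZero (HH n L))
    {C : DerivedCategory A} (hC : ∀ i, HZ C (SF i (HH i G))) : HZ C G := by
  obtain ⟨τ, π, t, hπ, hτ, hiso⟩ := exists_tower G
  have hτ0 (m : ℕ) (i : ℤ) (hi : i < -m) : IsZero (HH i (τ m)) := by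
    have := hτ m
    exact isZero_of_isGE (τ m) (-m) i hi
  have hfib (m : ℕ) := exists_fiber_SF (t m) (-m - 1)
    (by have := hτ (m + 1); rwa [show (-((m + 1 : ℕ) : ℤ)) = -m - 1 by lia] at this)
    (by have := hτ m; rwa [sub_add_cancel]) (fun i hi ↦ by
      have h1 := hiso m i (by lia)
      have h2 := hiso (m + 1) i (by lia)
      rw [← hπ, Functor.map_comp] at h1
      exact IsIso.of_isIso_comp_left ((homologyFunctor A i).map (π (m + 1))) _)
  choose F e k δ hT using hfib
  have e' (m : ℕ) : F m ≅ SF (-m - 1) (HH (-m - 1) G) :=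
    (e m).some ≪≫ (singleFunctor A _).mapIso
      (have := hiso (m + 1) (-m - 1) (by lia); (asIso ((homologyFunctor A _).map (π (m + 1)))).symm)
  obtain ⟨H, v, hv, hH⟩ := exists_holim τ _ hτ t
  have hinj (m₀ : ℕ) (Y : DerivedCategory A) (hY : ∀ m, m₀ ≤ m → HZ Y (F m)) (g : Y ⟶ H)
      (hg : g ≫ v m₀ = 0) : g = 0 := by
    refine (hH Y).2 (fun y ↦ ?_) g fun m ↦ ?_
    · exact telescope_surjective m₀ (fun m ↦ Y⟦(1 : ℤ)⟧ ⟶ τ m)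
        (fun m ↦ Preadditive.rightComp _ (t m))
        (fun m hm φ ↦ exists_lift_of_HZ (hT m) ((hY m hm).shift 1) φ) y
    · refine compatible_eq_zero (fun m ↦ Y ⟶ τ m) (fun m ↦ Preadditive.rightComp _ (t m)) m₀
        (fun m hm ↦ ?_) (fun m ↦ g ≫ v m) (fun m ↦ ?_) hg m
      · rw [injective_iff_map_eq_zero]
        exact fun φ hφ ↦ eq_zero_of_HZ (hT m) (hY m hm) φ hφ
      · change (g ≫ v (m + 1)) ≫ t m = g ≫ v m
        rw [Category.assoc, hv]
  have hsurj (m₀ : ℕ) (Y : DerivedCategory A) (hY : ∀ m, m₀ ≤ m → HZ Y ((F m)⟦(1 : ℤ)⟧))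
      (g : Y ⟶ τ m₀) : ∃ g' : Y ⟶ H, g' ≫ v m₀ = g := by
    obtain ⟨x, hx, hx'⟩ := exists_compatible m₀ (fun m ↦ Y ⟶ τ m)
      (fun m ↦ Preadditive.rightComp _ (t m)) (fun m hm φ ↦ exists_lift_of_HZ (hT m) (hY m hm) φ) g
    obtain ⟨g', hg'⟩ := (hH Y).1 x hx
    exact ⟨g', by rw [hg', hx']⟩
  have hv_iso (m₀ : ℕ) (n : ℤ) (hn : -m₀ ≤ n) : IsIso ((homologyFunctor A n).map (v m₀)) := by
    obtain ⟨L, p, d, hL⟩ := distinguished_cocone_triangle (v m₀)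
    have h0 (i : ℤ) (hi : -m₀ - 1 ≤ i) : IsZero (HH i L) := by
      refine hdet L i fun O hO φ ↦ ?_
      have hz1 : d ≫ (v m₀)⟦(1 : ℤ)⟧' = 0 := comp_distTriang_mor_zero₃₁ _ hL
      have hz2 : φ ≫ d = 0 := by
        have e1 : (SF (i + 1) O)⟦(1 : ℤ)⟧ ≅ SF i O := SFshift _ _ _ (by lia) O
        obtain ⟨g, hg⟩ := (shiftFunctor _ (1 : ℤ)).map_surjective (e1.hom ≫ φ ≫ d)
        have : g = 0 := by
          refine hinj m₀ _ (fun m hm ↦ (hP O hO _ _ _ (by lia)).of_iso_right (e' m).symm) g ?_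
          apply (shiftFunctor _ (1 : ℤ)).map_injective
          rw [Functor.map_comp, hg, Functor.map_zero, Category.assoc, Category.assoc, hz1,
            comp_zero, comp_zero]
        rw [← cancel_epi e1.hom, ← hg, this, Functor.map_zero, comp_zero]
      obtain ⟨ψ, hψ⟩ : ∃ ψ : SF i O ⟶ τ m₀, φ = ψ ≫ p := Triangle.coyoneda_exact₃ _ hL φ hz2
      obtain ⟨ψ', rfl⟩ := hsurj m₀ _ (fun m hm ↦ ((hP O hO (-m - 1 - 1) _ _ (by lia))).of_iso_right
        ((SFshift 1 (-m - 1) _ (by lia) _).symm ≪≫ (shiftFunctor _ (1 : ℤ)).mapIso (e' m).symm)) ψ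
      have hz3 : v m₀ ≫ p = 0 := comp_distTriang_mor_zero₁₂ _ hL
      rw [hψ, Category.assoc, hz3, comp_zero]
    have := isIso_HH_mor₁ _ hL n (n - 1) (by lia) (h0 _ (by lia)) (h0 _ (by lia))
    exact this
  obtain ⟨u, hu⟩ := (hH G).1 π hπ
  have : IsIso u := by
    rw [isIso_iff]
    intro n
    have h1 := hv_iso n.natAbs n (by lia)
    have h2 := hiso n.natAbs n (by lia)
    rw [← hu, Functor.map_comp] at h2
    exact IsIso.of_isIso_comp_right _ ((homologyFunctor A n).map (v n.natAbs))
  refine HZ.of_iso_right (fun g ↦ ?_) (asIso u).symm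
  have hCF (m : ℕ) : HZ C (F m) := (hC _).of_iso_right (e' m).symm
  refine hinj 0 C (fun m _ ↦ hCF m) g ?_
  have := hτ 0
  have hle (i : ℤ) (hi : max N 0 < i) : IsZero (HH i G) := isZero_of_isLE G N i (by lia)
  have : (τ 0).IsLE (max N 0) := by
    rw [isLE_iff]
    intro i hi
    have := hiso 0 i (by lia)
    exact (hle i hi).of_iso (asIso ((homologyFunctor A i).map (π 0))).symm
  refine HZ.of_bounded_right (max N 0).toNat 0 (max N 0) (by lia) (τ 0) (by simpa using hτ 0) this
    (fun i ↦ ?_) _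
  by_cases hi : i < 0
  · exact .of_isZero_right (Functor.map_isZero _ (hτ0 0 i (by lia)))
  · have := hiso 0 i (by lia)
    exact (hC i).of_iso_right ((singleFunctor A i).mapIso (asIso ((homologyFunctor A i).map (π 0))))

end LN

namespace LN

universe w v w'
variable {A : Type v} [Category.{w'} A] [Abelian A] [HasDerivedCategory.{w} A]
open DerivedCategory

open Pretriangulated

lemma exists_triangle_SF (n : ℤ) {X₁ X₂ X₃ : A} {f : X₁ ⟶ X₂} {g : X₂ ⟶ X₃} {w : f ≫ g = 0}
    (h : (ShortComplex.mk f g w).ShortExact) :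
    ∃ δ, Triangle.mk ((singleFunctor A n).map f) ((singleFunctor A n).map g) δ ∈ distTriang _ := by
  have := h.map_of_exact (HomologicalComplex.single A (.up ℤ) n)
  exact exists_triangle this

lemma HZ.SF_shift {n m n' m' : ℤ} (h' : n' - n = m' - m) {Y M : A} (h : HZ (SF n Y) (SF m M)) :
    HZ (SF n' Y) (SF m' M) :=
  (h.shift (n - n')).of_iso (SFshift _ _ _ (by lia) _) (SFshift _ _ _ (by lia) _)

section
variable {X₁ X₂ X₃ : A} {f : X₁ ⟶ X₂} {g : X₂ ⟶ X₃} {w : f ≫ g = 0}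
  (hS : (ShortComplex.mk f g w).ShortExact)
include hS

lemma HZ.right_SF₁ {C : DerivedCategory A} (m m' : ℤ) (h' : m' = m + 1) (h₃ : HZ C (SF m' X₃))
    (h₂ : HZ C (SF m X₂)) : HZ C (SF m X₁) := by
  obtain ⟨δ, hT⟩ := exists_triangle_SF m hS
  exact HZ.right₁ _ hT h₂ (h₃.of_iso_right (SFshift _ _ _ (by lia) _).symm)

lemma HZ.right_SF₃ {C : DerivedCategory A} (m m' : ℤ) (h' : m' + 1 = m) (h₂ : HZ C (SF m X₂))
    (h₁ : HZ C (SF m' X₁)) : HZ C (SF m X₃) := by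
  obtain ⟨δ, hT⟩ := exists_triangle_SF m hS
  exact HZ.right₃ _ hT h₂ (h₁.of_iso_right (SFshift _ _ _ (by lia) _).symm)

lemma exists_lift_of_ext {Y : A} {n m : ℤ} (h' : m + 1 = n) (h₁ : HZ (SF n Y) (SF m X₁))
    (ψ : Y ⟶ X₃) : ∃ l : Y ⟶ X₂, l ≫ g = ψ := by
  obtain ⟨δ, hT⟩ := exists_triangle_SF n hS
  obtain ⟨l, hl⟩ := exists_lift_of_HZ hT (h₁.of_iso_right (SFshift _ _ _ (by lia) _).symm)
    ((singleFunctor A n).map ψ)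
  obtain ⟨l, rfl⟩ := (singleFunctor A n).map_surjective l
  exact ⟨l, (singleFunctor A n).map_injective (by rw [Functor.map_comp, hl])⟩

lemma HZ.ext_of_lift {Y : A} {n m : ℤ} (h' : m + 1 = n) (h₂ : HZ (SF n Y) (SF m X₂))
    (h : ∀ ψ : Y ⟶ X₃, ∃ l : Y ⟶ X₂, l ≫ g = ψ) : HZ (SF n Y) (SF m X₁) := by
  obtain ⟨δ, hT⟩ := exists_triangle_SF n hS
  have e₁ : (SF n X₁)⟦(1 : ℤ)⟧ ≅ SF m X₁ := SFshift _ _ _ (by lia) _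
  have e₂ : (SF n X₂)⟦(1 : ℤ)⟧ ≅ SF m X₂ := SFshift _ _ _ (by lia) _
  refine HZ.of_iso_right (fun φ ↦ ?_) e₁
  obtain ⟨ψ, hψ⟩ : ∃ ψ : SF n Y ⟶ SF n X₃, φ = ψ ≫ δ :=
    Triangle.coyoneda_exact₁ _ hT φ (h₂.of_iso_right e₂.symm _)
  obtain ⟨ψ, rfl⟩ := (singleFunctor A n).map_surjective ψ
  obtain ⟨l, rfl⟩ := h ψ
  have : (singleFunctor A n).map g ≫ δ = 0 := comp_distTriang_mor_zero₂₃ _ hT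
  rw [hψ, Functor.map_comp, Category.assoc, this, comp_zero]
end

lemma HZ.injective {n m : ℤ} (h : m < n) (Y I : A) [Injective I] : HZ (SF n Y) (SF m I) := by
  have : CochainComplex.IsKInjective ((HomologicalComplex.single A (.up ℤ) m).obj I) := by
    have : CochainComplex.IsStrictlyGE ((HomologicalComplex.single A (.up ℤ) m).obj I) m := by
      rw [CochainComplex.isStrictlyGE_iff]
      exact fun i hi ↦ HomologicalComplex.isZero_single_obj_X _ _ _ _ hi.ne
    have (i : ℤ) : Injective (((HomologicalComplex.single A (.up ℤ) m).obj I).X i) := by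
      by_cases hi : i = m
      · subst hi
        exact Injective.of_iso (HomologicalComplex.singleObjXSelf (.up ℤ) i I).symm inferInstance
      · exact Injective.of_iso (HomologicalComplex.isZero_single_obj_X _ _ _ _ hi).isoZero.symm
          inferInstance
    exact CochainComplex.isKInjective_of_injective _ m
  intro φ
  obtain ⟨f, hf⟩ := exists_Q_map_eq (K := (HomologicalComplex.single A (.up ℤ) n).obj Y)
    (L := (HomologicalComplex.single A (.up ℤ) m).obj I) φ
  have : f = 0 := by
    refine HomologicalComplex.hom_ext _ _ fun i ↦ ?_
    by_cases hi : i = n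
    · exact (HomologicalComplex.isZero_single_obj_X _ _ _ _ (by lia)).eq_of_tgt _ _
    · exact (HomologicalComplex.isZero_single_obj_X _ _ _ _ hi).eq_of_src _ _
  rw [this, Functor.map_zero] at hf
  exact hf.symm

/-- Vanishing of extensions of a coproduct. -/
lemma HZ.of_isColimit [EnoughInjectives A] {κ : Type z} {O : κ → A} (c : Cofan O)
    (hc : IsColimit c) (k : ℕ) : ∀ (M : A)
    (_ : ∀ i (j : ℕ), j ≤ k → HZ (SF (j + 1) (O i)) (SF 0 M)), HZ (SF (k + 1) c.pt) (SF 0 M) := by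
  induction k with
  | zero =>
    intro M h
    refine HZ.ext_of_lift (f := Injective.ι M) (g := cokernel.π (Injective.ι M))
      (w := cokernel.condition _) { exact := ShortComplex.exact_cokernel _ } (by simp)
      (.injective (by simp) _ _) fun ψ ↦ ?_
    choose l hl using fun i ↦ exists_lift_of_ext (f := Injective.ι M)
      (g := cokernel.π (Injective.ι M))
      (w := cokernel.condition _) { exact := ShortComplex.exact_cokernel _ } (by simp)
      (h i 0 le_rfl) (c.inj i ≫ ψ)
    refine ⟨Cofan.IsColimit.desc hc l, Cofan.IsColimit.hom_ext hc _ _ fun i ↦ ?_⟩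
    rw [← Category.assoc, Cofan.IsColimit.fac, hl]
  | succ k ih =>
    intro M h
    have hS : (ShortComplex.mk (Injective.ι M) (cokernel.π (Injective.ι M))
      (cokernel.condition _)).ShortExact := { exact := ShortComplex.exact_cokernel _ }
    refine HZ.right_SF₁ hS 0 1 (by lia) ?_ (.injective (by positivity) _ _)
    refine HZ.SF_shift (n := k + 1) (m := 0) (by push_cast; lia) (ih _ fun i j hj ↦ ?_)
    exact HZ.right_SF₃ hS 0 (-1) (by lia) (.injective (by positivity) _ _)
      ((h i (j + 1) (by lia)).SF_shift (by push_cast; lia))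

end LN

namespace LN

universe w v w'
variable {A : Type v} [Category.{w'} A] [Abelian A] [HasDerivedCategory.{w} A]
open DerivedCategory

open Pretriangulated
section
variable {X₁ X₂ X₃ : A} {f : X₁ ⟶ X₂} {g : X₂ ⟶ X₃} {w : f ≫ g = 0}
  (hS : (ShortComplex.mk f g w).ShortExact)
include hS

/-- The connecting map of a short exact sequence. -/
lemma exists_conn (n m : ℤ) (h : m + 1 = n) : ∃ d : SF n X₃ ⟶ SF m X₁,
    (singleFunctor A n).map g ≫ d = 0 ∧ d ≫ (singleFunctor A m).map f = 0 ∧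
    (∀ (C : DerivedCategory A) (α : C ⟶ SF m X₁), α ≫ (singleFunctor A m).map f = 0 →
      ∃ β : C ⟶ SF n X₃, α = β ≫ d) ∧
    (∀ (Z : DerivedCategory A) (α : SF n X₃ ⟶ Z), (singleFunctor A n).map g ≫ α = 0 →
      ∃ β : SF m X₁ ⟶ Z, α = d ≫ β) := by
  obtain ⟨δ, hT⟩ := exists_triangle_SF n hS
  let e := (singleFunctors A).shiftIso 1 m n (by lia)
  have ne : e.hom.app X₁ ≫ (singleFunctor A m).map f =
      ((singleFunctor A n).map f)⟦(1 : ℤ)⟧' ≫ e.hom.app X₂ := (e.hom.naturality f).symm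
  have h₁ : (singleFunctor A n).map g ≫ δ = 0 := comp_distTriang_mor_zero₂₃ _ hT
  have h₂ : δ ≫ ((singleFunctor A n).map f)⟦(1 : ℤ)⟧' = 0 := comp_distTriang_mor_zero₃₁ _ hT
  refine ⟨δ ≫ e.hom.app X₁, ?_, ?_, fun C α hα ↦ ?_, fun Z α hα ↦ ?_⟩
  · rw [← Category.assoc, h₁, zero_comp]
  · rw [Category.assoc, ne, ← Category.assoc, h₂, zero_comp]
  · have : (α ≫ e.inv.app X₁) ≫ ((singleFunctor A n).map f)⟦(1 : ℤ)⟧' = 0 := by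
      rw [← cancel_mono (e.hom.app X₂), Category.assoc, Category.assoc, ← ne,
        Iso.inv_hom_id_app_assoc, hα, zero_comp]
    obtain ⟨β, hβ⟩ : ∃ β : C ⟶ SF n X₃, α ≫ e.inv.app X₁ = β ≫ δ :=
      Triangle.coyoneda_exact₁ _ hT (α ≫ e.inv.app X₁) this
    refine ⟨β, ?_⟩
    rw [← Category.assoc, ← hβ, Category.assoc, Iso.inv_hom_id_app]
    exact (Category.comp_id _).symm
  · obtain ⟨β, hβ⟩ : ∃ β : (SF n X₁)⟦(1 : ℤ)⟧ ⟶ Z, α = δ ≫ β := Triangle.yoneda_exact₃ _ hT α hα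
    refine ⟨e.inv.app X₁ ≫ β, ?_⟩
    rw [Category.assoc, Iso.hom_inv_id_app_assoc]
    exact hβ

lemma SF_eq_zero_of_shortExact {n m : ℤ} (hmn : m < n) {N : A} (φ : SF n X₃ ⟶ SF m N)
    (h : (singleFunctor A n).map g ≫ φ = 0)
    (hext : m + 1 = n → ∀ ψ : X₁ ⟶ N, ∃ ψ', f ≫ ψ' = ψ)
    (hz : m + 1 < n → HZ (SF (n - 1) X₁) (SF m N)) : φ = 0 := by
  obtain ⟨d, -, h₂, -, h₄⟩ := exists_conn hS n (n - 1) (by lia)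
  obtain ⟨β, rfl⟩ := h₄ _ φ h
  obtain hmn | hmn := (show m + 1 ≤ n from hmn).eq_or_lt
  · obtain rfl : m = n - 1 := by lia
    obtain ⟨β, rfl⟩ := (singleFunctor A _).map_surjective β
    obtain ⟨ψ, rfl⟩ := hext hmn β
    rw [Functor.map_comp, ← Category.assoc, h₂, zero_comp]
  · rw [hz hmn β, comp_zero]
end

lemma MVSquare.SF_eq_zero {T₀₁ T₀ T₁ T : A} (S : MVSquare T₀₁ T₀ T₁ T) {n m : ℤ} (hmn : m < n)
    {N : A} (φ : SF n T ⟶ SF m N) (h₀ : (singleFunctor A n).map S.j₀ ≫ φ = 0)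
    (h₁ : (singleFunctor A n).map S.j₁ ≫ φ = 0)
    (hext : m + 1 = n → ∀ ψ : T₀₁ ⟶ N, ∃ ψ₀ ψ₁, ψ = S.i₀ ≫ ψ₀ + S.i₁ ≫ ψ₁)
    (hz : m + 1 < n → HZ (SF (n - 1) T₀₁) (SF m N)) : φ = 0 := by
  refine SF_eq_zero_of_shortExact S.shortExact hmn φ ?_ (fun h ψ ↦ ?_) hz
  · rw [biprod.desc_eq, Functor.map_add, Preadditive.add_comp, Functor.map_comp, Functor.map_comp,
      Category.assoc, Category.assoc, h₀, h₁, comp_zero, comp_zero, add_zero]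
  · obtain ⟨ψ₀, ψ₁, rfl⟩ := hext h ψ
    exact ⟨biprod.desc ψ₀ (-ψ₁), by simp⟩

lemma exists_conn_injective [EnoughInjectives A] (N : A) (n m : ℤ) (h : m + 1 = n) :
    ∃ (I N' : A) (g : I ⟶ N') (_ : Epi g) (d : SF n N' ⟶ SF m N),
      (singleFunctor A n).map g ≫ d = 0 ∧
      ∀ (k : ℤ) (Y : A) (α : SF k Y ⟶ SF m N), m < k → ∃ β : SF k Y ⟶ SF n N', α = β ≫ d := by
  have hS : (ShortComplex.mk (Injective.ι N) (cokernel.π (Injective.ι N))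
    (cokernel.condition _)).ShortExact :=
    { exact := ShortComplex.exact_cokernel _ }
  obtain ⟨d, h₁, -, h₃, -⟩ := exists_conn hS n m h
  exact ⟨_, _, cokernel.π (Injective.ι N), inferInstance, d, h₁,
    fun k Y α hk ↦ h₃ _ α (HZ.injective hk _ _ _)⟩
end LN

namespace LN

universe w v w'
variable {A : Type v} [Category.{w'} A] [Abelian A] [HasDerivedCategory.{w} A]
open DerivedCategory

open Pretriangulated

/-- A property of objects stable under kernels, cokernels and extensions. -/
structure WeakSerre (P : A → Prop) : Prop where
  ker {K L M : A} (f : K ⟶ L) (g : L ⟶ M) (w : f ≫ g = 0) [Mono f]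
    (h : (ShortComplex.mk f g w).Exact) (hL : P L) (hM : P M) : P K
  coker {K L M : A} (f : K ⟶ L) (g : L ⟶ M) (w : f ≫ g = 0) [Epi g]
    (h : (ShortComplex.mk f g w).Exact) (hK : P K) (hL : P L) : P M
  ext {K L M : A} (f : K ⟶ L) (g : L ⟶ M) (w : f ≫ g = 0)
    (h : (ShortComplex.mk f g w).ShortExact) (hK : P K) (hM : P M) : P L

namespace WeakSerre
variable {P Q' : A → Prop}

lemma and (hP : WeakSerre P) (hQ : WeakSerre Q') : WeakSerre fun M ↦ P M ∧ Q' M where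
  ker f g w _ h hL hM := ⟨hP.ker f g w h hL.1 hM.1, hQ.ker f g w h hL.2 hM.2⟩
  coker f g w _ h hL hM := ⟨hP.coker f g w h hL.1 hM.1, hQ.coker f g w h hL.2 hM.2⟩
  ext f g w h hL hM := ⟨hP.ext f g w h hL.1 hM.1, hQ.ext f g w h hL.2 hM.2⟩

variable (hP : WeakSerre P)
include hP

lemma kernel {K L : A} (f : K ⟶ L) (hK : P K) (hL : P L) : P (kernel f) :=
  hP.ker (kernel.ι f) f (kernel.condition f) (ShortComplex.exact_kernel f) hK hL

lemma cokernel {K L : A} (f : K ⟶ L) (hK : P K) (hL : P L) : P (cokernel f) :=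
  hP.coker f (cokernel.π f) (cokernel.condition f) (ShortComplex.exact_cokernel f) hK hL

lemma five {K L M N O : A} (a : K ⟶ L) (b : L ⟶ M) (c : M ⟶ N) (d : N ⟶ O) (w₁ : a ≫ b = 0)
    (w₂ : b ≫ c = 0) (w₃ : c ≫ d = 0) (h₁ : (ShortComplex.mk a b w₁).Exact)
    (h₂ : (ShortComplex.mk b c w₂).Exact) (h₃ : (ShortComplex.mk c d w₃).Exact)
    (hK : P K) (hL : P L) (hN : P N) (hO : P O) : P M := by
  let i : Limits.cokernel a ⟶ M := cokernel.desc a b w₁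
  let p : M ⟶ Limits.kernel d := kernel.lift d c w₃
  have hi : Mono i := h₁.mono_cokernelDesc
  have hp : Epi p := h₃.epi_kernelLift
  have w : i ≫ p = 0 := by
    rw [← cancel_epi (cokernel.π a), ← cancel_mono (kernel.ι d)]
    simp [i, p, w₂]
  refine hP.ext i p w ⟨?_⟩ (hP.cokernel a hK hL) (hP.kernel d hN hO)
  rw [ShortComplex.exact_iff_exact_up_to_refinements] at h₂ ⊢
  intro T x hx
  obtain ⟨T', π, hπ, y, hy⟩ := h₂ x (by
    change x ≫ c = 0
    have := congr($hx ≫ kernel.ι d)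
    simpa [p] using this)
  exact ⟨T', π, hπ, y ≫ cokernel.π a, by simpa [i] using hy⟩

lemma homology (K : CochainComplex A ℤ) (h : ∀ i, P (K.X i)) (n : ℤ) : P (K.homology n) := by
  have hc : P (K.cycles n) := by
    refine hP.ker (K.iCycles n) (K.d n (n + 1)) (by simp) ?_ (h _) (h _)
    exact ShortComplex.exact_of_f_is_kernel _ (K.cyclesIsKernel n (n + 1) (by simp))
  refine hP.coker (K.toCycles (n - 1) n) (K.homologyπ n) (by simp) ?_ (h _) hc
  exact ShortComplex.exact_of_g_is_cokernel _ (K.homologyIsCokernel (n - 1) n (by simp))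

lemma of_triangle {K L M : DerivedCategory A} {f : K ⟶ L} {g : L ⟶ M} {δ : M ⟶ K⟦(1 : ℤ)⟧}
    (hT : Triangle.mk f g δ ∈ distTriang _) (hK : ∀ n, P (HH n K)) (hL : ∀ n, P (HH n L)) (n : ℤ) :
    P (HH n M) := by
  have h₁ := HomologySequence.exact₂ _ hT n
  have h₂ := HomologySequence.exact₃ _ hT n (n + 1) rfl
  have h₃ := HomologySequence.exact₁ _ hT n (n + 1) rfl
  exact hP.five _ _ _ _ _ _ _ h₁ h₂ h₃ (hK n) (hL n) (hK (n + 1)) (hL (n + 1))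

end WeakSerre
end LN

namespace LN

variable {X : Scheme.{u}}

section
universe v' u'
variable {C : Type u'} [Category.{v'} C] {J : GrothendieckTopology C} (R : Sheaf J RingCat.{u})

instance (K : Type u) [SmallCategory K] [IsFiltered K] (R : Cᵒᵖ ⥤ RingCat.{u}) :
    HasExactColimitsOfShape K (PresheafOfModules.{u} R) :=
  have : PreservesColimitsOfSize.{u, u} (PresheafOfModules.toPresheaf.{u} R) := inferInstance
  have : PreservesFiniteLimits (PresheafOfModules.toPresheaf.{u} R) := inferInstance
  have : ReflectsFiniteLimits (PresheafOfModules.toPresheaf.{u} R) := 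
    { reflects := fun _ _ _ ↦ inferInstance }
  HasExactColimitsOfShape.domain_of_functor K (PresheafOfModules.toPresheaf.{u} R)

variable [HasSheafify J AddCommGrpCat.{u}] [J.WEqualsLocallyBijective AddCommGrpCat.{u}]

lemma ab5_sheafOfModules : AB5OfSize.{u, u} (SheafOfModules.{u} R) where
  ofShape K _ _ :=
    have : (SheafOfModules.forget.{u} R ⋙ PresheafOfModules.restrictScalars (𝟙 R.obj)).Full := inferInstance
    (PresheafOfModules.sheafificationAdjunction (𝟙 R.obj)).hasExactColimitsOfShape K

end

instance : IsGrothendieckAbelian.{u} X.Modules where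
  ab5OfSize := ab5_sheafOfModules X.ringCatSheaf
  hasSeparator := ⟨∐ fun U : X.Opens ↦ OO X U, by
    refine ObjectProperty.IsSeparating.isSeparator_coproduct fun F G f g h ↦ ?_
    refine hom_ext_apply fun U s ↦ ?_
    have := h _ ⟨U⟩ (ofSec s)
    rw [ofSec_comp, ofSec_comp] at this
    rw [← ofSec_one (f.app U s), this, ofSec_one]⟩

instance : EnoughInjectives X.Modules := inferInstance

end LN

namespace LN

variable {X : Scheme.{u}}

/-- Restriction of functions. -/
def rr {V W : X.Opens} (h : V ≤ W) : Γ(X, W) →+* Γ(X, V) := (X.presheaf.map (homOfLE h).op).hom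

lemma rr_rr {V W Z : X.Opens} (h : V ≤ W) (h' : W ≤ Z) (a : Γ(X, Z)) :
    rr h (rr h' a) = rr (h.trans h') a := res_res (unitMod X) h h' a

lemma res_rr_smul (M : X.Modules) {V W : X.Opens} (h : V ≤ W) (a : Γ(X, W)) (s : Γ(M, W)) :
    res M h (a • s) = rr h a • res M h s := res_smul M h a s

lemma basicOpen_rr {V W : X.Opens} (h : V ≤ W) (f : Γ(X, W)) :
    X.basicOpen (rr h f) = V ⊓ X.basicOpen f := X.basicOpen_res f (homOfLE h).op

lemma isUnit_rr {V D : X.Opens} (h : D ≤ V) (f : Γ(X, V)) (hD : D ≤ X.basicOpen f) :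
    IsUnit (rr h f) := by
  have h1 : IsUnit (rr (X.basicOpen_le f) f) := RingedSpace.isUnit_res_basicOpen _ f
  have := h1.map (rr hD)
  rwa [rr_rr] at this

/-- Sections over affine opens contained in `W` behave as for quasi-coherent modules. -/
structure QCOn (W : X.Opens) (N : X.Modules) : Prop where
  inj {V D : X.Opens} (hV : IsAffineOpen V) (hVW : V ≤ W) (h : D ≤ V) (f : Γ(X, V))
    (hD : D = X.basicOpen f) (s : Γ(N, V)) (hs : res N h s = 0) : ∃ n : ℕ, f ^ n • s = 0
  surj {V D : X.Opens} (hV : IsAffineOpen V) (hVW : V ≤ W) (h : D ≤ V) (f : Γ(X, V))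
    (hD : D = X.basicOpen f) (t : Γ(N, D)) : ∃ (n : ℕ) (s : Γ(N, V)), res N h s = rr h f ^ n • t

namespace QCOn
variable {W : X.Opens} {M N K : X.Modules}

lemma le (hN : QCOn W N) {W' : X.Opens} (h : W' ≤ W) : QCOn W' N :=
  ⟨fun hV hVW ↦ hN.inj hV (hVW.trans h), fun hV hVW ↦ hN.surj hV (hVW.trans h)⟩

lemma of_retract (hN : QCOn W N) (i : M ⟶ N) (p : N ⟶ M) (hip : i ≫ p = 𝟙 M) : QCOn W M := by
  have key {V} (s : Γ(M, V)) : p.app V (i.app V s) = s := by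
    rw [← comp_app_apply, hip]; rfl
  refine ⟨fun {V D} hV hVW h f hD s hs ↦ ?_, fun {V D} hV hVW h f hD t ↦ ?_⟩
  · obtain ⟨n, hn⟩ := hN.inj hV hVW h f hD (i.app V s) (by rw [← app_res, hs, map_zero])
    exact ⟨n, by rw [← key (f ^ n • s), Scheme.Modules.Hom.app_smul, hn, map_zero]⟩
  · obtain ⟨n, s, hs⟩ := hN.surj hV hVW h f hD (i.app D t)
    exact ⟨n, p.app V s, by rw [← app_res, hs, Scheme.Modules.Hom.app_smul, key]⟩

lemma of_iso (hN : QCOn W N) (e : N ≅ M) : QCOn W M := hN.of_retract e.inv e.hom e.inv_hom_id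

lemma of_bijective (hN : QCOn W N) (φ : M ⟶ N)
    (hφ : ∀ V ≤ W, Function.Bijective (φ.app V)) : QCOn W M := by
  refine ⟨fun {V D} hV hVW h f hD s hs ↦ ?_, fun {V D} hV hVW h f hD t ↦ ?_⟩
  · obtain ⟨n, hn⟩ := hN.inj hV hVW h f hD (φ.app V s) (by rw [← app_res, hs, map_zero])
    exact ⟨n, (hφ V hVW).1 (by rw [Scheme.Modules.Hom.app_smul, hn, map_zero])⟩
  · obtain ⟨n, s, hs⟩ := hN.surj hV hVW h f hD (φ.app D t)
    obtain ⟨s, rfl⟩ := (hφ V hVW).2 s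
    exact ⟨n, s, (hφ D (h.trans hVW)).1 (by rw [app_res, hs, Scheme.Modules.Hom.app_smul])⟩

lemma of_bijective' (hM : QCOn W M) (φ : M ⟶ N)
    (hφ : ∀ V ≤ W, Function.Bijective (φ.app V)) : QCOn W N := by
  refine ⟨fun {V D} hV hVW h f hD s hs ↦ ?_, fun {V D} hV hVW h f hD t ↦ ?_⟩
  · obtain ⟨s, rfl⟩ := (hφ V hVW).2 s
    obtain ⟨n, hn⟩ := hM.inj hV hVW h f hD s
      ((hφ D (h.trans hVW)).1 (by rw [app_res, hs, map_zero]))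
    exact ⟨n, by rw [← Scheme.Modules.Hom.app_smul, hn, map_zero]⟩
  · obtain ⟨t, rfl⟩ := (hφ D (h.trans hVW)).2 t
    obtain ⟨n, s, hs⟩ := hM.surj hV hVW h f hD t
    exact ⟨n, φ.app V s, by rw [← app_res, hs, Scheme.Modules.Hom.app_smul]⟩

lemma unit : QCOn W (unitMod X) := by
  refine ⟨fun {V D} hV hVW h f hD s hs ↦ ?_, fun {V D} hV hVW h f hD t ↦ ?_⟩
  · subst hD
    have := hV.isLocalization_basicOpen f
    obtain ⟨⟨_, n, rfl⟩, hn⟩ := (IsLocalization.map_eq_zero_iff (.powers f) Γ(X, X.basicOpen f) s).1 hs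
    exact ⟨n, hn⟩
  · subst hD
    have := hV.isLocalization_basicOpen f
    obtain ⟨⟨s, ⟨_, n, rfl⟩⟩, hn⟩ := IsLocalization.surj (.powers f) (S := Γ(X, X.basicOpen f)) t
    refine ⟨n, s, hn.symm.trans ?_⟩
    rw [← map_pow]
    exact mul_comm (show Γ(X, X.basicOpen f) from t) _

lemma OO {V : X.Opens} (h : W ≤ V) : QCOn W (OO X V) :=
  unit.of_bijective (OOε V) fun _ hV ↦ cutε_bijective _ (hV.trans h)

end QCOn

end LN

namespace LN

variable {X : Scheme.{u}}

lemma exists_basicOpen_le' {V V' : X.Opens} (hV : IsAffineOpen V) {x : X} (hx : x ∈ V)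
    (hx' : x ∈ V') : ∃ f : Γ(X, V), X.basicOpen f ≤ V' ∧ x ∈ X.basicOpen f := by
  obtain ⟨f, hf, hxf⟩ := hV.exists_basicOpen_le (V := V') ⟨x, hx'⟩ hx
  exact ⟨f, hf, hxf⟩

lemma sup_basicOpen {V : X.Opens} (f g : Γ(X, V))
    (h : IsUnit (f + g)) : X.basicOpen f ⊔ X.basicOpen g = V := by
  refine le_antisymm (sup_le (X.basicOpen_le f) (X.basicOpen_le g)) ?_
  calc V = X.basicOpen (f + g) := (X.basicOpen_of_isUnit h).symm
    _ ≤ _ := X.basicOpen_add_le f g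

/-- A local property of the affine opens contained in an affine open can be checked on covers by
two basic opens. -/
lemma affine_local {Z : X.Opens → Prop} {V : X.Opens} (hV : IsAffineOpen V) (h0 : Z ⊥)
    (hmono : ∀ V' V'', V' ≤ V → IsAffineOpen V'' → V'' ≤ V' → Z V' → Z V'')
    (hloc : ∀ x ∈ V, ∃ V' ≤ V, x ∈ V' ∧ Z V')
    (hglue : ∀ V' ≤ V, IsAffineOpen V' → ∀ f g : Γ(X, V'), IsUnit (f + g) →
      Z (X.basicOpen f) → Z (X.basicOpen g) → Z V') : Z V := by
  let I : Ideal Γ(X, V) :=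
    { carrier := {f | Z (X.basicOpen f)}
      zero_mem' := by
        change Z (X.basicOpen 0)
        rwa [X.basicOpen_zero]
      smul_mem' := fun a f hf ↦ by
        refine hmono _ _ (X.basicOpen_le f) (hV.basicOpen _) ?_ hf
        rw [smul_eq_mul, X.basicOpen_mul]
        exact inf_le_right
      add_mem' := fun {f g} hf hg ↦ by
        let h := X.basicOpen_le (f + g)
        refine hglue _ h (hV.basicOpen _) (rr h f) (rr h g) ?_
          (hmono _ _ (X.basicOpen_le f) ((hV.basicOpen _).basicOpen _) ?_ hf)
          (hmono _ _ (X.basicOpen_le g) ((hV.basicOpen _).basicOpen _) ?_ hg)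
        · rw [← map_add]
          exact isUnit_rr h _ le_rfl
        · rw [basicOpen_rr]
          exact inf_le_right
        · rw [basicOpen_rr]
          exact inf_le_right }
  have hI : Ideal.span (I : Set Γ(X, V)) = ⊤ := by
    rw [← hV.self_le_iSup_basicOpen_iff]
    intro x hx
    obtain ⟨V', hV', hxV', hZ⟩ := hloc x hx
    obtain ⟨f, hf, hxf⟩ := exists_basicOpen_le' hV hx hxV'
    exact Opens.mem_iSup.2 ⟨⟨f, hmono _ _ hV' (hV.basicOpen f) hf hZ⟩, hxf⟩
  have h1 : (1 : Γ(X, V)) ∈ I := by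
    rw [Ideal.span_eq] at hI
    rw [hI]
    trivial
  have h2 : Z (X.basicOpen (1 : Γ(X, V))) := h1
  rwa [X.basicOpen_of_isUnit isUnit_one] at h2

lemma QCOn.exists_sub {W : X.Opens} {N : X.Modules} (hN : QCOn W N) {V : X.Opens}
    (hV : IsAffineOpen V) (hVW : V ≤ W) (f g : Γ(X, V)) (h : IsUnit (f + g))
    (t : Γ(N, X.basicOpen f ⊓ X.basicOpen g)) :
    ∃ (s₁ : Γ(N, X.basicOpen f)) (s₂ : Γ(N, X.basicOpen g)),
      t = res N inf_le_left s₁ + res N inf_le_right s₂ := by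
  obtain ⟨n₁, s₁, h₁⟩ := hN.surj (hV.basicOpen f) ((X.basicOpen_le f).trans hVW) inf_le_left
    (rr (X.basicOpen_le f) g) (basicOpen_rr _ g).symm t
  obtain ⟨n₂, s₂, h₂⟩ := hN.surj (hV.basicOpen g) ((X.basicOpen_le g).trans hVW) inf_le_right
    (rr (X.basicOpen_le g) f) (by rw [basicOpen_rr, inf_comm]) t
  have hfg : IsCoprime f g := by
    obtain ⟨u, hu⟩ := h.exists_left_inv
    exact ⟨u, u, by rw [← mul_add, hu]⟩
  obtain ⟨a, b, hab⟩ := hfg.pow (m := n₂) (n := n₁)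
  have hle : X.basicOpen f ⊓ X.basicOpen g ≤ V := inf_le_left.trans (X.basicOpen_le f)
  refine ⟨rr (X.basicOpen_le f) b • s₁, rr (X.basicOpen_le g) a • s₂, ?_⟩
  rw [res_rr_smul, res_rr_smul, h₁, h₂, rr_rr, rr_rr, rr_rr, rr_rr, smul_smul, smul_smul, ← map_pow,
    ← map_pow, ← map_mul, ← map_mul, ← add_smul, ← map_add, add_comm, hab, map_one, one_smul]

end LN

namespace LN

variable {X : Scheme.{u}}

open DerivedCategory

lemma OOLE_OOLE {U V W : X.Opens} (h : U ≤ V) (h' : V ≤ W) :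
    OOLE h ≫ OOLE h' = OOLE (h.trans h') :=
  OO_hom_ext (by rw [OOLE_comp_app, OOLE_one, OOLE_one, res_res])

lemma OOLE_self {U : X.Opens} (h : U ≤ U) : OOLE h = 𝟙 (OO X U) :=
  OO_hom_ext (by rw [OOLE_one, res_self]; rfl)

lemma hom_eq_add_of_section {U V W : X.Opens} {N : X.Modules} (h : U ≤ V) (h' : U ≤ W)
    (ψ : OO X U ⟶ N) (s : Γ(N, V)) (t : Γ(N, W))
    (e : ψ.app U (one U) = res N h s + res N h' t) :
    ψ = OOLE h ≫ ofSec s + OOLE h' ≫ ofSec t := by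
  refine OO_hom_ext (e.trans ?_)
  have : (OOLE h ≫ ofSec s + OOLE h' ≫ ofSec t).app U (one U) =
    (OOLE h ≫ ofSec s).app U (one U) + (OOLE h' ≫ ofSec t).app U (one U) := rfl
  rw [this, OOLE_comp_app, OOLE_comp_app, ofSec_one, ofSec_one]

variable [HasDerivedCategory.{u + 1} X.Modules]

/-- Classes of positive degree vanish locally. -/
lemma exists_OOLE_comp_eq_zero (k : ℕ) : ∀ (N : X.Modules) (n m : ℤ) (_ : m + (k + 1) = n)
    (V : X.Opens) (α : SF n (OO X V) ⟶ SF m N), ∀ x ∈ V, ∃ (V' : X.Opens) (h : V' ≤ V), x ∈ V' ∧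
      (singleFunctor X.Modules n).map (OOLE h) ≫ α = 0 := by
  induction k with
  | zero =>
    intro N n m hmn V α x hx
    obtain ⟨I, N', g, _, d, hd, h⟩ := exists_conn_injective N n m (by lia)
    obtain ⟨β, rfl⟩ := h n _ α (by lia)
    obtain ⟨ψ, rfl⟩ := (singleFunctor X.Modules n).map_surjective β
    obtain ⟨W, hW, hxW, t, ht⟩ := exists_local_lift g (ψ.app V (one V)) hx
    refine ⟨W, hW, hxW, ?_⟩
    have : OOLE hW ≫ ψ = ofSec t ≫ g := by
      apply OO_hom_ext
      rw [OOLE_comp_app, comp_app_apply, ofSec_one, ht]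
    rw [← Category.assoc, ← Functor.map_comp, this, Functor.map_comp, Category.assoc, hd, comp_zero]
  | succ k ih =>
    intro N n m hmn V α x hx
    obtain ⟨I, N', g, _, d, hd, h⟩ := exists_conn_injective N (m + 1) m rfl
    obtain ⟨β, rfl⟩ := h n _ α (by lia)
    obtain ⟨W, hW, hxW, e⟩ := ih N' n (m + 1) (by push_cast at hmn; lia) V β x hx
    exact ⟨W, hW, hxW, by rw [← Category.assoc, e, zero_comp]⟩

/-- Vanishing of the cohomology of quasi-coherent modules on affine opens. -/
lemma QCOn.hz_OO {W : X.Opens} {N : X.Modules} (hN : QCOn W N) (k : ℕ) :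
    ∀ (n m : ℤ) (_ : m + (k + 1) = n) (V : X.Opens) (_ : IsAffineOpen V) (_ : V ≤ W),
      HZ (SF n (LN.OO X V)) (SF m N) := by
  induction k with
  | zero => exact fun n m h V hV hVW ↦ aux n m (by lia) V hV hVW fun h ↦ by lia
  | succ k ih =>
    intro n m h V hV hVW
    refine aux n m (by lia) V hV hVW fun h' U hU hUW ↦ ih _ _ ?_ U hU hUW
    push_cast at h
    lia
where
  aux (n m : ℤ) (h : m < n) (V : X.Opens) (hV : IsAffineOpen V) (hVW : V ≤ W)
      (H : m + 1 < n → ∀ U : X.Opens, IsAffineOpen U → U ≤ W → HZ (SF (n - 1) (LN.OO X U)) (SF m N)) :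
      HZ (SF n (LN.OO X V)) (SF m N) := by
    intro α
    let Z (V' : X.Opens) : Prop := ∀ h : V' ≤ V, (singleFunctor X.Modules n).map (OOLE h) ≫ α = 0
    suffices Z V by
      have := this le_rfl
      rwa [OOLE_self, CategoryTheory.Functor.map_id, Category.id_comp] at this
    refine affine_local hV (fun h ↦ ?_) ?_ ?_ ?_
    · have : OOLE h = (0 : LN.OO X ⊥ ⟶ LN.OO X V) := by
        apply OO_hom_ext
        exact eq_of_locally _ _ _ fun x hx ↦ hx.elim
      rw [this, Functor.map_zero, zero_comp]
    · intro V' V'' hV' _ hVV hZ h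
      rw [← OOLE_OOLE hVV hV', Functor.map_comp, Category.assoc, hZ, comp_zero]
    · intro x hx
      obtain ⟨k, hk⟩ := Int.eq_ofNat_of_zero_le (show 0 ≤ n - m - 1 by lia)
      obtain ⟨V', hV', hx', e⟩ := exists_OOLE_comp_eq_zero k N n m (by lia) V α x hx
      exact ⟨V', hV', hx', fun _ ↦ e⟩
    · intro V' hV'V hV' f g hfg h₁ h₂ hV2
      have key (T : X.Opens) (hT : X.basicOpen f ⊔ X.basicOpen g = T) (hTV : T ≤ V) :
          (singleFunctor X.Modules n).map (OOLE hTV) ≫ α = 0 := by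
        subst hT
        refine (mvSquare _ _ (unitMod X)).SF_eq_zero h _ ?_ ?_ (fun hm ψ ↦ ?_) (fun hm ↦ ?_)
        · refine Eq.trans ?_ (h₁ (le_sup_left.trans hTV))
          rw [← OOLE_OOLE le_sup_left hTV, Functor.map_comp, Category.assoc]
          rfl
        · refine Eq.trans ?_ (h₂ (le_sup_right.trans hTV))
          rw [← OOLE_OOLE le_sup_right hTV, Functor.map_comp, Category.assoc]
          rfl
        · change LN.OO X _ ⟶ _ at ψ
          obtain ⟨s₁, s₂, e⟩ := hN.exists_sub hV' (hV'V.trans hVW) f g hfg (ψ.app _ (one _))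
          exact ⟨_, _, hom_eq_add_of_section _ _ ψ s₁ s₂ e⟩
        · refine H hm _ ?_ ((inf_le_left.trans (le_sup_left.trans hTV)).trans hVW)
          rw [← X.basicOpen_mul]
          exact hV'.basicOpen _
      exact key _ (sup_basicOpen f g hfg) hV2

lemma QCOn.hz {W : X.Opens} {N : X.Modules} (hN : QCOn W N) {n m : ℤ} (h : m < n) {V : X.Opens}
    (hV : IsAffineOpen V) (hVW : V ≤ W) : HZ (SF n (LN.OO X V)) (SF m N) := by
  obtain ⟨k, hk⟩ := Int.eq_ofNat_of_zero_le (show 0 ≤ n - m - 1 by lia)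
  exact hN.hz_OO k n m (by lia) V hV hVW

end LN

namespace LN

variable {X : Scheme.{u}}

lemma exists_of_exact {K L M : X.Modules} {f : K ⟶ L} {g : L ⟶ M} {w : f ≫ g = 0} [Mono f]
    (h : (ShortComplex.mk f g w).Exact) {V : X.Opens} (s : Γ(L, V))
    (hs : g.app V s = 0) : ∃ t, f.app V t = s := by
  have h1 : ofSec s ≫ g = 0 := by
    apply OO_hom_ext
    rw [comp_app_apply, ofSec_one, hs]; rfl
  obtain ⟨l, hl⟩ : ∃ l : OO X V ⟶ K, l ≫ f = ofSec s := h.lift' (ofSec s) h1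
  exact ⟨l.app V (one V), by rw [← comp_app_apply, hl, ofSec_one]⟩

variable [HasDerivedCategory.{u + 1} X.Modules]

lemma QCOn.surjective {W : X.Opens} {K L M : X.Modules} {f : K ⟶ L} {g : L ⟶ M} {w : f ≫ g = 0}
    (h : (ShortComplex.mk f g w).ShortExact) (hK : QCOn W K) {V : X.Opens} (hV : IsAffineOpen V)
    (hVW : V ≤ W) (s : Γ(M, V)) : ∃ t, g.app V t = s := by
  obtain ⟨l, hl⟩ := exists_lift_of_ext h (n := 1) (m := 0) rfl (hK.hz (by lia) hV hVW) (ofSec s)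
  exact ⟨l.app V (one V), by rw [← comp_app_apply, hl, ofSec_one]⟩

lemma QCOn.of_kernel {W : X.Opens} {K L M : X.Modules} {f : K ⟶ L} {g : L ⟶ M} {w : f ≫ g = 0}
    [Mono f] (h : (ShortComplex.mk f g w).Exact) (hL : QCOn W L)
    (hM : ∀ {V D : X.Opens} (_ : IsAffineOpen V) (_ : V ≤ W) (h : D ≤ V) (f : Γ(X, V))
      (_ : D = X.basicOpen f) (s : Γ(M, V)) (_ : res M h s = 0), ∃ n : ℕ, f ^ n • s = 0) :
    QCOn W K := by
  refine ⟨fun {V D} hV hVW h' a hD s hs ↦ ?_, fun {V D} hV hVW h' a hD t ↦ ?_⟩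
  · obtain ⟨n, hn⟩ := hL.inj hV hVW h' a hD (f.app V s) (by rw [← app_res, hs, map_zero])
    refine ⟨n, app_injective_of_mono f V ?_⟩
    rw [Scheme.Modules.Hom.app_smul, hn, map_zero]
  · obtain ⟨n, s, hs⟩ := hL.surj hV hVW h' a hD (f.app D t)
    obtain ⟨m, hm⟩ := hM hV hVW h' a hD (g.app V s) (by
      have hz : g.app D (f.app D t) = 0 := by rw [← comp_app_apply, w]; rfl
      rw [← app_res, hs, Scheme.Modules.Hom.app_smul, hz, smul_zero])
    rw [← Scheme.Modules.Hom.app_smul] at hm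
    obtain ⟨k, hk⟩ := exists_of_exact h _ hm
    refine ⟨m + n, k, app_injective_of_mono f D ?_⟩
    rw [app_res, hk, res_rr_smul, hs, Scheme.Modules.Hom.app_smul, map_pow, pow_add, mul_smul]

lemma QCOn.of_cokernel {W : X.Opens} {K L M : X.Modules} {f : K ⟶ L} {g : L ⟶ M} {w : f ≫ g = 0}
    (h : (ShortComplex.mk f g w).ShortExact) (hK : QCOn W K) (hL : QCOn W L) :
    QCOn W M := by
  have : Mono f := h.mono_f
  refine ⟨fun {V D} hV hVW h' a hD s hs ↦ ?_, fun {V D} hV hVW h' a hD t ↦ ?_⟩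
  · obtain ⟨l, rfl⟩ := hK.surjective h hV hVW s
    obtain ⟨k, hk⟩ := exists_of_exact h.exact (res L h' l) (by rw [app_res, hs])
    obtain ⟨n, k', hk'⟩ := hK.surj hV hVW h' a hD k
    obtain ⟨m, hm⟩ := hL.inj hV hVW h' a hD (a ^ n • l - f.app V k') (by
      rw [map_sub, ← app_res, hk', Scheme.Modules.Hom.app_smul, hk, res_rr_smul, map_pow, sub_self])
    refine ⟨m + n, ?_⟩
    have hz : g.app V (f.app V k') = 0 := by rw [← comp_app_apply, w]; rfl
    have := congr(g.app V $hm)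
    rwa [map_zero, Scheme.Modules.Hom.app_smul, map_sub, hz, sub_zero, Scheme.Modules.Hom.app_smul,
      smul_smul, ← pow_add] at this
  · obtain ⟨l, rfl⟩ := hK.surjective h (by rw [hD]; exact hV.basicOpen a) (h'.trans hVW) t
    obtain ⟨n, s, hs⟩ := hL.surj hV hVW h' a hD l
    exact ⟨n, g.app V s, by rw [← app_res, hs, Scheme.Modules.Hom.app_smul]⟩

lemma QCOn.of_ext {W : X.Opens} {K L M : X.Modules} {f : K ⟶ L} {g : L ⟶ M} {w : f ≫ g = 0}
    (h : (ShortComplex.mk f g w).ShortExact) (hK : QCOn W K) (hM : QCOn W M) :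
    QCOn W L := by
  have : Mono f := h.mono_f
  refine ⟨fun {V D} hV hVW h' a hD s hs ↦ ?_, fun {V D} hV hVW h' a hD t ↦ ?_⟩
  · obtain ⟨n, hn⟩ := hM.inj hV hVW h' a hD (g.app V s) (by rw [← app_res, hs, map_zero])
    rw [← Scheme.Modules.Hom.app_smul] at hn
    obtain ⟨k, hk⟩ := exists_of_exact h.exact _ hn
    obtain ⟨m, hm⟩ := hK.inj hV hVW h' a hD k (app_injective_of_mono f D (by
      rw [app_res, hk, res_rr_smul, hs, smul_zero, map_zero]))
    refine ⟨m + n, ?_⟩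
    rw [pow_add, mul_smul, ← hk, ← Scheme.Modules.Hom.app_smul, hm, map_zero]
  · obtain ⟨n, s, hs⟩ := hM.surj hV hVW h' a hD (g.app D t)
    obtain ⟨l, rfl⟩ := hK.surjective h hV hVW s
    obtain ⟨k, hk⟩ := exists_of_exact h.exact (res L h' l - rr h' a ^ n • t) (by
      rw [map_sub, app_res, hs, Scheme.Modules.Hom.app_smul, sub_self])
    obtain ⟨p, k', hk'⟩ := hK.surj hV hVW h' a hD k
    refine ⟨p + n, a ^ p • l - f.app V k', ?_⟩
    rw [map_sub, ← app_res, hk', Scheme.Modules.Hom.app_smul, hk, res_rr_smul, map_pow, smul_sub,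
      sub_sub_cancel, pow_add, mul_smul]

lemma weakSerre_QCOn (W : X.Opens) : WeakSerre (QCOn (X := X) W) := by
  have hker {K L M : X.Modules} (f : K ⟶ L) (g : L ⟶ M) (w : f ≫ g = 0) [Mono f]
      (h : (ShortComplex.mk f g w).Exact) (hL : QCOn W L) (hM : QCOn W M) : QCOn W K :=
    QCOn.of_kernel h hL fun hV hVW ↦ hM.inj hV hVW
  refine ⟨hker, fun {K L M} f g w _ h hK hL ↦ ?_, fun f g w h hK hM ↦ QCOn.of_ext h hK hM⟩
  have hk : QCOn W (Limits.kernel f) :=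
    hker _ _ (kernel.condition f) (ShortComplex.exact_kernel f) hK hL
  have hi : QCOn W (Abelian.coimage f) := QCOn.of_cokernel (f := kernel.ι f)
    (g := Abelian.coimage.π f) (w := cokernel.condition _)
    { exact := ShortComplex.exact_cokernel _, epi_g := by dsimp; infer_instance } hk hK
  have w' : Abelian.factorThruCoimage f ≫ g = 0 := by
    rw [← cancel_epi (Abelian.coimage.π f)]
    simp [w]
  refine QCOn.of_cokernel (f := Abelian.factorThruCoimage f) (g := g) (w := w')
    { exact := ?_, mono_f := by dsimp; infer_instance, epi_g := by dsimp; infer_instance } hi hL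
  refine (ShortComplex.exact_iff_of_epi_of_isIso_of_mono
    (S₁ := ShortComplex.mk f g w) (S₂ := ShortComplex.mk (Abelian.factorThruCoimage f) g w')
    { τ₁ := Abelian.coimage.π f, τ₂ := 𝟙 _, τ₃ := 𝟙 _ }).1 h

lemma weakSerre_IsSupp (W : X.Opens) : WeakSerre (IsSupp (X := X) W) where
  ker f g w _ h hL hM := hL.of_mono f
  coker f g w _ h hK hL := hL.of_epi g
  ext {K L M} f g w h hK hM := fun V s x hx ↦ by
    have : Mono f := h.mono_f
    obtain ⟨V', hV', hx', h'⟩ := hM V (g.app V s) x hx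
    obtain h' | h' := h'
    · exact ⟨V', hV', hx', Or.inl h'⟩
    obtain ⟨t, ht⟩ := exists_of_exact h.exact (res L hV' s) (by rw [app_res]; exact h')
    obtain ⟨V'', hV'', hx'', h''⟩ := hK V' t x hx'
    refine ⟨V'', hV''.trans hV', hx'', ?_⟩
    obtain h'' | h'' := h''
    · exact Or.inl h''
    · refine Or.inr ?_
      have h₃ : res K hV'' t = 0 := h''
      change res L _ s = 0
      rw [← res_res L hV'' hV', ← ht, ← app_res, h₃, map_zero]

end LN

namespace LN

variable {X : Scheme.{u}}

lemma MVSquare.exists_desc {A : Type*} [Category* A] [Abelian A] {T₀₁ T₀ T₁ T Z : A}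
    (S : MVSquare T₀₁ T₀ T₁ T) (k₀ : T₀ ⟶ Z) (k₁ : T₁ ⟶ Z) (h : S.i₀ ≫ k₀ = S.i₁ ≫ k₁) :
    ∃ d, S.j₀ ≫ d = k₀ ∧ S.j₁ ≫ d = k₁ := by
  have hS := S.shortExact
  have := hS.epi_g
  obtain ⟨d, hd⟩ : ∃ d, biprod.desc S.j₀ S.j₁ ≫ d = biprod.desc k₀ k₁ :=
    hS.exact.desc' (biprod.desc k₀ k₁) (by
      change biprod.lift S.i₀ (-S.i₁) ≫ _ = 0
      rw [biprod.lift_desc, Preadditive.neg_comp, h, add_neg_cancel])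
  refine ⟨d, ?_, ?_⟩
  · simpa using congr(biprod.inl ≫ $hd)
  · simpa using congr(biprod.inr ≫ $hd)

/-- Sections over two opens which agree on the intersection glue. -/
lemma exists_glue (N : X.Modules) {F G : X.Opens} (s : Γ(N, F)) (t : Γ(N, G))
    (h : res N (inf_le_left : F ⊓ G ≤ F) s = res N inf_le_right t) :
    ∃ r : Γ(N, F ⊔ G), res N le_sup_left r = s ∧ res N le_sup_right r = t := by
  have e : OOLE (inf_le_left : F ⊓ G ≤ F) ≫ ofSec s = OOLE inf_le_right ≫ ofSec t := by
    apply OO_hom_ext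
    rw [OOLE_comp_app, OOLE_comp_app, ofSec_one, ofSec_one, h]
  obtain ⟨d, hd₁, hd₂⟩ : ∃ d : OO X (F ⊔ G) ⟶ N, OOLE le_sup_left ≫ d = ofSec s ∧
    OOLE le_sup_right ≫ d = ofSec t := (mvSquare F G (unitMod X)).exists_desc _ _ e
  refine ⟨d.app _ (one _), ?_, ?_⟩
  · rw [← OOLE_comp_app, hd₁, ofSec_one]
  · rw [← OOLE_comp_app, hd₂, ofSec_one]

lemma eq_of_res_sup (N : X.Modules) {F G V : X.Opens} (hV : F ⊔ G = V) (hF : F ≤ V) (hG : G ≤ V)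
    {s t : Γ(N, V)} (h₁ : res N hF s = res N hF t) (h₂ : res N hG s = res N hG t) : s = t := by
  refine eq_of_locally _ _ _ fun x hx ↦ ?_
  obtain hx | hx := hV.ge hx
  exacts [⟨F, hF, hx, h₁⟩, ⟨G, hG, hx, h₂⟩]

set_option maxHeartbeats 800000 in
lemma QCOn.glue {N : X.Modules} {V : X.Opens} (hV : IsAffineOpen V) (f g : Γ(X, V))
    (hfg : IsUnit (f + g)) (hf : QCOn (X.basicOpen f) N) (hg : QCOn (X.basicOpen g) N) :
    QCOn V N := by
  have key {V'} (h : V' ≤ V) : X.basicOpen (rr h f) ⊔ X.basicOpen (rr h g) = V' :=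
    sup_basicOpen _ _ (by rw [← map_add]; exact hfg.map _)
  have hF' {V'} (h : V' ≤ V) : X.basicOpen (rr h f) ≤ X.basicOpen f := by
    rw [basicOpen_rr]; exact inf_le_right
  have hG' {V'} (h : V' ≤ V) : X.basicOpen (rr h g) ≤ X.basicOpen g := by
    rw [basicOpen_rr]; exact inf_le_right
  refine ⟨fun {V' D} hV' hVW h a hD s hs ↦ ?_, fun {V' D} hV' hVW h a hD t ↦ ?_⟩
  · have hF := X.basicOpen_le (rr hVW f)
    have hG := X.basicOpen_le (rr hVW g)
    obtain ⟨n, hn⟩ := hf.inj (hV'.basicOpen _) (hF' hVW)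
      (X.basicOpen_le (rr hF a)) (rr hF a) rfl (res N hF s) (by
        rw [res_res, ← res_res N (show _ ≤ D from ?_) h, hs, map_zero]
        rw [hD, basicOpen_rr]
        exact inf_le_right)
    obtain ⟨m, hm⟩ := hg.inj (hV'.basicOpen _) (hG' hVW)
      (X.basicOpen_le (rr hG a)) (rr hG a) rfl (res N hG s) (by
        rw [res_res, ← res_res N (show _ ≤ D from ?_) h, hs, map_zero]
        rw [hD, basicOpen_rr]
        exact inf_le_right)
    refine ⟨n + m, eq_of_res_sup N (key hVW) hF hG ?_ ?_⟩
    · rw [res_rr_smul, map_pow, add_comm, pow_add, mul_smul, hn, smul_zero, map_zero]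
    · rw [res_rr_smul, map_pow, pow_add, mul_smul, hm, smul_zero, map_zero]
  · have hF := X.basicOpen_le (rr hVW f)
    have hG := X.basicOpen_le (rr hVW g)
    have eF : X.basicOpen (rr hF a) ≤ D := by rw [hD, basicOpen_rr]; exact inf_le_right
    have eG : X.basicOpen (rr hG a) ≤ D := by rw [hD, basicOpen_rr]; exact inf_le_right
    obtain ⟨n₁, s₁, h₁⟩ := hf.surj (hV'.basicOpen _) (hF' hVW) (X.basicOpen_le (rr hF a)) (rr hF a)
      rfl (res N eF t)
    obtain ⟨n₂, s₂, h₂⟩ := hg.surj (hV'.basicOpen _) (hG' hVW) (X.basicOpen_le (rr hG a)) (rr hG a)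
      rfl (res N eG t)
    let F := X.basicOpen (rr hVW f)
    let G := X.basicOpen (rr hVW g)
    have hFG : IsAffineOpen (F ⊓ G) := by
      rw [← X.basicOpen_mul]
      exact hV'.basicOpen _
    have hle : F ⊓ G ≤ V' := inf_le_left.trans hF
    have e₁ : X.basicOpen (rr hle a) ≤ X.basicOpen (rr hF a) := by
      rw [basicOpen_rr, basicOpen_rr]
      exact inf_le_inf_right _ inf_le_left
    have e₂ : X.basicOpen (rr hle a) ≤ X.basicOpen (rr hG a) := by
      rw [basicOpen_rr, basicOpen_rr]
      exact inf_le_inf_right _ inf_le_right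
    obtain ⟨m, hm⟩ := hf.inj hFG (inf_le_left.trans (hF' hVW)) (X.basicOpen_le (rr hle a))
      (rr hle a) rfl (res N inf_le_left (rr hF a ^ n₂ • s₁) - res N inf_le_right (rr hG a ^ n₁ • s₂))
      (by
        have h₁' := congr(res N e₁ $h₁)
        have h₂' := congr(res N e₂ $h₂)
        simp only [res_res, res_rr_smul, rr_rr, map_pow] at h₁' h₂'
        rw [map_sub, res_res, res_res, res_rr_smul, res_rr_smul, map_pow, map_pow, rr_rr, rr_rr,
          h₁', h₂', smul_smul, smul_smul, mul_comm, sub_self])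
    obtain ⟨r, hr₁, hr₂⟩ := exists_glue N (F := F) (G := G) (rr hF a ^ (m + n₂) • s₁)
      (rr hG a ^ (m + n₁) • s₂) (by
        rw [← sub_eq_zero, ← hm, smul_sub]
        simp only [res_rr_smul, rr_rr, map_pow, smul_smul, ← pow_add])
    refine ⟨m + n₂ + n₁, res N (key hVW).ge r, ?_⟩
    refine eq_of_res_sup N (?_ : X.basicOpen (rr hF a) ⊔ X.basicOpen (rr hG a) = D) eF eG ?_ ?_
    · rw [basicOpen_rr hF a, basicOpen_rr hG a, ← inf_sup_right, key hVW, hD]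
      exact inf_of_le_right (X.basicOpen_le a)
    · have q : res N eF (res N h (res N (key hVW).ge r)) =
          res N (X.basicOpen_le (rr hF a)) (res N le_sup_left r) := by simp only [res_res]
      rw [q, hr₁, res_rr_smul, map_pow, h₁]
      simp only [rr_rr, res_rr_smul, map_pow, smul_smul, ← pow_add]
    · have q : res N eG (res N h (res N (key hVW).ge r)) =
          res N (X.basicOpen_le (rr hG a)) (res N le_sup_right r) := by simp only [res_res]
      rw [q, hr₂, res_rr_smul, map_pow, h₂]
      simp only [rr_rr, res_rr_smul, map_pow, smul_smul, ← pow_add, add_right_comm]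

/-- The property `QCOn` is local. -/
lemma QCOn.of_locally {N : X.Modules} {W : X.Opens} (h : ∀ x ∈ W, ∃ V, x ∈ V ∧ QCOn V N) :
    QCOn W N := by
  have key {V : X.Opens} (hV : IsAffineOpen V) (hVW : V ≤ W) : QCOn V N := by
    refine affine_local (Z := fun V ↦ QCOn V N) hV ?_ ?_ ?_ ?_
    · refine ⟨fun {V D} hV hVW h a hD s hs ↦ ⟨0, ?_⟩, fun {V D} hV hVW h a hD t ↦ ⟨0, 0, ?_⟩⟩
      · exact eq_of_locally _ _ _ fun x hx ↦ (hVW hx).elim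
      · exact eq_of_locally _ _ _ fun x hx ↦ (hVW (h hx)).elim
    · exact fun V' V'' _ _ hVV hV' ↦ hV'.le hVV
    · intro x hx
      obtain ⟨V', hxV', hV'⟩ := h x (hVW hx)
      exact ⟨V ⊓ V', inf_le_left, ⟨hx, hxV'⟩, hV'.le inf_le_right⟩
    · exact fun V' _ hV' f g hfg hf hg ↦ QCOn.glue hV' f g hfg hf hg
  exact ⟨fun hV hVW ↦ (key hV hVW).inj hV le_rfl, fun hV hVW ↦ (key hV hVW).surj hV le_rfl⟩

section
variable {V : X.Opens} (hV : IsAffineOpen V)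

lemma fromSpec_image_le (U : (Spec Γ(X, V)).Opens) : hV.fromSpec ''ᵁ U ≤ V := by
  refine (hV.fromSpec.image_le_opensRange U).trans ?_
  rw [hV.opensRange_fromSpec]

lemma appIso_inv_ΓSpecIso_inv (U : (Spec Γ(X, V)).Opens) (a : Γ(X, V)) :
    (hV.fromSpec.appIso U).inv ((Spec Γ(X, V)).presheaf.map U.leTop.op
      ((Scheme.ΓSpecIso Γ(X, V)).inv a)) = rr (fromSpec_image_le hV U) a := by
  have h1 : hV.fromSpec.appLE V U (by rw [hV.fromSpec_preimage_self]; exact le_top) a =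
      (Spec Γ(X, V)).presheaf.map U.leTop.op ((Scheme.ΓSpecIso Γ(X, V)).inv a) := by
    rw [Scheme.Hom.appLE, hV.fromSpec_app_self]
    simp [← Functor.map_comp]
    rfl
  rw [← h1]
  exact congr($(Scheme.Hom.appLE_appIso_inv hV.fromSpec (U := V) (V := U) _) a)
end

end LN

namespace LN

variable {X : Scheme.{u}}

section
variable {V : X.Opens} (hV : IsAffineOpen V) (N : X.Modules)

lemma fromSpec_image_top' : hV.fromSpec ''ᵁ ⊤ = V := by
  rw [Scheme.Hom.image_top_eq_opensRange, hV.opensRange_fromSpec]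

lemma smul_restrict_fromSpec (U : (Spec Γ(X, V)).Opens) (a : Γ(X, V))
    (s : Γ(N.restrict hV.fromSpec, U)) :
    (a • s : Γ(N.restrict hV.fromSpec, U)) =
      (show Γ(N.restrict hV.fromSpec, U) from
        (rr (fromSpec_image_le hV U) a • (show Γ(N, hV.fromSpec ''ᵁ U) from s))) := by
  rw [← appIso_inv_ΓSpecIso_inv hV U a]
  rfl

lemma isLocalizing_restrict_fromSpec [N.IsQuasicoherent] :
    IsLocalizing (modulesSpecToSheaf.obj (N.restrict hV.fromSpec)) :=
  (isIso_fromTildeΓ_iff_isLocalizing _).1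
    (Scheme.Modules.isIso_fromTildeΓ_of_isQuasicoherent (N.restrict hV.fromSpec))

lemma qc_inj [N.IsQuasicoherent] (f : Γ(X, V)) (D : (Spec Γ(X, V)).Opens)
    (hD : D = PrimeSpectrum.basicOpen f) (s : Γ(N, hV.fromSpec ''ᵁ ⊤))
    (hs : res N (hV.fromSpec.image_mono (le_top : D ≤ ⊤)) s = 0) :
    ∃ n : ℕ, rr (fromSpec_image_le hV ⊤) (f ^ n) • s = 0 := by
  subst hD
  let φ := ((modulesSpecToSheaf.obj (N.restrict hV.fromSpec)).obj.map
    (PrimeSpectrum.basicOpen f).leTop.op).hom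
  have h : IsLocalizedModule (.powers f) φ := isLocalizing_restrict_fromSpec hV N f
  obtain ⟨⟨_, n, rfl⟩, hn⟩ := (IsLocalizedModule.eq_zero_iff (.powers f) φ).1 hs
  exact ⟨n, (smul_restrict_fromSpec hV N ⊤ (f ^ n) s).symm.trans hn⟩

lemma qc_surj [N.IsQuasicoherent] (f : Γ(X, V)) (D : (Spec Γ(X, V)).Opens)
    (hD : D = PrimeSpectrum.basicOpen f) (t : Γ(N, hV.fromSpec ''ᵁ D)) :
    ∃ (n : ℕ) (s : Γ(N, hV.fromSpec ''ᵁ ⊤)),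
      res N (hV.fromSpec.image_mono (le_top : D ≤ ⊤)) s =
        rr (fromSpec_image_le hV D) (f ^ n) • t := by
  subst hD
  let φ := ((modulesSpecToSheaf.obj (N.restrict hV.fromSpec)).obj.map
    (PrimeSpectrum.basicOpen f).leTop.op).hom
  have h : IsLocalizedModule (.powers f) φ := isLocalizing_restrict_fromSpec hV N f
  obtain ⟨⟨s, ⟨_, n, rfl⟩⟩, hn⟩ := h.surj t
  exact ⟨n, s, hn.symm.trans (smul_restrict_fromSpec hV N _ (f ^ n) t)⟩

end

lemma QCOn.of_isQuasicoherent (N : X.Modules) [N.IsQuasicoherent] (W : X.Opens) : QCOn W N := by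
  refine ⟨fun {V D} hV hVW h f hD s hs ↦ ?_, fun {V D} hV hVW h f hD t ↦ ?_⟩
  · have : hV.fromSpec ''ᵁ (PrimeSpectrum.basicOpen f) ≤ D := by
      rw [hD]; exact (hV.fromSpec_image_basicOpen f).le
    obtain ⟨D', hD'⟩ : ∃ D' : (Spec Γ(X, V)).Opens, D' = PrimeSpectrum.basicOpen f := ⟨_, rfl⟩
    rw [← hD'] at this
    obtain ⟨n, hn⟩ := qc_inj hV N f D' hD' (res N (fromSpec_image_le hV ⊤) s) (by
      rw [res_res, ← res_res N this h, hs, map_zero])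
    refine ⟨n, ?_⟩
    rw [← res_rr_smul] at hn
    have := congr(res N (fromSpec_image_top' hV).ge $hn)
    rwa [res_res, res_self, map_zero] at this
  · have e : hV.fromSpec ''ᵁ (PrimeSpectrum.basicOpen f) = D := by
      rw [hD]; exact hV.fromSpec_image_basicOpen f
    obtain ⟨D', hD'⟩ : ∃ D' : (Spec Γ(X, V)).Opens, D' = PrimeSpectrum.basicOpen f := ⟨_, rfl⟩
    rw [← hD'] at e
    obtain ⟨n, s, hs⟩ := qc_surj hV N f D' hD' (res N e.le t)
    refine ⟨n, res N (fromSpec_image_top' hV).ge s, ?_⟩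
    have := congr(res N e.ge $hs)
    rw [res_res, res_rr_smul, rr_rr, res_res, res_self] at this
    rw [res_res, this, map_pow]

end LN

namespace LN

variable {X : Scheme.{u}}

section
variable {κ : Type u} {W : X.Opens} (c : Cofan (fun _ : κ ↦ LN.OO X W))

/-- The canonical sections of a coproduct of copies of `OO W`. -/
def cofanOne (k : κ) : Γ(c.pt, W) := (c.inj k).app W (one W)

variable {c} (hc : IsColimit c)

open scoped Classical in
/-- The coordinates on a coproduct of copies of `OO W`. -/
def cofanCoord (k : κ) : c.pt ⟶ unitMod X :=
  Cofan.IsColimit.desc hc (fun j ↦ if j = k then OOε W else 0)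

open scoped Classical in
lemma cofanCoord_one (k j : κ) :
    (cofanCoord hc k).app W (cofanOne c j) = if j = k then unitOne W else 0 := by
  rw [cofanOne, ← comp_app_apply, cofanCoord, Cofan.IsColimit.fac]
  split_ifs
  · exact OOε_one W
  · rfl

include hc in
lemma cofan_locally_span {V : X.Opens} (hV : V ≤ W) (s : Γ(c.pt, V)) (x : X) (hx : x ∈ V) :
    ∃ (V' : X.Opens) (hV' : V' ≤ V), x ∈ V' ∧ res c.pt hV' s ∈
      Submodule.span Γ(X, V') (Set.range fun k ↦ res c.pt (hV'.trans hV) (cofanOne c k)) := by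
  classical
  let P (V : X.Opens) : Submodule Γ(X, V) Γ(c.pt, V) :=
    if h : V ≤ W then Submodule.span Γ(X, V) (Set.range fun k ↦ res c.pt h (cofanOne c k)) else ⊥
  obtain ⟨C, q, hq⟩ := exists_hom_detecting c.pt P (by
    intro V V' h s hs
    dsimp only [P] at hs ⊢
    split_ifs at hs with h'
    · rw [dif_pos (h.trans h')]
      induction hs using Submodule.span_induction with
      | mem s hs =>
        obtain ⟨k, rfl⟩ := hs
        refine Submodule.subset_span ⟨k, ?_⟩
        dsimp only
        rw [res_res]
      | zero => rw [map_zero]; exact zero_mem _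
      | add s t _ _ hs ht => rw [map_add]; exact add_mem hs ht
      | smul a s _ hs => rw [res_rr_smul]; exact Submodule.smul_mem _ _ hs
    · rw [(Submodule.mem_bot _).1 hs, map_zero]
      exact zero_mem _)
  have hq0 : q = 0 := by
    refine Cofan.IsColimit.hom_ext hc _ _ fun k ↦ OO_hom_ext ?_
    rw [comp_zero, comp_app_apply]
    refine (hq W (cofanOne c k)).2 fun x hx ↦ ⟨W, le_rfl, hx, ?_⟩
    dsimp only [P]
    rw [dif_pos le_rfl]
    exact Submodule.subset_span ⟨k, rfl⟩
  obtain ⟨V', hV', hx', h⟩ := (hq V s).1 (by rw [hq0]; rfl) x hx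
  refine ⟨V', hV', hx', ?_⟩
  dsimp only [P] at h
  rwa [dif_pos (hV'.trans hV)] at h

/-- Sections over a quasi-compact open contained in `W` have finitely many coordinates and
are determined by them. -/
lemma cofan_exists_finset {V : X.Opens} (hV : V ≤ W) (hVc : IsCompact (V : Set X))
    (s : Γ(c.pt, V)) : ∃ T : Finset κ, (∀ k ∉ T, (cofanCoord hc k).app V s = 0) ∧
      s = ∑ k ∈ T, (show Γ(X, V) from (cofanCoord hc k).app V s) •
        res c.pt hV (cofanOne c k) := by
  classical
  have key {V' : X.Opens} (hV' : V' ≤ W) (t : Γ(c.pt, V')) (ht : t ∈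
      Submodule.span Γ(X, V') (Set.range fun k ↦ res c.pt hV' (cofanOne c k))) :
      ∃ T : Finset κ, (∀ k ∉ T, (cofanCoord hc k).app V' t = 0) ∧ ∀ T', T ⊆ T' →
        t = ∑ k ∈ T', (show Γ(X, V') from (cofanCoord hc k).app V' t) •
          res c.pt hV' (cofanOne c k) := by
    obtain ⟨a, rfl⟩ := (Finsupp.mem_span_range_iff_exists_finsupp (R := Γ(X, V'))).1 ht
    have e (k : κ) : (show Γ(X, V') from (cofanCoord hc k).app V'
        (a.sum fun i b ↦ b • res c.pt hV' (cofanOne c i))) = a k := by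
      rw [Finsupp.sum, map_sum]
      simp only [Scheme.Modules.Hom.app_smul, app_res, cofanCoord_one]
      refine (Finset.sum_congr rfl (fun i _ ↦ ?_ : ∀ i ∈ a.support, _ = if i = k then a i else 0)).trans ?_
      · split_ifs
        · rw [res_unitOne]; exact mul_one (a i)
        · rw [map_zero, smul_zero]; rfl
      · rw [Finset.sum_ite_eq']
        split_ifs with h
        · rfl
        · exact (Finsupp.notMem_support_iff.1 h).symm
    refine ⟨a.support, fun k hk ↦ (e k).trans (Finsupp.notMem_support_iff.1 hk), fun T' hT' ↦ ?_⟩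
    simp only [e]
    exact Finsupp.sum_of_support_subset _ hT' _ (fun i _ ↦ zero_smul _ _)
  have loc (x : V) : ∃ (V' : X.Opens) (hV' : V' ≤ V), x.1 ∈ V' ∧ ∃ T : Finset κ,
      (∀ k ∉ T, res (unitMod X) hV' ((cofanCoord hc k).app V s) = 0) ∧ ∀ T', T ⊆ T' →
        res c.pt hV' s = res c.pt hV' (∑ k ∈ T', (show Γ(X, V) from (cofanCoord hc k).app V s) •
          res c.pt hV (cofanOne c k)) := by
    obtain ⟨V', hV', hx, h⟩ := cofan_locally_span hc hV s x.1 x.2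
    obtain ⟨T, h₁, h₂⟩ := key (hV'.trans hV) _ h
    refine ⟨V', hV', hx, T, fun k hk ↦ ?_, fun T' hT' ↦ ?_⟩
    · rw [← app_res]; exact h₁ k hk
    · rw [map_sum]
      refine (h₂ T' hT').trans (Finset.sum_congr rfl fun k _ ↦ ?_)
      rw [res_rr_smul, res_res, app_res]
      rfl
  choose V' hV' hx T h₁ h₂ using loc
  obtain ⟨I, hI⟩ := hVc.elim_finite_subcover (fun x ↦ (V' x : Set X)) (fun x ↦ (V' x).2)
    (fun x hx' ↦ Set.mem_iUnion.2 ⟨⟨x, hx'⟩, hx _⟩)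
  have cov (x : X) (hx' : x ∈ V) : ∃ i ∈ I, x ∈ V' i := by
    simpa using hI hx'
  refine ⟨I.biUnion T, fun k hk ↦ eq_zero_of_locally _ _ fun x hx' ↦ ?_,
    eq_of_locally _ _ _ fun x hx' ↦ ?_⟩
  · obtain ⟨i, hi, hxi⟩ := cov x hx'
    exact ⟨V' i, hV' i, hxi, h₁ i k fun h ↦ hk (Finset.mem_biUnion.2 ⟨i, hi, h⟩)⟩
  · obtain ⟨i, hi, hxi⟩ := cov x hx'
    exact ⟨V' i, hV' i, hxi, h₂ i _ (Finset.subset_biUnion_of_mem T hi)⟩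

include hc in
lemma QCOn.cofan : QCOn W c.pt := by
  classical
  refine ⟨fun {V D} hV hVW h f hD s hs ↦ ?_, fun {V D} hV hVW h f hD t ↦ ?_⟩
  · obtain ⟨T, h₁, h₂⟩ := cofan_exists_finset hc hVW hV.isCompact s
    have (k : κ) : ∃ n : ℕ, f ^ n • (cofanCoord hc k).app V s = 0 :=
      (QCOn.unit (W := W)).inj hV hVW h f hD _ (by rw [← app_res, hs, map_zero])
    choose n hn using this
    refine ⟨∑ k ∈ T, n k, ?_⟩
    rw [h₂, Finset.smul_sum]
    refine Finset.sum_eq_zero fun k hk ↦ ?_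
    rw [smul_smul, ← Finset.sum_erase_add _ _ hk, pow_add, mul_assoc]
    have := hn k
    change f ^ n k * (show Γ(X, V) from (cofanCoord hc k).app V s) = 0 at this
    rw [this, mul_zero, zero_smul]
  · have hDc : IsCompact (D : Set X) := by rw [hD]; exact (hV.basicOpen f).isCompact
    obtain ⟨T, h₁, h₂⟩ := cofan_exists_finset hc (h.trans hVW) hDc t
    have (k : κ) := (QCOn.unit (W := W)).surj hV hVW h f hD ((cofanCoord hc k).app D t)
    choose n a ha using this
    refine ⟨∑ k ∈ T, n k, ∑ k ∈ T, (f ^ (∑ i ∈ T, n i - n k) * (show Γ(X, V) from a k)) •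
      res c.pt hVW (cofanOne c k), ?_⟩
    rw [map_sum]
    conv_rhs => rw [h₂, Finset.smul_sum]
    refine Finset.sum_congr rfl fun k hk ↦ ?_
    rw [res_rr_smul, map_mul, res_res, smul_smul, map_pow]
    congr 1
    have e : rr h (show Γ(X, V) from a k) = rr h f ^ n k * (show Γ(X, D) from
      (cofanCoord hc k).app D t) := ha k
    rw [e, ← mul_assoc, ← pow_add, Nat.sub_add_cancel]
    exact Finset.single_le_sum (f := n) (fun _ _ ↦ Nat.zero_le _) hk

include hc in
lemma IsSupp.cofan : IsSupp W c.pt := by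
  choose l hl using fun k ↦ (isSupp_OO W).exists_lift (c.inj k)
  have : Cofan.IsColimit.desc hc l ≫ (cutε X W).app c.pt = 𝟙 _ :=
    Cofan.IsColimit.hom_ext hc _ _ fun k ↦ by
      rw [Cofan.IsColimit.fac_assoc, hl, Category.comp_id]
  have : Mono (Cofan.IsColimit.desc hc l) := mono_of_mono_fac this
  exact (isSupp_cut W c.pt).of_mono (Cofan.IsColimit.desc hc l)

end

end LN

namespace LN

variable {X : Scheme.{u}}

section
variable {C : Type*} [Category* C] {D : Type*} [Category* D] (F : C ⥤ D) {κ : Type*} {Y : C}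

/-- The image of a cofan under a functor, with the summands changed by an isomorphism. -/
def mapCofan (c : Cofan (fun _ : κ ↦ Y)) {Z : D} (e : F.obj Y ≅ Z) : Cofan (fun _ : κ ↦ Z) :=
  Cofan.mk (F.obj c.pt) (fun i ↦ e.inv ≫ F.map (c.inj i))

/-- The image of a colimit cofan is a colimit cofan. -/
def isColimitMapCofan {c : Cofan (fun _ : κ ↦ Y)} (hc : IsColimit c) {Z : D} (e : F.obj Y ≅ Z)
    [PreservesColimitsOfShape (Discrete κ) F] : IsColimit (mapCofan F c e) := by
  have h := Cofan.isColimitMapCoconeEquiv F _ c (isColimitOfPreserves F hc)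
  refine Cofan.IsColimit.mk _ (fun t ↦ Cofan.IsColimit.desc h (fun i ↦ e.hom ≫ t.inj i))
    (fun t j ↦ ?_) (fun t m hm ↦ ?_)
  · change (e.inv ≫ F.map (c.inj j)) ≫ _ = _
    have := Cofan.IsColimit.fac h (fun i ↦ e.hom ≫ t.inj i) j
    change F.map (c.inj j) ≫ _ = _ at this
    rw [Category.assoc, this, e.inv_hom_id_assoc]
  · refine Cofan.IsColimit.hom_ext h _ _ fun i ↦ ?_
    have e1 := Cofan.IsColimit.fac h (fun i ↦ e.hom ≫ t.inj i) i
    have key : ∀ m' : F.obj c.pt ⟶ t.pt, (e.inv ≫ F.map (c.inj i)) ≫ m' = t.inj i →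
        F.map (c.inj i) ≫ m' = e.hom ≫ t.inj i := by
      intro m' h'
      rw [← h']
      simp
    exact (key m (hm i)).trans e1.symm

end

lemma isIso_cut_map_cutε {V W : X.Opens} (h : V ≤ W) (A : X.Modules) :
    IsIso ((cut X V).map ((cutε X W).app A)) := by
  have hm : Mono ((cut X V).map ((cutε X W).app A)) := inferInstance
  obtain ⟨l, hl⟩ := (isSupp_cut V A).exists_lift ((cutLE X h).app A)
  have e : l ≫ (cut X V).map ((cutε X W).app A) = 𝟙 _ := by
    apply cut_hom_ext
    have := (cutε X V).naturality ((cutε X W).app A)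
    change _ = _ ≫ (cutε X W).app A at this
    rw [Category.assoc, this, ← Category.assoc, hl, cutLE_ε_app, Category.id_comp]
    rfl
  have : IsSplitEpi ((cut X V).map ((cutε X W).app A)) := ⟨⟨l, e⟩⟩
  exact isIso_of_mono_of_isSplitEpi _

variable (X) in
/-- Extending by zero twice. -/
def cutCut {V W : X.Opens} (h : V ≤ W) : cut X W ⋙ cut X V ≅ cut X V :=
  NatIso.ofComponents (fun A ↦ @asIso _ _ _ _ _ (isIso_cut_map_cutε h A)) fun {A B} f ↦ by
    change (cut X V).map ((cut X W).map f) ≫ (cut X V).map ((cutε X W).app B) =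
      (cut X V).map ((cutε X W).app A) ≫ (cut X V).map f
    rw [← Functor.map_comp, ← Functor.map_comp, (cutε X W).naturality]
    rfl

/-- The restriction to `V` of the structure sheaf of `W`, extended by zero. -/
def cutOO {V W : X.Opens} (h : V ≤ W) : (cut X V).obj (LN.OO X W) ≅ LN.OO X V :=
  (cutCut X h).app (unitMod X)

instance (V : X.Opens) : (cut X V).IsLeftAdjoint :=
  inferInstanceAs (rest X V ⋙ extZero X V).IsLeftAdjoint

/-- Free modules, extended by zero, are coproducts. -/
lemma exists_cofan_free (U : X.Opens) (κ : Type u) :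
    ∃ (c : Cofan (fun _ : κ ↦ LN.OO X U)) (_ : IsColimit c),
      c.pt = (extZero X U).obj (SheafOfModules.free (R := X.ringCatSheaf.over U) κ : ModOver X U) := by
  let e : (extZero X U).obj (SheafOfModules.unit (X.ringCatSheaf.over U) : ModOver X U) ≅
    LN.OO X U := Iso.refl _
  exact ⟨_, isColimitMapCofan (extZero X U)
    (c := SheafOfModules.freeCofan (R := X.ringCatSheaf.over U) κ)
    (SheafOfModules.isColimitFreeCofan κ) e, rfl⟩

section
variable [HasDerivedCategory.{u + 1} X.Modules]

/-- Coproducts of extended structure sheaves have no higher extensions by quasi-coherent modules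
on affine opens. -/
lemma hz_cofan {κ : Type u} {V : X.Opens} (hV : IsAffineOpen V)
    {c : Cofan (fun _ : κ ↦ LN.OO X V)} (hc : IsColimit c) {N : X.Modules} (hN : QCOn V N)
    {m n : ℤ} (h : m < n) : HZ (SF n c.pt) (SF m N) := by
  obtain ⟨k, hk⟩ : ∃ k : ℕ, n - m = ((k + 1 : ℕ) : ℤ) := ⟨(n - m - 1).toNat, by lia⟩
  have := HZ.of_isColimit c hc k N
    (fun i j _ ↦ hN.hz (m := 0) (n := (j : ℤ) + 1) (by lia) hV le_rfl)
  exact this.SF_shift (by push_cast at hk; lia)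

end

end LN

namespace LN

universe w v w'
variable {A : Type v} [Category.{w'} A] [Abelian A] [HasDerivedCategory.{w} A]
open DerivedCategory

/-- The homology of the image of a complex in the derived category. -/
def HHQ (n : ℤ) (K : CochainComplex A ℤ) : HH n (Q.obj K) ≅ K.homology n :=
  (homologyFunctorFactors A n).app K

lemma HHQ_naturality (n : ℤ) {K L : CochainComplex A ℤ} (φ : K ⟶ L) :
    (homologyFunctor A n).map (Q.map φ) ≫ (HHQ n L).hom =
      (HHQ n K).hom ≫ HomologicalComplex.homologyMap φ n :=
  (homologyFunctorFactors A n).hom.naturality φ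

lemma HZ.comp_homologyπ {K : CochainComplex A ℤ} {n : ℤ} {O : A} (h : HZ (SF n O) (Q.obj K))
    (z : O ⟶ K.cycles n) : z ≫ K.homologyπ n = 0 := by
  let φ : (HomologicalComplex.single A (ComplexShape.up ℤ) n).obj O ⟶ K :=
    HomologicalComplex.mkHomFromSingle (z ≫ K.iCycles n) (fun k _ ↦ by simp)
  have h0 : Q.map φ = 0 := h (Q.map φ)
  have h1 : HomologicalComplex.homologyMap φ n = 0 := by
    have e := HHQ_naturality n φ
    rw [h0, Functor.map_zero, zero_comp] at e
    rw [← cancel_epi (HHQ n _).hom, comp_zero]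
    exact e.symm
  have h2 : (HomologicalComplex.singleObjCyclesSelfIso (ComplexShape.up ℤ) n O).inv ≫
      HomologicalComplex.cyclesMap φ n = z := by
    rw [← cancel_mono (K.iCycles n), Category.assoc, HomologicalComplex.cyclesMap_i,
      HomologicalComplex.singleObjCyclesSelfIso_inv_iCycles_assoc,
      HomologicalComplex.mkHomFromSingle_f, Iso.inv_hom_id_assoc]
  rw [← h2, Category.assoc, ← HomologicalComplex.homologyπ_naturality, h1, comp_zero, comp_zero]

end LN

namespace LN

variable {X : Scheme.{u}}

open DerivedCategory

lemma isZero_of_sections {M : X.Modules} (h : ∀ (V : X.Opens) (s : Γ(M, V)), s = 0) : IsZero M := by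
  rw [IsZero.iff_id_eq_zero]
  exact hom_ext_apply fun V s ↦ (h V _).trans (h V _).symm

lemma exists_affine_mem {x : X} {U : X.Opens} (hx : x ∈ U) :
    ∃ V : X.Opens, IsAffineOpen V ∧ x ∈ V ∧ V ≤ U := by
  obtain ⟨_, ⟨V, hV, rfl⟩, hxV, hVU⟩ := X.isBasis_affineOpens.exists_subset_of_mem_open hx U.2
  exact ⟨V, hV, hxV, hVU⟩

/-- Extended structure sheaves of affine opens detect the vanishing of homology. -/
lemma isZero_HH_of_hz [HasDerivedCategory.{u + 1} X.Modules] (L : DerivedCategory X.Modules) (n : ℤ)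
    (h : ∀ V : X.Opens, IsAffineOpen V → HZ (SF n (OO X V)) L) : IsZero (HH n L) := by
  obtain ⟨K, ⟨e⟩⟩ : ∃ K, Nonempty (Q.obj K ≅ L) := ⟨_, ⟨Q.objObjPreimageIso L⟩⟩
  have hK : ∀ V : X.Opens, IsAffineOpen V → HZ (SF n (OO X V)) (Q.obj K) :=
    fun V hV ↦ (h V hV).of_iso_right e.symm
  refine IsZero.of_iso (Y := K.homology n) (isZero_of_sections fun W s ↦ ?_)
    ((homologyFunctor X.Modules n).mapIso e.symm ≪≫ HHQ n K)
  refine eq_zero_of_locally _ _ fun x hx ↦ ?_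
  obtain ⟨W', hW', hxW', t, ht⟩ := exists_local_lift (K.homologyπ n) s hx
  obtain ⟨V, hV, hxV, hVW'⟩ := exists_affine_mem hxW'
  refine ⟨V, hVW'.trans hW', hxV, ?_⟩
  have h1 := (hK V hV).comp_homologyπ (ofSec (res _ hVW' t))
  have h2 := congr($(h1).app V (one V))
  rw [comp_app_apply, ofSec_one, app_res, ht, res_res] at h2
  exact h2

end LN

namespace LN

universe w v w'
variable {A : Type v} [Category.{w'} A] [Abelian A] [HasDerivedCategory.{w} A]
open DerivedCategory

section
variable (F : A ⥤ A) [F.Additive] [PreservesFiniteLimits F] [PreservesFiniteColimits F]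

/-- The derived functor of an exact functor on a complex. -/
def mapDQ (K : CochainComplex A ℤ) :
    F.mapDerivedCategory.obj (Q.obj K) ≅ Q.obj ((F.mapHomologicalComplex _).obj K) :=
  F.mapDerivedCategoryFactors.app K

/-- The derived functor of an exact functor on a single complex. -/
def mapDSF (n : ℤ) (M : A) : F.mapDerivedCategory.obj (SF n M) ≅ SF n (F.obj M) :=
  (F.mapDerivedCategorySingleFunctor n).app M

/-- The derived functor of an exact functor commutes with homology. -/
lemma nonempty_mapDHH (n : ℤ) (L : DerivedCategory A) :
    Nonempty (HH n (F.mapDerivedCategory.obj L) ≅ F.obj (HH n L)) := by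
  obtain ⟨K, ⟨e⟩⟩ : ∃ K, Nonempty (Q.obj K ≅ L) := ⟨_, ⟨Q.objObjPreimageIso L⟩⟩
  let e1 : HH n (F.mapDerivedCategory.obj L) ≅ HH n (Q.obj ((F.mapHomologicalComplex _).obj K)) :=
    (homologyFunctor A n).mapIso (F.mapDerivedCategory.mapIso e.symm ≪≫ mapDQ F K)
  let e2 : ((F.mapHomologicalComplex (ComplexShape.up ℤ)).obj K).homology n ≅ F.obj (K.homology n) :=
    (K.sc n).mapHomologyIso F
  exact ⟨e1 ≪≫ HHQ n _ ≪≫ e2 ≪≫ F.mapIso ((HHQ n K).symm ≪≫ (homologyFunctor A n).mapIso e)⟩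

end

end LN

namespace LN

variable {X : Scheme.{u}}

open DerivedCategory

lemma isZero_of_locally {M : X.Modules} (h : ∀ x : X, ∃ U : X.Opens, x ∈ U ∧ IsZero ((cut X U).obj M)) :
    IsZero M := by
  refine isZero_of_sections fun V s ↦ eq_zero_of_locally _ _ fun x hx ↦ ?_
  obtain ⟨U, hxU, hU⟩ := h x
  refine ⟨V ⊓ U, inf_le_left, ⟨hx, hxU⟩, ?_⟩
  obtain ⟨t, ht⟩ := (cutε_bijective M (inf_le_right : V ⊓ U ≤ U)).2 (res M inf_le_left s)
  rw [← ht]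
  have : (cutε X U).app M = 0 := hU.eq_of_src _ _
  rw [this]
  rfl

lemma qcOn_cut_iff {U V : X.Opens} (h : V ≤ U) (M : X.Modules) :
    QCOn V ((cut X U).obj M) ↔ QCOn V M :=
  ⟨fun H ↦ H.of_bijective' ((cutε X U).app M) fun _ hW ↦ cutε_bijective M (hW.trans h),
    fun H ↦ H.of_bijective ((cutε X U).app M) fun _ hW ↦ cutε_bijective M (hW.trans h)⟩

/-- Extending complexes by zero twice. -/
lemma nonempty_cutC_cutC {V W : X.Opens} (h : V ≤ W) (K : CochainComplex X.Modules ℤ) :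
    Nonempty ((cutC X V).obj ((cutC X W).obj K) ≅ (cutC X V).obj K) :=
  ⟨HomologicalComplex.Hom.isoOfComponents (fun i ↦ (cutCut X h).app (K.X i))
    fun i j _ ↦ ((cutCut X h).hom.naturality (K.d i j)).symm⟩

lemma nonempty_cutC_top (K : CochainComplex X.Modules ℤ) : Nonempty ((cutC X ⊤).obj K ≅ K) := by
  have h (A : X.Modules) : IsIso ((cutε X ⊤).app A) :=
    IsSupp.isIso_cutε fun V s x hx ↦ ⟨V, le_rfl, hx, Or.inl le_top⟩
  exact ⟨HomologicalComplex.Hom.isoOfComponents (fun i ↦ @asIso _ _ _ _ _ (h (K.X i)))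
    fun i j _ ↦ ((cutε X ⊤).naturality (K.d i j)).symm⟩

section
variable [HasDerivedCategory.{u + 1} X.Modules]

variable (X) in
/-- The derived functor of `cut`. -/
def TD (U : X.Opens) : DerivedCategory X.Modules ⥤ DerivedCategory X.Modules :=
  (cut X U).mapDerivedCategory

/-- `TD` on complexes. -/
def TDQ (U : X.Opens) (K : CochainComplex X.Modules ℤ) :
    (TD X U).obj (Q.obj K) ≅ Q.obj ((cutC X U).obj K) := mapDQ _ K

/-- `TD` on single complexes. -/
def TDSF (U : X.Opens) (n : ℤ) (M : X.Modules) :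
    (TD X U).obj (SF n M) ≅ SF n ((cut X U).obj M) := mapDSF _ n M

lemma nonempty_TDHH (U : X.Opens) (n : ℤ) (L : DerivedCategory X.Modules) :
    Nonempty (HH n ((TD X U).obj L) ≅ (cut X U).obj (HH n L)) := nonempty_mapDHH _ n L

lemma nonempty_TD_TD {V W : X.Opens} (h : V ≤ W) (L : DerivedCategory X.Modules) :
    Nonempty ((TD X V).obj ((TD X W).obj L) ≅ (TD X V).obj L) := by
  obtain ⟨K, ⟨e⟩⟩ : ∃ K, Nonempty (Q.obj K ≅ L) := ⟨_, ⟨Q.objObjPreimageIso L⟩⟩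
  obtain ⟨c⟩ := nonempty_cutC_cutC h K
  exact ⟨(TD X V).mapIso ((TD X W).mapIso e.symm ≪≫ TDQ W K) ≪≫ TDQ V _ ≪≫ Q.mapIso c ≪≫
    (TDQ V K).symm ≪≫ (TD X V).mapIso e⟩

lemma nonempty_TD_top (L : DerivedCategory X.Modules) : Nonempty ((TD X ⊤).obj L ≅ L) := by
  obtain ⟨K, ⟨e⟩⟩ : ∃ K, Nonempty (Q.obj K ≅ L) := ⟨_, ⟨Q.objObjPreimageIso L⟩⟩
  obtain ⟨c⟩ := nonempty_cutC_top K
  exact ⟨(TD X ⊤).mapIso e.symm ≪≫ TDQ ⊤ K ≪≫ Q.mapIso c ≪≫ e⟩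

/-- Morphisms from `L` restricted to `V` into shifts of quasi-coherent modules vanish in degrees
lower than `a`. -/
def PA (V : X.Opens) (a : ℤ) (L : DerivedCategory X.Modules) : Prop :=
  ∀ M : X.Modules, QCOn V M → ∀ m < a, HZ ((TD X V).obj L) (SF m M)

lemma PA.of_retract {V : X.Opens} {a : ℤ} {L L' : DerivedCategory X.Modules} (h : PA V a L)
    (i : L' ⟶ L) (p : L ⟶ L') (e : i ≫ p = 𝟙 _) : PA V a L' := fun M hM m hm ↦
  (h M hM m hm).of_retract_left ((TD X V).map i) ((TD X V).map p)
    (by rw [← Functor.map_comp, e, CategoryTheory.Functor.map_id])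

lemma PA_TD_iff {V W : X.Opens} (h : V ≤ W) {a : ℤ} {L : DerivedCategory X.Modules} :
    PA V a ((TD X W).obj L) ↔ PA V a L := by
  obtain ⟨e⟩ := nonempty_TD_TD h L
  exact ⟨fun H M hM m hm ↦ (H M hM m hm).of_iso_left e,
    fun H M hM m hm ↦ (H M hM m hm).of_iso_left e.symm⟩

/-- Complexes of extended free modules. -/
lemma PA.of_free {U V : X.Opens} (hVU : V ≤ U) (hV : IsAffineOpen V) {a b : ℤ} (hab : a ≤ b)
    (K : CochainComplex X.Modules ℤ) (hK : ∀ i, (i < a ∨ b < i) → IsZero (K.X i))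
    (hF : ∀ i, ∃ (κ : Type u) (c : Cofan (fun _ : κ ↦ LN.OO X U)) (_ : IsColimit c),
      Nonempty (c.pt ≅ K.X i)) : PA V a (Q.obj K) := by
  intro M hM m hm
  refine HZ.of_iso_left ?_ (TDQ V K).symm
  obtain ⟨k, hk⟩ := Int.eq_ofNat_of_zero_le (show 0 ≤ b + 1 - a by lia)
  refine HZ.of_terms k a (b + 1) (by lia) _ (fun i hi ↦ (cut X V).map_isZero (hK i (by lia)))
    fun i N ⟨eN⟩ ↦ ?_
  by_cases hi : i < a
  · have : IsZero N := ((cut X V).map_isZero (hK i (Or.inl hi))).of_iso eN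
    exact HZ.of_isZero_left ((singleFunctor X.Modules i).map_isZero this)
  · obtain ⟨κ, c, hc, ⟨e⟩⟩ := hF i
    have := hz_cofan hV (isColimitMapCofan (cut X V) hc (cutOO hVU)) hM (show m < i by lia)
    exact this.of_iso_left ((singleFunctor X.Modules i).mapIso ((cut X V).mapIso e ≪≫ eN.symm))

end

end LN

namespace LN

variable {X : Scheme.{u}}

open DerivedCategory

lemma nonempty_iso_map {B C : Type*} [Category* B] [Category* C] [Abelian B] [Abelian C]
    [HasDerivedCategory B] [HasDerivedCategory C] (J : B ⥤ C) [J.Additive] [PreservesFiniteLimits J]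
    [PreservesFiniteColimits J] {K L : CochainComplex B ℤ} (e : Q.obj K ≅ Q.obj L) :
    Nonempty (Q.obj ((J.mapHomologicalComplex _).obj K) ≅
      Q.obj ((J.mapHomologicalComplex _).obj L)) :=
  ⟨(J.mapDerivedCategoryFactors.app K).symm ≪≫ J.mapDerivedCategory.mapIso e ≪≫
    J.mapDerivedCategoryFactors.app L⟩

variable [HasDerivedCategory.{u + 1} X.Modules]

/-- The properties of locally projective complexes which are used. -/
structure ALP (a b : ℤ) (L : DerivedCategory X.Modules) : Prop where
  qc (n : ℤ) : QCOn ⊤ (HH n L)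
  zero (n : ℤ) (h : n < a ∨ b < n) : IsZero (HH n L)
  loc (x : X) : ∃ U : X.Opens, x ∈ U ∧ ∀ V ≤ U, IsAffineOpen V → PA V a L

lemma exists_local [∀ U : X.Opens, HasDerivedCategory.{u + 1} (ModOver X U)]
    {a b : ℤ} {E : CochainComplex X.Modules ℤ} {U : X.Opens}
    {F G : CochainComplex (ModOver X U) ℤ}
    (hF : ∀ i : ℤ, ∃ κ : Type u, Nonempty (F.X i ≅ SheafOfModules.free κ))
    (hF' : ∀ i : ℤ, (i < a ∨ b < i) → IsZero (F.X i)) (s : G ⟶ F) (ρ : F ⟶ G) (h : s ≫ ρ = 𝟙 G)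
    (e : Q.obj ((restrictComplex X U).obj E) ≅ Q.obj G) :
    ∃ F' : CochainComplex X.Modules ℤ, (∀ i, (i < a ∨ b < i) → IsZero (F'.X i)) ∧
      (∀ i, ∃ (κ : Type u) (c : Cofan (fun _ : κ ↦ LN.OO X U)) (_ : IsColimit c),
        Nonempty (c.pt ≅ F'.X i)) ∧
      ∃ (i : (TD X U).obj (Q.obj E) ⟶ Q.obj F') (p : Q.obj F' ⟶ (TD X U).obj (Q.obj E)),
        i ≫ p = 𝟙 _ := by
  let : HasDerivedCategory.{u + 1} (OpenMod X U) :=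
    inferInstanceAs (HasDerivedCategory.{u + 1} (ModOver X U))
  let J := (extZero X U).mapHomologicalComplex (ComplexShape.up ℤ)
  let G' : CochainComplex (OpenMod X U) ℤ := G
  let F' : CochainComplex (OpenMod X U) ℤ := F
  let s' : G' ⟶ F' := s
  let ρ' : F' ⟶ G' := ρ
  have h' : s' ≫ ρ' = 𝟙 _ := h
  let e' : Q.obj (((rest X U).mapHomologicalComplex _).obj E) ≅ Q.obj G' := e
  obtain ⟨e₂⟩ := nonempty_iso_map (extZero X U) e'
  let e₃ : (TD X U).obj (Q.obj E) ≅ Q.obj (J.obj G') := TDQ U E ≪≫ e₂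
  refine ⟨J.obj F', fun i hi ↦ (extZero X U).map_isZero (hF' i hi), fun i ↦ ?_,
    e₃.hom ≫ Q.map (J.map s'), Q.map (J.map ρ') ≫ e₃.inv, ?_⟩
  · obtain ⟨κ, ⟨ei⟩⟩ := hF i
    obtain ⟨c, hc, hcp⟩ := exists_cofan_free U κ
    let ei' : F'.X i ≅ (SheafOfModules.free (R := X.ringCatSheaf.over U) κ : ModOver X U) := ei
    exact ⟨κ, c, hc, ⟨eqToIso hcp ≪≫ ((extZero X U).mapIso ei').symm⟩⟩
  · rw [Category.assoc, ← Category.assoc (Q.map _), ← Functor.map_comp, ← Functor.map_comp, h',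
      CategoryTheory.Functor.map_id, CategoryTheory.Functor.map_id, Category.id_comp, e₃.hom_inv_id]

lemma IsALocallyProjective.exists_ALP [∀ U : X.Opens, HasDerivedCategory.{u + 1} (ModOver X U)]
    {a : ℤ} {E : CochainComplex X.Modules ℤ} (hE : IsALocallyProjective X a E) :
    ∃ b, a ≤ b ∧ ALP a b (Q.obj E) := by
  obtain ⟨b, hab, ι, _, U, hU, hU', hE⟩ := hE
  have key (α : ι) : (∀ n, QCOn (U α) (HH n (Q.obj E))) ∧
      (∀ n, (n < a ∨ b < n) → IsZero ((cut X (U α)).obj (HH n (Q.obj E)))) ∧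
      ∀ V ≤ U α, IsAffineOpen V → PA V a (Q.obj E) := by
    obtain ⟨F, G, hF, hF', -, ⟨s, ρ, h⟩, ⟨e⟩⟩ := hE α
    obtain ⟨F', hz, hc, i, p, hip⟩ := exists_local hF hF' s ρ h e
    have hr (n : ℤ) : (homologyFunctor X.Modules n).map i ≫ (homologyFunctor X.Modules n).map p =
        𝟙 _ := by
      rw [← Functor.map_comp, hip, CategoryTheory.Functor.map_id]
    refine ⟨fun n ↦ ?_, fun n hn ↦ ?_, fun V hVU hV ↦ ?_⟩
    · obtain ⟨e⟩ := nonempty_TDHH (U α) n (Q.obj E)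
      refine (qcOn_cut_iff le_rfl _).1 (QCOn.of_iso ?_ e)
      refine QCOn.of_retract (QCOn.of_iso ?_ (HHQ n F').symm) _ _ (hr n)
      refine (weakSerre_QCOn (U α)).homology F' (fun j ↦ ?_) n
      obtain ⟨κ, c, hc, ⟨e⟩⟩ := hc j
      exact (QCOn.cofan hc).of_iso e
    · obtain ⟨e⟩ := nonempty_TDHH (U α) n (Q.obj E)
      refine IsZero.of_iso ?_ e.symm
      have : IsZero (F'.homology n) :=
        (F'.exactAt_iff_isZero_homology n).1 (ShortComplex.exact_of_isZero_X₂ (F'.sc n) (hz n hn))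
      rw [IsZero.iff_id_eq_zero, ← hr n, (this.of_iso (HHQ n F')).eq_zero_of_tgt
        ((homologyFunctor X.Modules n).map i), zero_comp]
    · rw [← PA_TD_iff hVU]
      exact (PA.of_free hVU hV hab F' hz hc).of_retract i p hip
  have hcov (x : X) : ∃ α, x ∈ U α := by
    have : x ∈ iSup U := hU' ▸ trivial
    simpa using this
  refine ⟨b, hab, ⟨fun n ↦ QCOn.of_locally fun x _ ↦ ?_, fun n hn ↦ isZero_of_locally fun x ↦ ?_,
    fun x ↦ ?_⟩⟩
  all_goals obtain ⟨α, hα⟩ := hcov x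
  · exact ⟨_, hα, (key α).1 n⟩
  · exact ⟨_, hα, (key α).2.1 n hn⟩
  · exact ⟨_, hα, (key α).2.2⟩

end LN

namespace LN

universe w v w'
variable {A : Type v} [Category.{w'} A] [Abelian A] [HasDerivedCategory.{w} A]
open DerivedCategory

open Pretriangulated

lemma epi_HH_SF_map (n : ℤ) {M N : A} (p : M ⟶ N) [Epi p] :
    Epi ((homologyFunctor A n).map ((singleFunctor A n).map p)) := by
  have e : (homologyFunctor A n).map ((singleFunctor A n).map p) =
      (HHSF n M).hom ≫ p ≫ (HHSF n N).inv := by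
    rw [← Category.assoc, Iso.eq_comp_inv]
    exact (singleFunctorCompHomologyFunctorIso A n).hom.naturality p
  rw [e]
  infer_instance

lemma exists_top {L : DerivedCategory A} {b : ℤ} (hL : ∀ n, b < n → IsZero (HH n L)) :
    ∃ (K : DerivedCategory A) (k : K ⟶ L) (g : L ⟶ SF b (HH b L)) (δ : _ ⟶ K⟦(1 : ℤ)⟧),
      Triangle.mk k g δ ∈ distTriang _ ∧ IsIso ((homologyFunctor A b).map g) ∧
      (∀ n, n < b → IsIso ((homologyFunctor A n).map k)) ∧ ∀ n, b ≤ n → IsZero (HH n K) := by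
  obtain ⟨K, Y, hK, hY, k, g, δ, hT⟩ := TStructure.t.exists_triangle L (b - 1) b (by lia)
  have hK' : K.IsLE (b - 1) := ⟨hK⟩
  have hY' : Y.IsGE b := ⟨hY⟩
  have hKz (n : ℤ) (hn : b ≤ n) : IsZero (HH n K) := isZero_of_isLE K (b - 1) n (by lia)
  have hYz (n : ℤ) (hn : n < b) : IsZero (HH n Y) := isZero_of_isGE Y b n hn
  have hY'' : Y.IsLE b := (isLE_iff _ _).2 fun n hn ↦
    isZero_HH₃ _ hT n (n + 1) rfl (hL n hn) (hKz _ (by lia))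
  have hg : IsIso ((homologyFunctor A b).map g) :=
    isIso_HH_mor₂ _ hT b (b + 1) rfl (hKz _ le_rfl) (hKz _ (by lia))
  obtain ⟨e⟩ := exists_iso_SF Y b
  let e' : Y ≅ SF b (HH b L) := e ≪≫
    (singleFunctor A b).mapIso (@asIso _ _ _ _ ((homologyFunctor A b).map g) hg).symm
  refine ⟨K, k, g ≫ e'.hom, e'.inv ≫ δ, ?_, ?_, fun n hn ↦ ?_, hKz⟩
  · exact isomorphic_distinguished _ hT _
      (Triangle.isoMk _ _ (Iso.refl _) (Iso.refl _) e'.symm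
        (by change k ≫ 𝟙 L = 𝟙 K ≫ k; simp)
        (by change (g ≫ e'.hom) ≫ e'.inv = 𝟙 L ≫ g; simp)
        (by change (e'.inv ≫ δ) ≫ (𝟙 K)⟦(1 : ℤ)⟧' = e'.inv ≫ δ; simp))
  · rw [Functor.map_comp]
    infer_instance
  · exact isIso_HH_mor₁ _ hT n (n - 1) (by lia) (hYz _ (by lia)) (hYz _ hn)

/-- Attaching a cell in the top degree. -/
lemma exists_attach {L : DerivedCategory A} {a b : ℤ} (hab : a < b)
    (hL : ∀ n, (n < a ∨ b < n) → IsZero (HH n L)) {F : A} (p : F ⟶ HH b L) [Epi p]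
    (hF : ∀ i < b, HZ (SF b F) (SF i (HH (i + 1) L))) :
    ∃ (φ : SF b F ⟶ L) (C : DerivedCategory A) (g : L ⟶ C) (δ : C ⟶ (SF b F)⟦(1 : ℤ)⟧),
      Triangle.mk φ g δ ∈ distTriang _ ∧ ∀ n, (n < a ∨ b - 1 < n) → IsZero (HH n C) := by
  obtain ⟨K, k, g, δ, hT, hg, hk, hK⟩ := exists_top (b := b) (fun n hn ↦ hL n (Or.inr hn))
  have hk' (n : ℤ) (hn : n < b) : Nonempty (HH n L ≅ HH n K) :=
    ⟨(@asIso _ _ _ _ _ (hk n hn)).symm⟩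
  have hKz (n : ℤ) (hn : n < a) : IsZero (HH n K) := by
    obtain ⟨e⟩ := hk' n (by lia)
    exact (hL n (Or.inl hn)).of_iso e.symm
  have hob : HZ (SF b F) (K⟦(1 : ℤ)⟧) := by
    obtain ⟨r, hr⟩ := Int.eq_ofNat_of_zero_le (show 0 ≤ (b - 2) - (a - 1) by lia)
    refine HZ.of_bounded_right r (a - 1) (b - 2) (by lia) _ ((isGE_iff _ _).2 fun i hi ↦ ?_)
      ((isLE_iff _ _).2 fun i hi ↦ ?_) fun i ↦ ?_
    · exact (hKz (i + 1) (by lia)).of_iso (HHshift 1 i (i + 1) (by lia) K)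
    · exact (hK (i + 1) (by lia)).of_iso (HHshift 1 i (i + 1) (by lia) K)
    · by_cases hi : i + 1 < b
      · obtain ⟨e⟩ := hk' (i + 1) hi
        exact (hF i (by lia)).of_iso_right
          ((singleFunctor A i).mapIso (e ≪≫ (HHshift 1 i (i + 1) (by lia) K).symm))
      · exact HZ.of_isZero_right ((singleFunctor A i).map_isZero
          ((hK (i + 1) (by lia)).of_iso (HHshift 1 i (i + 1) (by lia) K)))
  obtain ⟨φ, hφ⟩ := exists_lift_of_HZ hT hob ((singleFunctor A b).map p)
  have hφ' : Epi ((homologyFunctor A b).map φ) := by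
    have h1 : (homologyFunctor A b).map φ ≫ (homologyFunctor A b).map g =
        (homologyFunctor A b).map ((singleFunctor A b).map p) := by
      rw [← hφ, Functor.map_comp]
    have h2 : (homologyFunctor A b).map φ =
      (homologyFunctor A b).map ((singleFunctor A b).map p) ≫
        inv ((homologyFunctor A b).map g) := by
      rw [← h1, Category.assoc, IsIso.hom_inv_id, Category.comp_id]
    have := epi_HH_SF_map b p
    rw [h2]
    infer_instance
  obtain ⟨C, g', δ', hT'⟩ := distinguished_cocone_triangle φ
  refine ⟨φ, C, g', δ', hT', fun n hn ↦ ?_⟩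
  by_cases hnb : n = b
  · subst hnb
    have h0 : (homologyFunctor A n).map g' = 0 := by
      have h3 : (homologyFunctor A n).map φ ≫ (homologyFunctor A n).map g' = 0 := by
        rw [← Functor.map_comp, show φ ≫ g' = 0 from comp_distTriang_mor_zero₁₂ _ hT',
          Functor.map_zero]
      rwa [← cancel_epi ((homologyFunctor A n).map φ), comp_zero]
    exact (HomologySequence.exact₃ _ hT' n (n + 1) rfl).isZero_X₂ h0
      ((isZero_HHSF n (n + 1) (by lia) F).eq_of_tgt _ _)
  · exact isZero_HH₃ _ hT' n (n + 1) rfl (hL n (by lia)) (isZero_HHSF b (n + 1) (by lia) F)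

end LN

namespace LN


section Countable

variable {A Q : Type*} [CommRing A] [AddCommGroup Q] [Module A Q]

theorem projective_of_approx (π : (ℕ →₀ A) →ₗ[A] Q) (hπ : Function.Surjective π)
    (h : ∀ N : ℕ, ∃ R : Submodule A (ℕ →₀ A), R ≤ LinearMap.ker π ∧ R.FG ∧
      ∀ S : Submodule A (ℕ →₀ A), S.FG → S ≤ LinearMap.ker π →
        ∃ w : (ℕ →₀ A) →ₗ[A] (ℕ →₀ A), S ≤ LinearMap.ker w ∧ π ∘ₗ w = π ∧
          ∀ x ∈ Finsupp.supported A A {j : ℕ | j < N}, w x - x ∈ R) :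
    Module.Projective A Q := by
  choose R hRK hRfg hR using h
  choose v hv1 hv2 hv3 using fun n => hR n (R (n + 1)) (hRfg _) (hRK _)
  obtain ⟨w0, hw01, hw02, -⟩ := hR 0 (R 0) (hRfg _) (hRK _)
  let w : ℕ → ((ℕ →₀ A) →ₗ[A] (ℕ →₀ A)) := fun n =>
    Nat.rec w0 (fun n wn => wn ∘ₗ v n) n
  have hws (n) : w (n + 1) = w n ∘ₗ v n := rfl
  have hw1 (n) : R n ≤ LinearMap.ker (w n) := by
    cases n with
    | zero => exact hw01
    | succ n =>
      rw [hws]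
      exact (hv1 n).trans (LinearMap.ker_le_ker_comp _ _)
  have hw2 (n) : π ∘ₗ w n = π := by
    induction n with
    | zero => exact hw02
    | succ n ih => rw [hws, ← LinearMap.comp_assoc, ih, hv2]
  have hw3 (n) (x) (hx : x ∈ Finsupp.supported A A {j : ℕ | j < n}) :
      w (n + 1) x = w n x := by
    have := hw1 n (hv3 n x hx)
    rw [LinearMap.mem_ker, map_sub, sub_eq_zero] at this
    rw [hws]; exact this
  have hw4 (n m) (hnm : n ≤ m) (x) (hx : x ∈ Finsupp.supported A A {j : ℕ | j < n}) :
      w m x = w n x := by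
    induction m, hnm using Nat.le_induction with
    | base => rfl
    | succ m hm ih =>
      rw [hw3 m x (Finsupp.supported_mono (fun j hj => lt_of_lt_of_le hj hm) hx), ih]
  have hfin (x : ℕ →₀ A) : ∃ n, x ∈ Finsupp.supported A A {j : ℕ | j < n} := by
    obtain ⟨n, hn⟩ := x.support.bddAbove
    refine ⟨n + 1, fun j hj => Nat.lt_succ_of_le (hn hj)⟩
  let σ : (ℕ →₀ A) →ₗ[A] (ℕ →₀ A) :=
    Finsupp.lsum A fun j => (w (j + 1)) ∘ₗ Finsupp.lsingle j
  have hσ (n) (x) (hx : x ∈ Finsupp.supported A A {j : ℕ | j < n}) : σ x = w n x := by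
    conv_rhs => rw [← Finsupp.sum_single x]
    rw [Finsupp.sum, map_sum, Finsupp.lsum_apply, Finsupp.sum]
    refine Finset.sum_congr rfl fun j hj => ?_
    have hj' : j < n := hx hj
    refine (hw4 (j + 1) n hj' _ ?_).symm
    exact Finsupp.single_mem_supported (R := A) (M := A) (x j) (Nat.lt_succ_self j)
  have hσ1 : π ∘ₗ σ = π := by
    refine LinearMap.ext fun x => ?_
    obtain ⟨n, hn⟩ := hfin x
    rw [LinearMap.comp_apply, hσ n _ hn]
    exact LinearMap.congr_fun (hw2 n) _
  have hσ2 : LinearMap.ker π ≤ LinearMap.ker σ := by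
    intro k hk
    obtain ⟨n, hn⟩ := hfin k
    have hkR : k ∈ R n := by
      obtain ⟨u, hu1, -, hu3⟩ := hR n (Submodule.span A {k}) (Submodule.fg_span_singleton k)
        (by rw [Submodule.span_singleton_le_iff_mem]; exact hk)
      have h1 := hu3 k hn
      rw [LinearMap.mem_ker.1 (hu1 (Submodule.mem_span_singleton_self k)), zero_sub] at h1
      exact (Submodule.neg_mem_iff _).1 h1
    rw [LinearMap.mem_ker, hσ n _ hn]
    exact hw1 n hkR
  let e := LinearMap.quotKerEquivOfSurjective π hπ
  refine Module.Projective.of_split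
    (((LinearMap.ker π).liftQ σ hσ2) ∘ₗ e.symm.toLinearMap) π ?_
  ext q
  obtain ⟨x, rfl⟩ := hπ q
  have : e.symm (π x) = Submodule.Quotient.mk x := by
    rw [LinearEquiv.symm_apply_eq]; rfl
  simp only [LinearMap.comp_apply, LinearEquiv.coe_coe, this, LinearMap.id_apply]
  exact LinearMap.congr_fun hσ1 x

end Countable

end LN

namespace LN


universe v

section LocSplit

open LocalizedModule

/-- An elementary form of the projectivity of the `A_f`-module `M_f`. -/
def LocSplit {A : Type v} [CommRing A] (f : A) (M : Type v) [AddCommGroup M] [Module A M] : Prop :=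
  ∃ (I : Type v) (y : I → M) (s : M →ₗ[A] (I →₀ Localization.Away f)),
    ∀ x, Finsupp.linearCombination (Localization.Away f)
      (fun c => mkLinearMap (.powers f) M (y c)) (s x) = mkLinearMap (.powers f) M x

variable {A : Type v} [CommRing A]

open Filter in
theorem eventually_of_mk_eq_zero {f : A} {M : Type v} [AddCommGroup M] [Module A M] {x : M}
    (h : mkLinearMap (.powers f) M x = 0) : ∀ᶠ n : ℕ in atTop, f ^ n • x = 0 := by
  obtain ⟨⟨_, n, rfl⟩, hn⟩ := (IsLocalizedModule.eq_zero_iff (.powers f) _).1 h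
  refine eventually_atTop.2 ⟨n, fun m hm => ?_⟩
  obtain ⟨k, rfl⟩ := Nat.exists_eq_add_of_le hm
  rw [add_comm, pow_add, mul_smul]
  have hn' : f ^ n • x = 0 := hn
  rw [hn', smul_zero]

open Filter in
theorem eventually_exists_mk_eq {f : A} {M : Type v} [AddCommGroup M] [Module A M]
    (x : LocalizedModule (.powers f) M) :
    ∀ᶠ n : ℕ in atTop, ∃ y : M, mkLinearMap (.powers f) M y = f ^ n • x := by
  obtain ⟨⟨y, ⟨_, n, rfl⟩⟩, hn⟩ := IsLocalizedModule.surj (.powers f) (mkLinearMap (.powers f) M) x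
  refine eventually_atTop.2 ⟨n, fun m hm => ?_⟩
  obtain ⟨k, rfl⟩ := Nat.exists_eq_add_of_le hm
  refine ⟨f ^ k • y, ?_⟩
  rw [map_smul, ← hn, add_comm, pow_add, mul_smul]
  rfl

open Filter in
theorem projective_of_locSplit_of_countable {Q : Type v} [AddCommGroup Q] [Module A Q]
    (g : ℕ → Q) (hg : Submodule.span A (Set.range g) = ⊤) {ι : Type*} [Finite ι] (f : ι → A)
    (hf : Ideal.span (Set.range f) = ⊤) (h : ∀ i, LocSplit (f i) Q) : Module.Projective A Q := by
  classical
  let π : (ℕ →₀ A) →ₗ[A] Q := Finsupp.linearCombination A g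
  have hπ : Function.Surjective π := by
    rw [← LinearMap.range_eq_top, Finsupp.range_linearCombination, hg]
  refine projective_of_approx π hπ fun N => ?_
  have key (i : ι) : ∃ R : Submodule A (ℕ →₀ A), R ≤ LinearMap.ker π ∧ R.FG ∧
      ∀ S : Submodule A (ℕ →₀ A), S.FG → S ≤ LinearMap.ker π →
        ∃ m : ℕ, ∃ w : (ℕ →₀ A) →ₗ[A] (ℕ →₀ A), S ≤ LinearMap.ker w ∧ π ∘ₗ w = f i ^ m • π ∧
          ∀ j < N, w (Finsupp.single j 1) - f i ^ m • Finsupp.single j 1 ∈ R := by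
    obtain ⟨I, y, s, hs⟩ := h i
    choose y' hy' using fun c => hπ (y c)
    let P := LocalizedModule (.powers (f i)) (ℕ →₀ A)
    let mk : (ℕ →₀ A) →ₗ[A] P := mkLinearMap (.powers (f i)) (ℕ →₀ A)
    let e : (ℕ →₀ A) →ₗ[A] P := ((Finsupp.linearCombination (Localization.Away (f i))
      (fun c => mk (y' c))).restrictScalars A) ∘ₗ s ∘ₗ π
    have hmapmk' (x) : LocalizedModule.map (.powers (f i)) π (mkLinearMap _ _ x) =
        mkLinearMap (.powers (f i)) Q (π x) :=
      IsLocalizedModule.map_LocalizedModules (.powers (f i)) π x 1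
    have he (x) : LocalizedModule.map (.powers (f i)) π (e x) =
        mkLinearMap (.powers (f i)) Q (π x) := by
      rw [← hs]
      simp only [e, LinearMap.comp_apply, LinearMap.restrictScalars_apply]
      rw [Finsupp.apply_linearCombination]
      congr 2
      ext c
      rw [← hy']
      exact hmapmk' _
    have heker (x) (hx : π x = 0) : e x = 0 := by
      simp only [e, LinearMap.comp_apply, hx, map_zero]
    have hmapmk (x) : LocalizedModule.map (.powers (f i)) π (mk x) =
        mkLinearMap (.powers (f i)) Q (π x) := hmapmk' x
    -- elements of the kernel approximating `1 - e`
    have hk (j : ℕ) : ∀ᶠ n : ℕ in atTop, ∃ k ∈ LinearMap.ker π,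
        mk k = f i ^ n • (e (Finsupp.single j 1) - mk (Finsupp.single j 1)) := by
      obtain ⟨n, hn⟩ := (eventually_exists_mk_eq
        (e (Finsupp.single j 1) - mk (Finsupp.single j 1))).exists
      obtain ⟨k, hk⟩ := hn
      have h0 : mkLinearMap (.powers (f i)) Q (π k) = 0 := by
        rw [← hmapmk]
        change LocalizedModule.map _ π (mkLinearMap _ _ k) = 0
        rw [hk, ← LinearMap.restrictScalars_apply A, map_smul, LinearMap.restrictScalars_apply,
          map_sub, he, hmapmk, sub_self, smul_zero]
      obtain ⟨n', hn'⟩ := eventually_atTop.1 (eventually_of_mk_eq_zero h0)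
      refine eventually_atTop.2 ⟨n + n', fun m hm => ?_⟩
      obtain ⟨t, rfl⟩ := Nat.exists_eq_add_of_le hm
      refine ⟨f i ^ (n' + t) • k, ?_, ?_⟩
      · rw [LinearMap.mem_ker, map_smul, hn' _ (Nat.le_add_right _ _)]
      · rw [map_smul]
        change f i ^ (n' + t) • mkLinearMap _ _ k = _
        rw [hk, smul_smul, ← pow_add]
        congr 2
        ring
    obtain ⟨n, hn⟩ := ((Set.finite_lt_nat N).eventually_all.2 fun j _ => hk j).exists
    choose! k hkK hk' using hn
    refine ⟨Submodule.span A (k '' {j | j < N}), ?_, Submodule.fg_span ((Set.finite_lt_nat N).image k),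
      fun S hS hSK => ?_⟩
    · rw [Submodule.span_le]
      rintro _ ⟨j, hj, rfl⟩
      exact hkK j hj
    obtain ⟨T, hT⟩ := hS
    obtain ⟨M, hNM, hM⟩ : ∃ M, N ≤ M ∧ ∀ x ∈ T, x ∈ Finsupp.supported A A {j : ℕ | j < M} := by
      obtain ⟨M, hM⟩ := (T.biUnion Finsupp.support).bddAbove
      refine ⟨max N (M + 1), le_max_left _ _, fun x hx j hj => ?_⟩
      exact lt_max_of_lt_right (Nat.lt_succ_of_le (hM (Finset.mem_coe.2
        (Finset.mem_biUnion.2 ⟨x, hx, hj⟩))))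
    obtain ⟨m, hm, hnm⟩ := (((Set.finite_lt_nat M).eventually_all.2 fun j _ =>
      eventually_exists_mk_eq (e (Finsupp.single j 1))).and (eventually_ge_atTop n)).exists
    choose! p hp using hm
    let w : (ℕ →₀ A) →ₗ[A] (ℕ →₀ A) := Finsupp.linearCombination A
      fun j => if j < M then p j else f i ^ m • Finsupp.single j 1
    have hw1 (j) (hj : j < M) : w (Finsupp.single j 1) = p j := by
      simp [w, hj]
    have hw2 (j) (hj : ¬ j < M) : w (Finsupp.single j 1) = f i ^ m • Finsupp.single j 1 := by
      simp [w, hj]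
    have hwe (x) (hx : x ∈ Finsupp.supported A A {j : ℕ | j < M}) :
        mk (w x) = f i ^ m • e x := by
      conv_lhs => rw [← Finsupp.sum_single x]
      conv_rhs => rw [← Finsupp.sum_single x]
      simp only [Finsupp.sum, map_sum, Finset.smul_sum]
      refine Finset.sum_congr rfl fun j hj => ?_
      have hj' : j < M := hx hj
      have : Finsupp.single j (x j) = x j • Finsupp.single j (1 : A) := by simp
      rw [this, map_smul, map_smul, map_smul, hw1 j hj', smul_comm]
      congr 1
      exact hp j hj'
    have ev1 : ∀ᶠ t : ℕ in atTop, ∀ x ∈ T, f i ^ t • w x = 0 := by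
      refine (Finset.eventually_all T).2 fun x hx => eventually_of_mk_eq_zero ?_
      change mk (w x) = 0
      rw [hwe x (hM x hx), heker x (hSK (hT ▸ Submodule.subset_span hx)), smul_zero]
    have ev2 : ∀ᶠ t : ℕ in atTop, ∀ j ∈ {j | j < M},
        f i ^ t • (π (w (Finsupp.single j 1)) - f i ^ m • π (Finsupp.single j 1)) = 0 := by
      refine (Set.finite_lt_nat M).eventually_all.2 fun j hj => eventually_of_mk_eq_zero ?_
      rw [map_sub, map_smul, ← hmapmk, hwe _ (Finsupp.single_mem_supported (R := A) (1 : A) hj),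
        ← LinearMap.restrictScalars_apply A, map_smul, LinearMap.restrictScalars_apply, he, sub_self]
    have ev3 : ∀ᶠ t : ℕ in atTop, ∀ j ∈ {j | j < N},
        f i ^ t • (w (Finsupp.single j 1) - f i ^ m • Finsupp.single j 1 -
          f i ^ (m - n) • k j) = 0 := by
      refine (Set.finite_lt_nat N).eventually_all.2 fun j hj => eventually_of_mk_eq_zero ?_
      change mk _ = 0
      have hj' : j < M := lt_of_lt_of_le hj hNM
      rw [map_sub, map_sub, map_smul, map_smul,
        hwe _ (Finsupp.single_mem_supported (R := A) (1 : A) hj'), hk' j hj, smul_smul, ← pow_add,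
        Nat.sub_add_cancel hnm, smul_sub, sub_self]
    obtain ⟨t, ht1, ht2, ht3⟩ := (ev1.and (ev2.and ev3)).exists
    refine ⟨t + m, f i ^ t • w, ?_, ?_, fun j hj => ?_⟩
    · rw [← hT, Submodule.span_le]
      intro x hx
      exact ht1 x hx
    · refine Finsupp.lhom_ext' fun j => LinearMap.ext_ring ?_
      simp only [LinearMap.comp_apply, LinearMap.smul_apply, Finsupp.lsingle_apply, map_smul]
      by_cases hj : j < M
      · have := ht2 j hj
        rw [smul_sub, sub_eq_zero] at this
        rw [this, pow_add, mul_smul]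
      · rw [hw2 j hj, map_smul, pow_add, mul_smul]
    · have := ht3 j hj
      rw [smul_sub, sub_eq_zero, smul_sub, smul_smul, ← pow_add] at this
      rw [LinearMap.smul_apply, this]
      exact Submodule.smul_mem _ _ (Submodule.smul_mem _ _
        (Submodule.subset_span ⟨j, hj, rfl⟩))
  choose R hRK hRfg hR using key
  refine ⟨⨆ i, R i, iSup_le hRK, Submodule.fg_iSup _ hRfg, fun S hS hSK => ?_⟩
  let J : Ideal A :=
    { carrier := {a | ∃ w : (ℕ →₀ A) →ₗ[A] (ℕ →₀ A), S ≤ LinearMap.ker w ∧ π ∘ₗ w = a • π ∧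
        ∀ j < N, w (Finsupp.single j 1) - a • Finsupp.single j 1 ∈ ⨆ i, R i}
      add_mem' := by
        rintro a b ⟨w, h1, h2, h3⟩ ⟨w', h1', h2', h3'⟩
        refine ⟨w + w', fun x hx => ?_, ?_, fun j hj => ?_⟩
        · rw [LinearMap.mem_ker, LinearMap.add_apply, LinearMap.mem_ker.1 (h1 hx),
            LinearMap.mem_ker.1 (h1' hx), add_zero]
        · rw [LinearMap.comp_add, h2, h2', add_smul]
        · have := add_mem (h3 j hj) (h3' j hj)
          convert this using 1
          rw [LinearMap.add_apply, add_smul]; abel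
      zero_mem' := ⟨0, fun x _ => by simp, by simp, fun j _ => by simp⟩
      smul_mem' := by
        rintro c a ⟨w, h1, h2, h3⟩
        refine ⟨c • w, fun x hx => ?_, ?_, fun j hj => ?_⟩
        · rw [LinearMap.mem_ker, LinearMap.smul_apply, LinearMap.mem_ker.1 (h1 hx), smul_zero]
        · rw [LinearMap.comp_smul, h2, smul_assoc]
        · have := Submodule.smul_mem _ c (h3 j hj)
          convert this using 1
          rw [LinearMap.smul_apply, smul_sub, smul_assoc] }
  have hJ : J = ⊤ := by
    have : J.radical = ⊤ := by
      rw [eq_top_iff, ← hf, Ideal.span_le]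
      rintro _ ⟨i, rfl⟩
      obtain ⟨m, w, h1, h2, h3⟩ := hR i S hS hSK
      exact ⟨m, w, h1, h2, fun j hj => Submodule.mem_iSup_of_mem i (h3 j hj)⟩
    exact Ideal.radical_eq_top.1 this
  obtain ⟨w, h1, h2, h3⟩ : (1 : A) ∈ J := hJ ▸ Submodule.mem_top
  refine ⟨w, h1, by rw [h2, one_smul], fun x hx => ?_⟩
  have hx' : w x - x = ∑ j ∈ x.support, (w (Finsupp.single j (x j)) - Finsupp.single j (x j)) := by
    rw [Finset.sum_sub_distrib, ← map_sum]
    exact congrArg₂ _ (congrArg w (Finsupp.sum_single x).symm) (Finsupp.sum_single x).symm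
  rw [hx']
  refine Submodule.sum_mem _ fun j hj => ?_
  have : Finsupp.single j (x j) = x j • Finsupp.single j (1 : A) := by simp
  rw [this, map_smul, ← smul_sub]
  refine Submodule.smul_mem _ _ ?_
  simpa using h3 j (hx hj)

end LocSplit

end LN

namespace LN


universe v

section Kaplansky

open LocalizedModule

variable {A : Type v} [CommRing A] {M : Type v} [AddCommGroup M] [Module A M]

theorem locSplit_quotient {f : A} {I : Type v} {y : I → M} {s : M →ₗ[A] (I →₀ Localization.Away f)}
    (hs : ∀ x, Finsupp.linearCombination (Localization.Away f)
      (fun c => mkLinearMap (.powers f) M (y c)) (s x) = mkLinearMap (.powers f) M x)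
    {N N' : Submodule A M} (hN : ∀ x ∈ N, ∀ c ∈ (s x).support, y c ∈ N)
    (hN' : ∀ x ∈ N', ∀ c ∈ (s x).support, y c ∈ N') :
    LocSplit f (N' ⧸ N.submoduleOf N') := by
  classical
  let J : Set I := {c | ∃ x ∈ N, c ∈ (s x).support}
  have hJ (c) (hc : c ∈ J) : y c ∈ N := by
    obtain ⟨x, hx, hc⟩ := hc; exact hN x hx c hc
  let y' : I → N' := fun c => if h : y c ∈ N' then ⟨y c, h⟩ else 0
  let r : (I →₀ Localization.Away f) →ₗ[A] (I →₀ Localization.Away f) :=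
    { toFun := Finsupp.filter (fun c => c ∉ J)
      map_add' := fun _ _ => Finsupp.filter_add
      map_smul' := fun _ _ => Finsupp.filter_smul }
  have hr (x) (hx : x ∈ N) : r (s x) = 0 := by
    refine Finsupp.filter_eq_zero_iff _ _ |>.2 fun c hc => ?_
    by_contra h
    exact hc ⟨x, hx, Finsupp.mem_support_iff.2 h⟩
  let q := (N.submoduleOf N').mkQ
  have e1 (x : N') : Finsupp.linearCombination (Localization.Away f)
      (fun c => mkLinearMap (.powers f) N' (y' c)) (s x) = mkLinearMap (.powers f) N' x := by
    have inj : Function.Injective (LocalizedModule.map (.powers f) N'.subtype) :=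
      IsLocalizedModule.map_injective (.powers f) (mkLinearMap _ _) (mkLinearMap _ _) _
        N'.injective_subtype
    refine inj ?_
    rw [Finsupp.apply_linearCombination]
    refine Eq.trans ?_ ((hs x).trans
      (IsLocalizedModule.map_LocalizedModules (.powers f) N'.subtype x 1).symm)
    simp only [Finsupp.linearCombination_apply, Finsupp.sum]
    refine Finset.sum_congr rfl fun c hc => ?_
    congr 1
    refine (IsLocalizedModule.map_LocalizedModules (.powers f) N'.subtype (y' c) 1).trans ?_
    simp only [y', hN' x x.2 c hc, dif_pos]
    rfl
  refine ⟨I, fun c => q (y' c), (N.submoduleOf N').liftQ (r ∘ₗ s ∘ₗ N'.subtype) fun x hx =>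
    hr x hx, fun x => ?_⟩
  obtain ⟨x, rfl⟩ := Submodule.mkQ_surjective _ x
  have e2 := congrArg (LocalizedModule.map (.powers f) q) (e1 x)
  rw [Finsupp.apply_linearCombination] at e2
  refine Eq.trans ?_ (e2.trans (IsLocalizedModule.map_LocalizedModules (.powers f) q x 1))
  change Finsupp.linearCombination _ _ (Finsupp.filter _ (s x)) = _
  rw [Finsupp.linearCombination_apply, Finsupp.linearCombination_apply, Finsupp.sum, Finsupp.sum,
    Finsupp.support_filter, Finset.sum_filter]
  refine Finset.sum_congr rfl fun c hc => ?_
  have hq : LocalizedModule.map (.powers f) q (mkLinearMap (.powers f) N' (y' c)) =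
      mkLinearMap (.powers f) _ (q (y' c)) :=
    IsLocalizedModule.map_LocalizedModules (.powers f) q (y' c) 1
  rw [Function.comp_apply, hq]
  split_ifs with h
  · have : q (y' c) = 0 := by
      refine (Submodule.Quotient.mk_eq_zero _).2 ?_
      have h' := hJ c h
      change (y' c : M) ∈ N
      by_cases h'' : y c ∈ N' <;> simp [y', h'', h']
    rw [this, map_zero, smul_zero]
  · change Finsupp.filter (fun c => c ∉ J) (s x) c • _ = _
    rw [Finsupp.filter_apply_pos (fun c => c ∉ J) (s x) h]

/-- A Kaplansky-type dévissage: `D` is a closure operation with countable values. -/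
theorem projective_of_countable_devissage (D : M → Set M) (hD : ∀ x, (D x).Countable)
    (hadd : ∀ x y, D (x + y) ⊆ D x ∪ D y) (hsmul : ∀ (a : A) x, D (a • x) ⊆ D x)
    (hzero : D 0 = ∅)
    (h : ∀ N N' : Submodule A M, (∀ x ∈ N, D x ⊆ N) → (∀ x ∈ N', D x ⊆ N') →
      (∃ g : ℕ → (N' ⧸ N.submoduleOf N'), Submodule.span A (Set.range g) = ⊤) →
        Module.Projective A (N' ⧸ N.submoduleOf N')) :
    Module.Projective A M := by
  classical
  let p : (M →₀ A) →ₗ[A] M := Finsupp.linearCombination A id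
  have hp : Function.Surjective p := Finsupp.linearCombination_id_surjective A M
  have step (N : Submodule A M) (hN : ∀ x ∈ N, D x ⊆ N) (x : M) :
      ∃ N' : Submodule A M, N ≤ N' ∧ x ∈ N' ∧ (∀ x ∈ N', D x ⊆ N') ∧
        ∃ g : ℕ → (N' ⧸ N.submoduleOf N'), Submodule.span A (Set.range g) = ⊤ := by
    let G : ℕ → Set M := fun n => Nat.rec {x} (fun _ S => ⋃ z ∈ S, D z) n
    have hG (n) : (G n).Countable := by
      induction n with
      | zero => exact Set.countable_singleton x
      | succ n ih => exact ih.biUnion fun z _ => hD z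
    let T : Set M := ⋃ n, G n
    have hT : T.Countable := Set.countable_iUnion hG
    have hxT : x ∈ T := Set.mem_iUnion.2 ⟨0, rfl⟩
    obtain ⟨g, hg⟩ := hT.exists_eq_range ⟨x, hxT⟩
    let N' := N ⊔ Submodule.span A T
    have hTN' : T ⊆ N' := fun z hz => Submodule.mem_sup_right (Submodule.subset_span hz)
    refine ⟨N', le_sup_left, hTN' hxT, ?_, ?_⟩
    · let K : Submodule A M :=
        { carrier := {z | D z ⊆ N'}
          add_mem' := fun {a b} ha hb => (hadd a b).trans (Set.union_subset ha hb)
          zero_mem' := by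
            change D 0 ⊆ _
            rw [hzero]; exact Set.empty_subset _
          smul_mem' := fun c a ha => (hsmul c a).trans ha }
      have : N' ≤ K := by
        refine sup_le (fun z hz => (hN z hz).trans (show N ≤ N' from le_sup_left)) ?_
        rw [Submodule.span_le]
        intro z hz
        obtain ⟨n, hn⟩ := Set.mem_iUnion.1 hz
        refine Set.Subset.trans (fun t ht => ?_) hTN'
        exact Set.mem_iUnion.2 ⟨n + 1, Set.mem_biUnion hn ht⟩
      exact fun z hz => this hz
    · refine ⟨fun n => (N.submoduleOf N').mkQ ⟨g n, hTN' (hg ▸ ⟨n, rfl⟩)⟩, ?_⟩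
      rw [eq_top_iff]
      rintro z -
      obtain ⟨⟨z, hz⟩, rfl⟩ := Submodule.mkQ_surjective _ z
      obtain ⟨n, hn, t, ht, rfl⟩ := Submodule.mem_sup.1 hz
      have htN' : t ∈ N' := Submodule.mem_sup_right ht
      have e : (N.submoduleOf N').mkQ ⟨n + t, hz⟩ = (N.submoduleOf N').mkQ ⟨t, htN'⟩ := by
        rw [← sub_eq_zero, ← map_sub, Submodule.mkQ_apply, Submodule.Quotient.mk_eq_zero]
        change (n + t) - t ∈ N
        simpa using hn
      rw [e]
      let L : Submodule A N' := (Submodule.span A (Set.range fun n =>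
        (N.submoduleOf N').mkQ ⟨g n, hTN' (hg ▸ ⟨n, rfl⟩)⟩)).comap (N.submoduleOf N').mkQ
      have hL : Submodule.span A T ≤ L.map N'.subtype := by
        rw [Submodule.span_le]
        intro z hz
        obtain ⟨n, rfl⟩ : z ∈ Set.range g := hg ▸ hz
        exact ⟨⟨g n, hTN' hz⟩, Submodule.subset_span ⟨n, rfl⟩, rfl⟩
      obtain ⟨⟨t', ht'⟩, h1, h2⟩ := hL ht
      obtain rfl : t' = t := h2
      exact h1
  let S : Set (M →ₗ.[A] (M →₀ A)) :=
    {σ | (∀ x ∈ σ.domain, D x ⊆ σ.domain) ∧ ∀ x : σ.domain, p (σ x) = x}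
  have hzorn : ∃ σ, Maximal (· ∈ S) σ := by
    refine zorn_le₀ S fun c hcS hc => ?_
    rcases c.eq_empty_or_nonempty with rfl | hne
    · refine ⟨⊥, ⟨?_, ?_⟩, by simp⟩
      · rintro x hx
        obtain rfl : x = 0 := hx
        rw [hzero]
        exact Set.empty_subset _
      · rintro ⟨x, hx⟩
        obtain rfl : x = 0 := hx
        exact (congrArg p (LinearPMap.map_zero (⊥ : M →ₗ.[A] (M →₀ A)))).trans (map_zero p)
    · refine ⟨LinearPMap.sSup c hc.directedOn, ⟨?_, ?_⟩, fun σ hσ => LinearPMap.le_sSup _ hσ⟩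
      · intro x hx
        obtain ⟨σ, hσ, hx⟩ := (LinearPMap.mem_domain_sSup_iff hne hc.directedOn).1 hx
        exact ((hcS hσ).1 x hx).trans (LinearPMap.le_sSup hc.directedOn hσ).1
      · rintro ⟨x, hx⟩
        obtain ⟨σ, hσ, hx'⟩ := (LinearPMap.mem_domain_sSup_iff hne hc.directedOn).1 hx
        have := LinearPMap.sSup_apply hc.directedOn hσ ⟨x, hx'⟩
        refine (congrArg p this).trans ((hcS hσ).2 _)
  obtain ⟨σ, hσ⟩ := hzorn
  have htop : σ.domain = ⊤ := by
    rw [eq_top_iff]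
    rintro x -
    obtain ⟨N', hNN', hx, hN', hg⟩ := step σ.domain hσ.1.1 x
    have hproj := h σ.domain N' hσ.1.1 hN' hg
    let q := (σ.domain.submoduleOf N').mkQ
    obtain ⟨t, ht⟩ := Module.projective_lifting_property q LinearMap.id
      (Submodule.mkQ_surjective _)
    obtain ⟨T, hT⟩ := Module.projective_lifting_property p (N'.subtype ∘ₗ t) hp
    let d : N' →ₗ[A] σ.domain := LinearMap.codRestrict σ.domain
      (N'.subtype ∘ₗ (LinearMap.id - t ∘ₗ q)) fun z => by
        have : q (z - t (q z)) = 0 := by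
          rw [map_sub, sub_eq_zero]; exact (LinearMap.congr_fun ht (q z)).symm
        exact (Submodule.Quotient.mk_eq_zero (σ.domain.submoduleOf N')).1 this
    let σ' : M →ₗ.[A] (M →₀ A) := ⟨N', σ.toFun ∘ₗ d + T ∘ₗ q⟩
    have hσ'S : σ' ∈ S := by
      refine ⟨hN', fun z => ?_⟩
      change p (σ (d z) + T (q z)) = z
      rw [map_add, hσ.1.2]
      have : p (T (q z)) = (t (q z) : M) := LinearMap.congr_fun hT (q z)
      rw [this]
      change ((z : M) - t (q z)) + t (q z) = z
      abel
    have hle : σ ≤ σ' := by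
      refine ⟨hNN', fun z z' hzz' => ?_⟩
      have hq : q z' = 0 := (Submodule.Quotient.mk_eq_zero _).2 (by
        change (z' : M) ∈ σ.domain
        rw [← hzz']; exact z.2)
      change σ z = σ (d z') + T (q z')
      rw [hq, map_zero, add_zero]
      congr 1
      ext
      change (z : M) = (z' : M) - t (q z')
      rw [hq, map_zero]
      simpa using hzz'
    exact (hσ.2 hσ'S hle).1 hx
  refine Module.Projective.of_split (σ.toFun ∘ₗ (LinearMap.codRestrict σ.domain LinearMap.id
    fun x => htop ▸ Submodule.mem_top)) p ?_
  ext x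
  exact hσ.1.2 _

theorem projective_of_locSplit {ι : Type*} [Finite ι] (f : ι → A)
    (hf : Ideal.span (Set.range f) = ⊤) (h : ∀ i, LocSplit (f i) M) : Module.Projective A M := by
  classical
  choose I y s hs using h
  refine projective_of_countable_devissage (A := A)
    (fun x => ⋃ i, y i '' ((s i x).support : Set (I i))) (fun x => ?_) (fun x z => ?_)
    (fun a x => ?_) (by simp) fun N N' hN hN' ⟨g, hg⟩ => ?_
  · exact Set.countable_iUnion fun i => ((Finset.finite_toSet _).image _).countable
  · refine Set.iUnion_subset fun i => ?_
    rintro _ ⟨c, hc, rfl⟩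
    rw [map_add] at hc
    rcases Finset.mem_union.1 (Finsupp.support_add hc) with hc | hc
    · exact Or.inl (Set.mem_iUnion.2 ⟨i, c, hc, rfl⟩)
    · exact Or.inr (Set.mem_iUnion.2 ⟨i, c, hc, rfl⟩)
  · refine Set.iUnion_mono fun i => Set.image_mono ?_
    rw [map_smul]
    exact Finsupp.support_smul
  · refine projective_of_locSplit_of_countable g hg f hf fun i => locSplit_quotient (hs i) ?_ ?_
    · exact fun x hx c hc => hN x hx (Set.mem_iUnion.2 ⟨i, c, hc, rfl⟩)
    · exact fun x hx c hc => hN' x hx (Set.mem_iUnion.2 ⟨i, c, hc, rfl⟩)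

end Kaplansky

end LN

namespace LN

variable {X : Scheme.{u}}

open DerivedCategory

section
variable {W : X.Opens} {M N K : X.Modules}

/-- Quasi-coherent modules on an affine open are generated by global sections. -/
lemma QCOn.hom_eq_zero (hM : QCOn W M) (hs : IsSupp W M) (hW : IsAffineOpen W) (f : M ⟶ K)
    (h : ∀ s : Γ(M, W), f.app W s = 0) : f = 0 := by
  refine hs.hom_eq_zero f fun V hV s ↦ eq_zero_of_locally K _ fun x hx ↦ ?_
  obtain ⟨a, ha, hxa⟩ := exists_basicOpen_le' hW (hV hx) hx
  obtain ⟨n, t, ht⟩ := hM.surj hW le_rfl (X.basicOpen_le a) a rfl (res M ha s)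
  refine ⟨X.basicOpen a, ha, hxa, ?_⟩
  have hu := (isUnit_rr (X.basicOpen_le a) a le_rfl).pow n
  rw [← hu.smul_eq_zero, ← app_res, ← Scheme.Modules.Hom.app_smul, ← ht, app_res, h, map_zero]

lemma QCOn.epi (hM : QCOn W M) (hs : IsSupp W M) (hW : IsAffineOpen W) (p : N ⟶ M)
    (h : ∀ s : Γ(M, W), ∃ t, p.app W t = s) : Epi p :=
  Preadditive.epi_of_cancel_zero p fun g hg ↦ hM.hom_eq_zero hs hW g fun s ↦ by
    obtain ⟨t, rfl⟩ := h s
    rw [← comp_app_apply, hg]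
    rfl

lemma exists_cofan_surjective (W : X.Opens) (N : X.Modules) :
    ∃ (κ : Type u) (c : Cofan (fun _ : κ ↦ LN.OO X W)) (_ : IsColimit c) (p : c.pt ⟶ N),
      ∀ s : Γ(N, W), ∃ t, p.app W t = s := by
  let c := Cofan.mk (∐ fun _ : Γ(N, W) ↦ LN.OO X W) (Sigma.ι _)
  have hc : IsColimit c := coproductIsCoproduct _
  refine ⟨_, c, hc, Cofan.IsColimit.desc hc fun s ↦ ofSec s, fun s ↦ ⟨cofanOne c s, ?_⟩⟩
  rw [cofanOne, ← comp_app_apply, Cofan.IsColimit.fac, ofSec_one]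

/-- A section of the restriction of a morphism induces sections on sections. -/
lemma exists_linear_section {V : X.Opens} (p : M ⟶ N)
    (σ : (cut X V).obj N ⟶ (cut X V).obj M) (hσ : σ ≫ (cut X V).map p = 𝟙 _) :
    ∃ u : Γ(N, V) →ₗ[Γ(X, V)] Γ(M, V), ∀ x, p.app V (u x) = x := by
  choose z hz using (cutε_bijective N (le_refl V)).2
  have hi := (cutε_bijective N (le_refl V)).1
  refine ⟨{
    toFun x := ((cutε X V).app M).app V (σ.app V (z x))
    map_add' x y := ?_
    map_smul' a x := ?_ }, fun x ↦ ?_⟩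
  · rw [← map_add, ← map_add]
    congr 2
    exact hi (by rw [map_add, hz, hz, hz])
  · rw [RingHom.id_apply, ← Scheme.Modules.Hom.app_smul, ← Scheme.Modules.Hom.app_smul]
    congr 2
    exact hi (by rw [Scheme.Modules.Hom.app_smul, hz, hz])
  · have e : (cutε X V).app M ≫ p = (cut X V).map p ≫ (cutε X V).app N :=
      ((cutε X V).naturality p).symm
    change p.app V (((cutε X V).app M).app V (σ.app V (z x))) = x
    rw [← comp_app_apply, e, comp_app_apply, ← comp_app_apply σ, hσ]
    exact hz x
end

section
variable {κ : Type u} {W : X.Opens} {c : Cofan (fun _ : κ ↦ LN.OO X W)} (hc : IsColimit c)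
  {N : X.Modules} (p : c.pt ⟶ N)
include hc

lemma QCOn.locSplit (hW : IsAffineOpen W) (hN : QCOn W N) (f : Γ(X, W))
    (σ : (cut X (X.basicOpen f)).obj N ⟶ (cut X (X.basicOpen f)).obj c.pt)
    (hσ : σ ≫ (cut X (X.basicOpen f)).map p = 𝟙 _) : LocSplit f Γ(N, W) := by
  classical
  obtain ⟨u, hu⟩ := exists_linear_section p σ hσ
  have hV := X.basicOpen_le f
  have hloc := hW.isLocalization_basicOpen f
  let θ : Γ(X, X.basicOpen f) ≃ₐ[Γ(X, W)] Localization.Away f :=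
    IsLocalization.algEquiv (.powers f) _ _
  let a (k : κ) (x : Γ(N, W)) : Γ(X, X.basicOpen f) :=
    (cofanCoord hc k).app (X.basicOpen f) (u (res N hV x))
  have hT (x : Γ(N, W)) := cofan_exists_finset hc hV (hW.basicOpen f).isCompact (u (res N hV x))
  choose T hT₁ hT₂ using hT
  have ha (k : κ) (r : Γ(X, W)) (x) : a k (r • x) = rr hV r * a k x := by
    change (cofanCoord hc k).app _ _ = _
    rw [res_rr_smul, map_smul, Scheme.Modules.Hom.app_smul]
    rfl
  let s (x : Γ(N, W)) : κ →₀ Localization.Away f :=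
    Finsupp.onFinset (T x) (fun k ↦ θ (a k x)) fun k hk ↦ by
      by_contra h
      apply hk
      have : a k x = 0 := hT₁ x k h
      rw [this, map_zero]
  refine ⟨κ, fun k ↦ p.app W (cofanOne c k), {
    toFun := s
    map_add' x y := ?_
    map_smul' r x := ?_ }, fun x ↦ ?_⟩
  · ext k
    change θ (a k (x + y)) = θ (a k x) + θ (a k y)
    rw [← map_add]
    congr 1
    change (cofanCoord hc k).app _ _ = _
    rw [map_add, map_add, map_add]
    rfl
  · ext k
    change θ (a k (r • x)) = r • θ (a k x)
    rw [ha, ← map_smul, Algebra.smul_def]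
    rfl
  · change Finsupp.linearCombination _ _ (s x) = _
    rw [Finsupp.linearCombination_apply, Finsupp.sum_of_support_subset _
      (Finsupp.support_onFinset_subset) _ (by simp)]
    obtain ⟨⟨_, n, rfl⟩, hb⟩ := IsLocalization.exist_integer_multiples (.powers f) (T x)
      (fun k ↦ a k x)
    have hb' (k) : ∃ b : Γ(X, W), k ∈ T x → rr hV b = rr hV f ^ n * a k x := by
      by_cases hk : k ∈ T x
      · obtain ⟨b, hb⟩ := hb k hk
        refine ⟨b, fun _ ↦ hb.trans ?_⟩
        rw [Algebra.smul_def, map_pow]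
        rfl
      · exact ⟨0, fun h ↦ (hk h).elim⟩
    choose b hb using hb'
    have h1 : res N hV x = ∑ k ∈ T x, a k x • res N hV (p.app W (cofanOne c k)) := by
      conv_lhs => rw [← hu (res N hV x), hT₂ x, map_sum]
      refine Finset.sum_congr rfl fun k _ ↦ ?_
      rw [Scheme.Modules.Hom.app_smul, app_res]
    obtain ⟨m, hm⟩ := hN.inj hW le_rfl hV f rfl
      (f ^ n • x - ∑ k ∈ T x, b k • p.app W (cofanOne c k)) (by
        rw [map_sub, sub_eq_zero, map_sum, res_rr_smul, map_pow]
        conv_lhs => rw [h1, Finset.smul_sum]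
        refine Finset.sum_congr rfl fun k hk ↦ ?_
        rw [res_rr_smul, hb k hk, mul_smul])
    have hbθ (k) (hk : k ∈ T x) : algebraMap _ (Localization.Away f) (b k) =
        algebraMap _ _ (f ^ n) * θ (a k x) := by
      have e (r : Γ(X, W)) : θ (rr hV r) = algebraMap _ _ r := θ.commutes r
      rw [← e, hb k hk, map_mul, ← map_pow, e]
    have hunit : IsUnit (algebraMap Γ(X, W) (Localization.Away f) (f ^ m * f ^ n)) :=
      IsLocalization.map_units (M := .powers f) _ ⟨_, m + n, pow_add f m n⟩
    rw [← sub_eq_zero, ← hunit.smul_eq_zero]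
    have hm' := congr(LocalizedModule.mkLinearMap (.powers f) Γ(N, W) $hm)
    rw [smul_sub, smul_smul, map_sub, map_zero, map_smul, map_smul, map_sum] at hm'
    rw [← neg_eq_zero, ← smul_neg, neg_sub, smul_sub, ← hm', Finset.smul_sum, Finset.smul_sum,
      algebraMap_smul]
    congr 1
    refine Finset.sum_congr rfl fun k hk ↦ ?_
    rw [map_smul, ← algebraMap_smul (Localization.Away f) (b k), hbθ k hk, map_mul, mul_smul,
      mul_smul, algebraMap_smul]
    rfl

variable [HasDerivedCategory.{u+1} X.Modules]

lemma exists_section_of_linear (hW : IsAffineOpen W) (hN : QCOn W N) (hs : IsSupp W N)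
    (j : Γ(N, W) →ₗ[Γ(X, W)] Γ(c.pt, W)) (hj : ∀ x, p.app W (j x) = x) :
    ∃ t, t ≫ p = 𝟙 N := by
  have : Epi p := hN.epi hs hW p fun s ↦ ⟨_, hj s⟩
  let e : c.pt ⟶ c.pt := Cofan.IsColimit.desc hc fun k ↦ ofSec (j (p.app W (cofanOne c k)))
  have he (k) : e.app W (cofanOne c k) = j (p.app W (cofanOne c k)) := by
    rw [cofanOne, ← comp_app_apply, Cofan.IsColimit.fac, ofSec_one]
    rfl
  have he' (z : Γ(c.pt, W)) : e.app W z = j (p.app W z) := by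
    obtain ⟨T, -, hT⟩ := cofan_exists_finset hc le_rfl hW.isCompact z
    rw [hT, map_sum, map_sum, map_sum]
    refine Finset.sum_congr rfl fun k _ ↦ ?_
    rw [Scheme.Modules.Hom.app_smul, Scheme.Modules.Hom.app_smul, map_smul, res_self, he]
  have hk : kernel.ι p ≫ e = 0 :=
    ((weakSerre_QCOn W).kernel p (QCOn.cofan hc) hN).hom_eq_zero
      ((weakSerre_IsSupp W).kernel p (IsSupp.cofan hc) hs) hW _ fun s ↦ by
        rw [comp_app_apply, he', ← comp_app_apply, kernel.condition]
        exact map_zero j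
  obtain ⟨t, ht⟩ : ∃ t, p ≫ t = e :=
    ⟨(ShortComplex.exact_kernel p).desc e hk, (ShortComplex.exact_kernel p).g_desc e hk⟩
  refine ⟨t, (cancel_epi p).1 ?_⟩
  rw [← Category.assoc, ht, Category.comp_id]
  refine Cofan.IsColimit.hom_ext hc _ _ fun k ↦ OO_hom_ext ?_
  change (e ≫ p).app W (cofanOne c k) = p.app W (cofanOne c k)
  rw [comp_app_apply, he, hj]

/-- A quasi-coherent module on an affine open which is locally projective is projective. -/
lemma exists_section (hW : IsAffineOpen W) (hN : QCOn W N) (hs : IsSupp W N) {ι : Type*}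
    [Finite ι] (f : ι → Γ(X, W)) (hf : Ideal.span (Set.range f) = ⊤)
    (h : ∀ i M, QCOn (X.basicOpen (f i)) M →
      HZ (SF 1 ((cut X (X.basicOpen (f i))).obj N)) (SF 0 M))
    (hp : ∀ s : Γ(N, W), ∃ t, p.app W t = s) : ∃ t, t ≫ p = 𝟙 N := by
  have : Epi p := hN.epi hs hW p hp
  have : Module.Projective Γ(X, W) Γ(N, W) := by
    refine projective_of_locSplit f hf fun i ↦ ?_
    let V := X.basicOpen (f i)
    have hV : V ≤ W := X.basicOpen_le _
    have hex : (ShortComplex.mk (kernel.ι p) p (kernel.condition p)).ShortExact :=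
      { exact := ShortComplex.exact_kernel p }
    have hK : QCOn V (kernel p) :=
      ((weakSerre_QCOn W).kernel p (QCOn.cofan hc) hN).le hV
    have hex' := hex.map_of_exact (cut X V)
    obtain ⟨σ, hσ⟩ := exists_lift_of_ext (f := (cut X V).map (kernel.ι p))
      (g := (cut X V).map p) (w := by rw [← Functor.map_comp, kernel.condition, Functor.map_zero])
      hex' (n := 1) (m := 0) rfl (h i _ ((qcOn_cut_iff le_rfl _).2 hK)) (𝟙 _)
    exact QCOn.locSplit hc p hW hN (f i) σ hσ
  let pl : Γ(c.pt, W) →ₗ[Γ(X, W)] Γ(N, W) :=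
    { toFun := p.app W, map_add' := map_add _, map_smul' := Scheme.Modules.Hom.app_smul _ }
  obtain ⟨j, hj⟩ := Module.projective_lifting_property pl LinearMap.id hp
  exact exists_section_of_linear hc p hW hN hs j fun x ↦ LinearMap.congr_fun hj x
end

end LN

namespace LN

variable {X : Scheme.{u}}

open DerivedCategory Pretriangulated

variable [HasDerivedCategory.{u+1} X.Modules]

lemma QCOn.of_isZero {W : X.Opens} {M : X.Modules} (h : IsZero M) : QCOn W M :=
  QCOn.unit.of_retract (0 : M ⟶ unitMod X) 0 (h.eq_of_src _ _)

lemma IsSupp.of_isZero {W : X.Opens} {M : X.Modules} (h : IsZero M) : IsSupp W M := by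
  have : Mono (0 : M ⟶ LN.OO X W) := ⟨fun _ _ _ ↦ h.eq_of_tgt _ _⟩
  exact (isSupp_OO W).of_mono (0 : M ⟶ LN.OO X W)

instance (U : X.Opens) : (TD X U).CommShift ℤ :=
  inferInstanceAs ((cut X U).mapDerivedCategory.CommShift ℤ)

instance (U : X.Opens) : (TD X U).IsTriangulated :=
  inferInstanceAs ((cut X U).mapDerivedCategory.IsTriangulated)

lemma exists_TD_triangle (U : X.Opens) {K L M : DerivedCategory X.Modules} {f : K ⟶ L} {g : L ⟶ M}
    {δ : M ⟶ K⟦(1 : ℤ)⟧} (hT : Triangle.mk f g δ ∈ distTriang _) :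
    ∃ δ', Triangle.mk ((TD X U).map f) ((TD X U).map g) δ' ∈ distTriang _ :=
  ⟨_, (TD X U).map_distinguished _ hT⟩

/-- A complex on an affine open which is locally a complex of projectives is one globally. -/
lemma hz_of_cover {W : X.Opens} (hW : IsAffineOpen W) {ι : Type*} [Finite ι] (f : ι → Γ(X, W))
    (hf : Ideal.span (Set.range f) = ⊤) (k : ℕ) : ∀ (a b : ℤ) (_ : a + k = b)
    (L : DerivedCategory X.Modules) (_ : ∀ n, (n < a ∨ b < n) → IsZero (HH n L))
    (_ : ∀ n, QCOn W (HH n L) ∧ IsSupp W (HH n L)) (_ : ∀ i, PA (X.basicOpen (f i)) a L)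
    (M : X.Modules) (_ : QCOn W M) (m : ℤ) (_ : m < a), HZ L (SF m M) := by
  induction k with
  | zero =>
    intro a b hab L hz hq hPA M hM m hm
    obtain rfl : a = b := by lia
    have h1 : L.IsGE a := (isGE_iff L a).2 fun i hi ↦ hz i (Or.inl hi)
    have h2 : L.IsLE a := (isLE_iff L a).2 fun i hi ↦ hz i (Or.inr hi)
    obtain ⟨e⟩ := exists_iso_SF L a
    obtain ⟨κ, c, hc, p, hp⟩ := exists_cofan_surjective W (HH a L)
    obtain ⟨t, ht⟩ := exists_section hc p hW (hq a).1 (hq a).2 f hf (fun i M hM ↦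
      ((hPA i M hM (a - 1) (by lia)).of_iso_left
        ((TD X _).mapIso e ≪≫ TDSF _ a _)).SF_shift (by lia)) hp
    refine HZ.of_iso_left ?_ e.symm
    exact (hz_cofan hW hc hM hm).of_retract_left ((singleFunctor X.Modules a).map t)
      ((singleFunctor X.Modules a).map p)
      (by rw [← Functor.map_comp, ht, CategoryTheory.Functor.map_id])
  | succ k ih =>
    intro a b hab L hz hq hPA M hM m hm
    obtain ⟨κ, c, hc, p, hp⟩ := exists_cofan_surjective W (HH b L)
    have : Epi p := (hq b).1.epi (hq b).2 hW p hp
    obtain ⟨φ, C, g, δ, hT, hC⟩ := exists_attach (show a < b by lia) hz p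
      fun i hi ↦ hz_cofan hW hc (hq (i + 1)).1 hi
    refine HZ.left₂ _ hT (hz_cofan hW hc hM (by lia)) (ih a (b - 1) (by lia) C hC ?_ ?_ M hM m hm)
    · refine ((weakSerre_QCOn W).and (weakSerre_IsSupp W)).of_triangle hT (fun n ↦ ?_) hq
      by_cases hn : n = b
      · subst hn
        let e : c.pt ≅ HH n (SF n c.pt) := (HHSF n c.pt).symm
        exact ⟨(QCOn.cofan hc).of_iso e, (IsSupp.cofan hc).of_epi e.hom⟩
      · have := isZero_HHSF b n hn c.pt
        exact ⟨QCOn.of_isZero this, IsSupp.of_isZero this⟩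
    · intro i N hN j hj
      let V := X.basicOpen (f i)
      obtain ⟨δ', hT'⟩ := exists_TD_triangle V hT
      have hV : IsAffineOpen V := hW.basicOpen _
      refine HZ.left₃ _ hT' (hPA i N hN j hj) ?_
      have := hz_cofan hV (isColimitMapCofan (cut X V) hc (cutOO (X.basicOpen_le _))) hN
        (show j < b - 1 by lia)
      exact this.of_iso_left ((SFshift 1 b (b - 1) (by lia) _).symm ≪≫
        (shiftFunctor _ (1 : ℤ)).mapIso (TDSF V b c.pt).symm)

lemma ALP.PA {a b : ℤ} {L : DerivedCategory X.Modules} (hL : ALP a b L) {W : X.Opens}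
    (hW : IsAffineOpen W) : LN.PA W a L := by
  choose U hxU hU using hL.loc
  have hc : ∀ x : W, ∃ f : Γ(X, W), X.basicOpen f ≤ U x ⊓ W ∧ (x : X) ∈ X.basicOpen f := fun x ↦
    exists_basicOpen_le' hW x.2 ⟨hxU x, x.2⟩
  choose f hf hxf using hc
  have hspan : Ideal.span (Set.range f) = ⊤ := by
    rw [← hW.self_le_iSup_basicOpen_iff]
    intro x hx
    exact Opens.mem_iSup.2 ⟨⟨f ⟨x, hx⟩, ⟨x, hx⟩, rfl⟩, hxf ⟨x, hx⟩⟩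
  obtain ⟨T, hT, hT1⟩ : ∃ T : Finset Γ(X, W), (T : Set Γ(X, W)) ⊆ Set.range f ∧
      Ideal.span (T : Set Γ(X, W)) = ⊤ := by
    obtain ⟨T, hT, h⟩ := Submodule.mem_span_finite_of_mem_span
      ((Ideal.eq_top_iff_one _).1 hspan)
    exact ⟨T, hT, (Ideal.eq_top_iff_one _).2 h⟩
  have hPA (t : T) : LN.PA (X.basicOpen (t : Γ(X, W))) a ((TD X W).obj L) := by
    obtain ⟨x, hx⟩ := hT t.2
    rw [PA_TD_iff (X.basicOpen_le _), ← hx]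
    exact hU x _ ((hf x).trans inf_le_left) (hW.basicOpen _)
  intro M hM m hm
  refine hz_of_cover hW (fun t : T ↦ (t : Γ(X, W))) (by simpa using hT1) (b - a).toNat a
    (a + (b - a).toNat) rfl _ (fun n hn ↦ ?_) (fun n ↦ ?_) hPA M hM m hm
  · obtain ⟨e⟩ := nonempty_TDHH W n L
    exact ((cut X W).map_isZero (hL.zero n (by lia))).of_iso e
  · obtain ⟨e⟩ := nonempty_TDHH W n L
    exact ⟨((qcOn_cut_iff le_rfl _).2 ((hL.qc n).le le_top)).of_iso e.symm,
      (isSupp_cut W _).of_mono e.hom⟩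

end LN

namespace LN

variable {X : Scheme.{u}}

open DerivedCategory Pretriangulated

/-- Mayer-Vietoris induction over the quasi-compact opens of a quasi-separated scheme. -/
lemma qc_induction [QuasiSeparatedSpace X] {F : X.Opens → Prop}
    (haff : ∀ U, IsAffineOpen U → F U) (hMV : ∀ U V, F U → F V → F (U ⊓ V) → F (U ⊔ V))
    (U : X.Opens) (hU : IsCompact (U : Set X)) : F U := by
  classical
  have key {W : X.Opens} (hW : IsAffineOpen W) (T : Finset Γ(X, W)) :
      ∀ g : Γ(X, W), F ((⨆ f ∈ T, X.basicOpen f) ⊓ X.basicOpen g) := by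
    induction T using Finset.induction_on with
    | empty =>
      intro g
      refine haff _ ?_
      simp only [Finset.notMem_empty, iSup_false, iSup_bot, bot_inf_eq]
      exact isAffineOpen_bot X
    | insert h T _ ih =>
      intro g
      rw [Finset.iSup_insert, inf_sup_right]
      refine hMV _ _ ?_ (ih g) ?_
      · rw [← X.basicOpen_mul]
        exact haff _ (hW.basicOpen _)
      · convert ih (h * g) using 1
        rw [X.basicOpen_mul]
        refine le_antisymm (le_inf (inf_le_right.trans inf_le_left) inf_le_left)
          (le_inf inf_le_right (le_inf inf_le_left (inf_le_right.trans inf_le_right)))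
  have key' {V W : X.Opens} (hW : IsAffineOpen W) (hV : IsCompact (V : Set X)) (hVW : V ≤ W) :
      F V := by
    choose f hf hxf using fun x : V ↦ exists_basicOpen_le' hW (hVW x.2) x.2
    obtain ⟨T, hT⟩ := hV.elim_finite_subcover (fun x : V ↦ (X.basicOpen (f x) : Set X))
      (fun x ↦ (X.basicOpen (f x)).2) fun x hx ↦ Set.mem_iUnion.2 ⟨⟨x, hx⟩, hxf ⟨x, hx⟩⟩
    convert key hW (T.image f) 1 using 1
    rw [X.basicOpen_of_isUnit isUnit_one, Finset.iSup_finset_image]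
    refine le_antisymm (le_inf (fun x hx ↦ ?_) hVW) (inf_le_left.trans (iSup₂_le fun x _ ↦ hf x))
    obtain ⟨y, hy, hx⟩ := Set.mem_iUnion₂.1 (hT hx)
    exact le_iSup₂ (f := fun y (_ : y ∈ T) ↦ X.basicOpen (f y)) y hy hx
  refine compact_open_induction_on U hU (haff _ (isAffineOpen_bot X)) fun S hS V h ↦
    hMV _ _ h (haff _ V.2) (key' V.2 ?_ inf_le_right)
  exact QuasiSeparatedSpace.inter_isCompact _ _ S.2 hS V.1.2 V.2.isCompact

variable [HasDerivedCategory.{u+1} X.Modules]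

lemma hz_TD_sup {U V : X.Opens} {L Z : DerivedCategory X.Modules} (hU : HZ ((TD X U).obj L) Z)
    (hV : HZ ((TD X V).obj L) Z) (hUV : HZ (((TD X (U ⊓ V)).obj L)⟦(1 : ℤ)⟧) Z) :
    HZ ((TD X (U ⊔ V)).obj L) Z := by
  obtain ⟨K, ⟨e⟩⟩ : ∃ K, Nonempty (Q.obj K ≅ L) := ⟨_, ⟨Q.objObjPreimageIso L⟩⟩
  let t (U : X.Opens) : (TD X U).obj L ≅ Q.obj ((cutC X U).obj K) :=
    (TD X U).mapIso e.symm ≪≫ TDQ U K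
  intro φ
  rw [← cancel_epi (t _).inv, comp_zero]
  exact (mvSquareC U V K).eq_zero _ (hU.of_iso_left (t U) _) (hV.of_iso_left (t V) _) fun ψ ↦
    ⟨0, 0, by rw [hUV.of_iso_left ((shiftFunctor _ (1 : ℤ)).mapIso (t _)) ψ]; simp⟩

/-- Locally projective complexes have uniformly bounded dimension with respect to quasi-coherent
modules. -/
lemma exists_bound [CompactSpace X] [QuasiSeparatedSpace X] :
    ∃ N : ℤ, 0 ≤ N ∧ ∀ (a b : ℤ) (L : DerivedCategory X.Modules), ALP a b L →
      ∀ M : X.Modules, QCOn ⊤ M → ∀ m < a - N, HZ L (SF m M) := by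
  obtain ⟨N, hN, h⟩ := qc_induction (X := X) (F := fun U ↦ ∃ N : ℤ, 0 ≤ N ∧
      ∀ (a b : ℤ) (L : DerivedCategory X.Modules), ALP a b L →
        ∀ M : X.Modules, QCOn ⊤ M → ∀ m < a - N, HZ ((TD X U).obj L) (SF m M))
    (fun U hU ↦ ⟨0, le_rfl, fun a b L hL M hM m hm ↦ hL.PA hU M (hM.le le_top) m (by lia)⟩) (by
      rintro U V ⟨N₁, h₁, H₁⟩ ⟨N₂, h₂, H₂⟩ ⟨N₃, h₃, H₃⟩
      refine ⟨N₁ + N₂ + N₃ + 1, by lia, fun a b L hL M hM m hm ↦ hz_TD_sup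
        (H₁ a b L hL M hM m (by lia)) (H₂ a b L hL M hM m (by lia)) ?_⟩
      have := (H₃ a b L hL M hM (m + 1) (by lia)).shift (1 : ℤ)
      exact this.of_iso_right (SFshift 1 (m + 1) m (by lia) M)) ⊤ isCompact_univ
  refine ⟨N, hN, fun a b L hL M hM m hm ↦ ?_⟩
  obtain ⟨e⟩ := nonempty_TD_top L
  exact (h a b L hL M hM m hm).of_iso_left e

theorem IsALocallyProjective.hz_of_homology
    [∀ U : X.Opens, HasDerivedCategory.{u + 1} (ModOver X U)] {a : ℤ}
    {E : CochainComplex X.Modules ℤ} (hE : IsALocallyProjective X a E) {N : ℤ}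
    (hN : ∀ (a b : ℤ) (L : DerivedCategory X.Modules), ALP a b L →
      ∀ M : X.Modules, QCOn ⊤ M → ∀ m < a - N, HZ L (SF m M)) (G : DerivedCategory X.Modules)
    (hG : ∀ n : ℤ, (HH n G).IsQuasicoherent)
    (hG' : ∀ j : ℤ, a - (N + 1) < j → IsZero (HH j G)) : HZ (Q.obj E) G := by
  obtain ⟨b, hab, hE⟩ := hE.exists_ALP
  have hq (n : ℤ) (W : X.Opens) : QCOn W (HH n G) := by
    have := hG n
    exact QCOn.of_isQuasicoherent _ W
  have : G.IsLE (a - (N + 1)) := (isLE_iff G _).2 hG'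
  refine HZ.of_homology G (a - (N + 1)) (fun O ↦ ∃ V, IsAffineOpen V ∧ O = OO X V) ?_ ?_ fun i ↦ ?_
  · rintro _ ⟨V, hV, rfl⟩ i j k hij
    exact (hq k V).hz hij hV le_rfl
  · intro L n h
    exact isZero_HH_of_hz L n fun V hV ↦ h _ ⟨V, hV, rfl⟩
  · by_cases hi : a - (N + 1) < i
    · exact HZ.of_isZero_right ((singleFunctor X.Modules i).map_isZero (hG' i hi))
    · exact hN a b _ hE _ (hq i ⊤) i (by lia)
end LN

open LN DerivedCategory in
/-- **Lemma 3.2 of Lipman–Neeman.** For any quasi-compact quasi-separated scheme `X`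
there is an integer `s > 0` such that for every integer `a`, every `a`-locally
projective `O_X`-complex `E`, and every `G ∈ D_qc(X)` with `H^j(G) = 0` for all
`j > a − s`, one has `Hom_{D(X)}(E, G) = 0`. -/
theorem statement_3 (X : Scheme.{u}) [CompactSpace X] [QuasiSeparatedSpace X]
    [HasDerivedCategory.{u + 1} X.Modules]
    [∀ U : X.Opens, HasDerivedCategory.{u + 1} (ModOver X U)] :
    ∃ s : ℤ, 0 < s ∧
      ∀ (a : ℤ) (E : CochainComplex X.Modules ℤ), IsALocallyProjective X a E →
        ∀ G : DerivedCategory X.Modules,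
          (∀ n : ℤ, ((homologyFunctor X.Modules n).obj G).IsQuasicoherent) →
          (∀ j : ℤ, a - s < j → IsZero ((homologyFunctor X.Modules j).obj G)) →
          ∀ f : Q.obj E ⟶ G, f = 0 := by
  obtain ⟨N, hN, h⟩ := exists_bound (X := X)
  exact ⟨N + 1, by lia, fun a E hE G hG hG' ↦ hE.hz_of_homology h G hG hG'⟩
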